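/- Second-order asymptotics for noisy lossy source coding: for a discrete memoryless source P_X observed through a discrete memoryless channel P_{Y|X}, under the stated assumptions, for every ε ∈ (0,1), log M*(n,D,ε) = n R(P_{XY},D) + √(n Ṽ(P_{XY},D)) Q^{-1}(ε) + O(log n) as n → ∞. -/

import Mathlib

/-!
Second-order asymptotics for noisy lossy source coding
(Kostina–Verdú, Theorem `second4noisy`).
-/

open scoped BigOperators

noncomputable section

/-- Probability of an event under a pmf on a finite space. -/
def Pr {Ω : Type*} [Fintype Ω] (μ : Ω → ℝ) (A : Set Ω) : ℝ :=
  ∑ ω, A.indicator μ ω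

/-- Average per-letter distortion of a block. -/
def distn {α β : Type*} {n : ℕ} (d : α → β → ℝ) (xs : Fin n → α) (ys : Fin n → β) : ℝ :=
  (∑ i, d (xs i) (ys i)) / n

/-- A conditional pmf (channel). -/
def IsChannel {α β : Type*} [Fintype β] (W : α → β → ℝ) : Prop :=
  ∀ a, (∀ b, 0 ≤ W a b) ∧ ∑ b, W a b = 1

/-- Mutual information `I(p, W)`. -/
def mutInfo {α β : Type*} [Fintype α] [Fintype β] (p : α → ℝ) (W : α → β → ℝ) : ℝ :=
  ∑ a, ∑ b, p a * W a b * Real.log (W a b / (∑ a', p a' * W a' b))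

/-- Output marginal induced by a source pmf and a channel. -/
def outMarg {α β : Type*} [Fintype α] (p : α → ℝ) (W : α → β → ℝ) : β → ℝ :=
  fun b => ∑ a, p a * W a b

/-- Marginal law of the noisy observation `Y`. -/
def PYof {𝒳 𝒴 : Type*} [Fintype 𝒳] (P : 𝒳 → ℝ) (V : 𝒳 → 𝒴 → ℝ) : 𝒴 → ℝ :=
  fun y => ∑ x, P x * V x y

/-- Backward conditional law `P_{X|Y}` induced by `P` and `V`. -/
def condPXgY {𝒳 𝒴 : Type*} [Fintype 𝒳] (P : 𝒳 → ℝ) (V : 𝒳 → 𝒴 → ℝ) : 𝒳 → 𝒴 → ℝ :=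
  fun x y => P x * V x y / PYof P V y

/-- The noisy rate-distortion function `R(Q_Y P_{X|Y}, D)`, viewed as a function of the
`Y`-marginal `QY` (with the backward channel `PXgY` held fixed). -/
def RN {𝒳 𝒴 Xh : Type*} [Fintype 𝒳] [Fintype 𝒴] [Fintype Xh]
    (QY : 𝒴 → ℝ) (PXgY : 𝒳 → 𝒴 → ℝ) (d : 𝒳 → Xh → ℝ) (D : ℝ) : ℝ :=
  sInf {r | ∃ U : 𝒴 → Xh → ℝ, IsChannel U ∧
    (∑ y, ∑ x, ∑ z, QY y * PXgY x y * U y z * d x z) ≤ D ∧ r = mutInfo QY U}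

/-- The noisy distortion-tilted information density
`ȷ(x,y,x̂|D) = log (U(x̂|y)/Q(x̂)) + λ(d(x,x̂) − D)`. -/
def jNoisy {𝒳 𝒴 Xh : Type*} (U : 𝒴 → Xh → ℝ) (QZ : Xh → ℝ) (d : 𝒳 → Xh → ℝ)
    (lam D : ℝ) : 𝒳 → 𝒴 → Xh → ℝ :=
  fun x y z => Real.log (U y z / QZ z) + lam * (d x z - D)

/-- Mean of a function of `(X,Y,X̂) ∼ P × V × U`. -/
def meanF3 {𝒳 𝒴 Xh : Type*} [Fintype 𝒳] [Fintype 𝒴] [Fintype Xh]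
    (P : 𝒳 → ℝ) (V : 𝒳 → 𝒴 → ℝ) (U : 𝒴 → Xh → ℝ) (g : 𝒳 → 𝒴 → Xh → ℝ) : ℝ :=
  ∑ x, ∑ y, ∑ z, P x * V x y * U y z * g x y z

/-- Variance of a function of `(X,Y,X̂) ∼ P × V × U`. -/
def varF3 {𝒳 𝒴 Xh : Type*} [Fintype 𝒳] [Fintype 𝒴] [Fintype Xh]
    (P : 𝒳 → ℝ) (V : 𝒳 → 𝒴 → ℝ) (U : 𝒴 → Xh → ℝ) (g : 𝒳 → 𝒴 → Xh → ℝ) : ℝ :=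
  ∑ x, ∑ y, ∑ z, P x * V x y * U y z * (g x y z - meanF3 P V U g) ^ 2

/-- Joint i.i.d. law of `(X^n, Y^n)`. -/
def iidJoint {𝒳 𝒴 : Type*} (P : 𝒳 → ℝ) (V : 𝒳 → 𝒴 → ℝ) (n : ℕ) :
    (Fin n → 𝒳) × (Fin n → 𝒴) → ℝ :=
  fun p => ∏ i, P (p.1 i) * V (p.1 i) (p.2 i)

/-- Minimum codebook size for noisy lossy source coding: the encoder observes only `Y^n`. -/
def MstarNoisy {𝒳 𝒴 Xh : Type} [Fintype 𝒳] [Fintype 𝒴] [Fintype Xh]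
    (P : 𝒳 → ℝ) (V : 𝒳 → 𝒴 → ℝ) (d : 𝒳 → Xh → ℝ) (n : ℕ) (D ε : ℝ) : ℕ :=
  sInf {M : ℕ | 0 < M ∧ ∃ (f : (Fin n → 𝒴) → Fin M) (φ : Fin M → (Fin n → Xh)),
    Pr (iidJoint P V n) {p | D < distn d p.1 (φ (f p.2))} ≤ ε}

/-- The Gaussian complementary cdf. -/
def gaussQ (t : ℝ) : ℝ :=
  ∫ u in Set.Ioi t, Real.exp (-u ^ 2 / 2) / Real.sqrt (2 * Real.pi)

open scoped BigOperators
noncomputable section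
open Real MeasureTheory Set Filter Topology

/-- standard normal density -/
def phi (u : ℝ) : ℝ := Real.exp (-u ^ 2 / 2) / Real.sqrt (2 * Real.pi)

/-- standard normal cdf -/
def Phi (t : ℝ) : ℝ := 1 - gaussQ t

lemma phi_pos (u : ℝ) : 0 < phi u := by unfold phi; positivity

lemma phi_eq_pdf : phi = ProbabilityTheory.gaussianPDFReal 0 1 := by
  ext u
  simp [phi, ProbabilityTheory.gaussianPDFReal_def]
  ring

lemma phi_integrable : Integrable phi := by
  rw [phi_eq_pdf]; exact ProbabilityTheory.integrable_gaussianPDFReal 0 1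

lemma phi_integral : ∫ u, phi u = 1 := by
  rw [phi_eq_pdf]; exact ProbabilityTheory.integral_gaussianPDFReal_eq_one 0 (by norm_num)

lemma phi_cont : Continuous phi := by unfold phi; fun_prop

lemma gaussQ_eq (t : ℝ) : gaussQ t = ∫ u in Ioi t, phi u := rfl

lemma phi_neg (u : ℝ) : phi (-u) = phi u := by simp [phi]

lemma phi_le_one (u : ℝ) : phi u ≤ 1 := by
  unfold phi
  rw [div_le_one (by positivity)]
  have h1 : Real.exp (-u ^ 2 / 2) ≤ 1 := by
    rw [Real.exp_le_one_iff]; nlinarith [sq_nonneg u]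
  have h2 : 1 ≤ Real.sqrt (2 * Real.pi) := by
    rw [Real.one_le_sqrt]; nlinarith [Real.pi_gt_three]
  linarith

lemma phi_ge (u : ℝ) (h : |u| ≤ 1) : 1 / 6 ≤ phi u := by
  unfold phi
  have hu : u ^ 2 ≤ 1 := by rw [← sq_abs]; nlinarith [abs_nonneg u]
  have h1 : 1 / 2 ≤ Real.exp (-u ^ 2 / 2) := by
    have := Real.add_one_le_exp (-u ^ 2 / 2); linarith
  have h2 : Real.sqrt (2 * Real.pi) ≤ 51 / 20 := by
    rw [Real.sqrt_le_left (by norm_num)]; nlinarith [Real.pi_lt_d2]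
  rw [le_div_iff₀ (by positivity)]
  linarith

lemma Phi_eq (t : ℝ) : Phi t = ∫ u in Iic t, phi u := by
  unfold Phi; rw [gaussQ_eq, ← phi_integral, ← intervalIntegral.integral_Iic_add_Ioi
    (phi_integrable.integrableOn) (phi_integrable.integrableOn) (b := t)]
  ring

lemma Phi_deriv (t : ℝ) : HasDerivAt Phi (phi t) t := by
  have : ∀ s, Phi s = Phi 0 + ∫ u in (0 : ℝ)..s, phi u := by
    intro s
    rw [Phi_eq, Phi_eq, ← intervalIntegral.integral_Iic_sub_Iic phi_integrable.integrableOn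
      phi_integrable.integrableOn]
    ring
  have h2 : HasDerivAt (fun s => Phi 0 + ∫ u in (0 : ℝ)..s, phi u) (phi t) t := by
    apply HasDerivAt.const_add
    exact intervalIntegral.integral_hasDerivAt_right (phi_cont.intervalIntegrable _ _)
      (phi_cont.stronglyMeasurableAtFilter _ _) phi_cont.continuousAt
  exact h2.congr_of_eventuallyEq (Eventually.of_forall this)

lemma Phi_nonneg (t : ℝ) : 0 ≤ Phi t := by
  rw [Phi_eq]; exact integral_nonneg (fun u => (phi_pos u).le)

lemma gaussQ_nonneg (t : ℝ) : 0 ≤ gaussQ t := by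
  rw [gaussQ_eq]; exact integral_nonneg (fun u => (phi_pos u).le)

lemma Phi_le_one (t : ℝ) : Phi t ≤ 1 := by
  have := gaussQ_nonneg t; unfold Phi; linarith

lemma Phi_neg (t : ℝ) : Phi (-t) = 1 - Phi t := by
  have : Phi (-t) = gaussQ t := by
    rw [Phi_eq, gaussQ_eq, ← integral_comp_neg_Ioi]
    simp [phi_neg]
  rw [this]; unfold Phi; ring

lemma Phi_diff : Differentiable ℝ Phi := fun t => (Phi_deriv t).differentiableAt

lemma Phi_mono : Monotone Phi := by
  apply monotone_of_deriv_nonneg Phi_diff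
  intro x; rw [(Phi_deriv x).deriv]; exact (phi_pos x).le

lemma Phi_lip {a b : ℝ} (h : a ≤ b) : Phi b - Phi a ≤ b - a := by
  have := Convex.image_sub_le_mul_sub_of_deriv_le (convex_univ) (f := Phi) (C := 1)
    Phi_diff.continuous.continuousOn (Phi_diff.differentiableOn)
    (fun x _ => by rw [(Phi_deriv x).deriv]; exact phi_le_one x) a trivial b trivial h
  linarith

lemma Phi_lip' (a b : ℝ) : Phi b ≤ Phi a + |b - a| := by
  rcases le_total a b with h | h
  · have := Phi_lip h; rw [abs_of_nonneg (by linarith)]; linarith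
  · have := Phi_mono h; have := abs_nonneg (b - a); linarith

lemma Phi_lip'' {a b c : ℝ} (hc : 0 ≤ c) (h : b ≤ a + c) : Phi b ≤ Phi a + c := by
  have h1 := Phi_mono h
  have := Phi_lip' a (a + c)
  rw [add_sub_cancel_left, abs_of_nonneg hc] at this
  linarith

lemma Phi_window {x : ℝ} (h0 : 0 ≤ x) (h1 : x ≤ 1) : 2 * x / 6 ≤ Phi x - Phi (-x) := by
  have := (convex_Icc (-1 : ℝ) 1).mul_sub_le_image_sub_of_le_deriv (f := Phi) (C := 1 / 6)
    Phi_diff.continuous.continuousOn (Phi_diff.differentiableOn)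
    (fun y hy => by
      rw [(Phi_deriv y).deriv]
      rw [interior_Icc] at hy
      exact phi_ge y (abs_le.2 ⟨hy.1.le, hy.2.le⟩)) (-x) ⟨by linarith, by linarith⟩ x
      ⟨by linarith, by linarith⟩ (by linarith)
  linarith

/-- Phi grows at a linear rate near `z`. -/
lemma Phi_local (z : ℝ) : ∃ c > 0, ∀ t, 0 ≤ t → t ≤ 1 →
    Phi (z - t) ≤ Phi z - c * t ∧ Phi z + c * t ≤ Phi (z + t) := by
  obtain ⟨x0, hx0, hmin⟩ := isCompact_Icc.exists_isMinOn (s := Icc (z - 1) (z + 1))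
    ⟨z, by simp⟩ phi_cont.continuousOn
  refine ⟨phi x0, phi_pos x0, ?_⟩
  have key := (convex_Icc (z - 1 : ℝ) (z + 1)).mul_sub_le_image_sub_of_le_deriv (f := Phi)
    (C := phi x0)
    Phi_diff.continuous.continuousOn (Phi_diff.differentiableOn)
    (fun y hy => by
      rw [(Phi_deriv y).deriv]
      exact hmin (interior_subset hy))
  intro t h0 h1
  have a := key (z - t) ⟨by linarith, by linarith⟩ z ⟨by linarith, by linarith⟩ (by linarith)
  have b := key z ⟨by linarith, by linarith⟩ (z + t) ⟨by linarith, by linarith⟩ (by linarith)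
  constructor <;> nlinarith

lemma phi_deriv (t : ℝ) : HasDerivAt phi (-t * phi t) t := by
  unfold phi
  have h : HasDerivAt (fun u : ℝ => -u ^ 2 / 2) (-t) t := by
    have := ((hasDerivAt_pow 2 t).fun_neg.div_const 2)
    refine this.congr_deriv ?_
    simp; ring
  refine (h.exp.div_const (Real.sqrt (2 * Real.pi))).congr_deriv ?_
  ring

/-- Mills ratio bound. -/
lemma mills {w : ℝ} (hw : 0 ≤ w) : w * (1 - Phi w) ≤ phi w := by
  have h : (1 - Phi w) = ∫ u in Ioi w, phi u := by unfold Phi; rw [gaussQ_eq]; ring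
  have tend : Tendsto phi atTop (𝓝 0) := by
    have : Tendsto (fun u : ℝ => Real.exp (-u ^ 2 / 2)) atTop (𝓝 0) := by
      apply Real.tendsto_exp_atBot.comp
      have : Tendsto (fun u : ℝ => u ^ 2 / 2) atTop atTop :=
        (tendsto_pow_atTop (by norm_num)).atTop_div_const (by norm_num)
      have := tendsto_neg_atTop_atBot.comp this
      refine this.congr (fun u => by simp; ring)
    have := this.div_const (Real.sqrt (2 * Real.pi))
    rw [zero_div] at this
    exact this
  have h1 : IntegrableOn (fun u => u * phi u) (Ioi w) := by
    apply integrableOn_Ioi_deriv_of_nonneg' (g := fun u => - phi u) (l := 0)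
    · intro x _; exact (phi_deriv x).fun_neg.congr_deriv (by ring)
    · intro x hx; exact mul_nonneg (le_trans hw (le_of_lt hx)) (phi_pos x).le
    · simpa using tend.neg
  have h2 : ∫ u in Ioi w, u * phi u = phi w := by
    have := integral_Ioi_of_hasDerivAt_of_tendsto' (a := w) (f := fun u => - phi u)
      (f' := fun u => u * phi u) (m := 0)
      (fun x _ => by exact (phi_deriv x).fun_neg.congr_deriv (by ring)) h1 (by simpa using tend.neg)
    rw [this]; ring
  rw [h, ← h2, ← integral_const_mul]
  apply setIntegral_mono_on (phi_integrable.integrableOn.const_mul w) h1 measurableSet_Ioi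
  intro x hx
  exact mul_le_mul_of_nonneg_right (le_of_lt hx) (phi_pos x).le

lemma mills2 {w : ℝ} (hw : 0 ≤ w) : (1 - Phi w) ≤ 6 * phi w := by
  rcases le_total w 1 with h | h
  · have := phi_ge w (by rw [abs_of_nonneg hw]; exact h)
    have := Phi_nonneg w; linarith
  · have := mills hw
    have := Phi_le_one w
    have := phi_pos w
    nlinarith

end

open scoped BigOperators
noncomputable section
open Real Set Filter Topology

/-- Stein solution for the half line `(-∞, z]`. -/
def stn (z w : ℝ) : ℝ := (Phi (min w z) - Phi w * Phi z) / phi w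

lemma stn_num_nonneg (z w : ℝ) : 0 ≤ Phi (min w z) - Phi w * Phi z := by
  have a := Phi_nonneg w; have b := Phi_nonneg z
  have c := Phi_le_one w; have d := Phi_le_one z
  rcases le_total w z with h | h
  · rw [min_eq_left h]; nlinarith
  · rw [min_eq_right h]; nlinarith

lemma stn_num_le (z w : ℝ) : Phi (min w z) - Phi w * Phi z ≤ 1 - Phi |w| := by
  have a := Phi_nonneg w; have b := Phi_nonneg z
  have c := Phi_le_one w; have d := Phi_le_one z
  have k1 : Phi (min w z) - Phi w * Phi z ≤ Phi w := by
    have := Phi_mono (min_le_left w z); nlinarith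
  have k2 : Phi (min w z) - Phi w * Phi z ≤ 1 - Phi w := by
    rcases le_total w z with h | h
    · rw [min_eq_left h]; have := Phi_mono h; nlinarith
    · rw [min_eq_right h]; nlinarith
  rcases le_total 0 w with h | h
  · rw [abs_of_nonneg h]; exact k2
  · rw [abs_of_nonpos h, Phi_neg]; linarith

lemma phi_abs (w : ℝ) : phi |w| = phi w := by
  rcases le_total 0 w with h | h
  · rw [abs_of_nonneg h]
  · rw [abs_of_nonpos h, phi_neg]

lemma stn_nonneg (z w : ℝ) : 0 ≤ stn z w := div_nonneg (stn_num_nonneg z w) (phi_pos w).le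

lemma stn_le (z w : ℝ) : stn z w ≤ 6 := by
  unfold stn
  rw [div_le_iff₀ (phi_pos w)]
  have := mills2 (abs_nonneg w)
  rw [phi_abs] at this
  linarith [stn_num_le z w]

lemma stn_mul_le (z w : ℝ) : |w * stn z w| ≤ 1 := by
  rw [abs_mul, abs_of_nonneg (stn_nonneg z w)]
  unfold stn
  rw [← mul_div_assoc, div_le_iff₀ (phi_pos w)]
  have := mills (abs_nonneg w)
  rw [phi_abs] at this
  nlinarith [stn_num_le z w, abs_nonneg w]

lemma stn_cont (z : ℝ) : Continuous (stn z) := by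
  unfold stn
  apply Continuous.div
  · have := Phi_diff.continuous
    fun_prop
  · exact phi_cont
  · intro w; exact (phi_pos w).ne'

lemma stn_deriv_lt {z w : ℝ} (h : w < z) :
    HasDerivAt (stn z) (w * stn z w + 1 - Phi z) w := by
  have h1 : HasDerivAt (fun w => (Phi w - Phi w * Phi z) / phi w)
      (w * stn z w + 1 - Phi z) w := by
    refine (((Phi_deriv w).sub ((Phi_deriv w).mul_const (Phi z))).div (phi_deriv w)
      (phi_pos w).ne').congr_deriv ?_
    unfold stn; rw [min_eq_left h.le]
    have := (phi_pos w).ne'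
    simp only [Pi.sub_apply]
    field_simp
    ring
  apply h1.congr_of_eventuallyEq
  filter_upwards [Iio_mem_nhds h] with u hu
  unfold stn; rw [min_eq_left (le_of_lt hu)]

lemma stn_deriv_gt {z w : ℝ} (h : z < w) :
    HasDerivAt (stn z) (w * stn z w - Phi z) w := by
  have h1 : HasDerivAt (fun w => (Phi z - Phi w * Phi z) / phi w)
      (w * stn z w - Phi z) w := by
    refine ((((Phi_deriv w).mul_const (Phi z)).const_sub (Phi z)).div (phi_deriv w)
      (phi_pos w).ne').congr_deriv ?_
    unfold stn; rw [min_eq_right h.le]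
    have := (phi_pos w).ne'
    field_simp
    ring
  apply h1.congr_of_eventuallyEq
  filter_upwards [Ioi_mem_nhds h] with u hu
  unfold stn; rw [min_eq_right (le_of_lt hu)]

/-- mean value bound with one exceptional point -/
lemma mv_split {f : ℝ → ℝ} (hf : Continuous f) {a b m : ℝ} (hab : a ≤ b) (z : ℝ)
    (hd : ∀ u, a < u → u < b → u ≠ z → DifferentiableAt ℝ f u ∧ m ≤ deriv f u) :
    m * (b - a) ≤ f b - f a := by
  have base : ∀ p q, p ≤ q → a ≤ p → q ≤ b → (q ≤ z ∨ z ≤ p) → m * (q - p) ≤ f q - f p := by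
    intro p q hpq hp hq hz
    have hu : ∀ u, u ∈ interior (Icc p q) → DifferentiableAt ℝ f u ∧ m ≤ deriv f u := by
      intro u hu
      rw [interior_Icc] at hu
      apply hd u (lt_of_le_of_lt hp hu.1) (lt_of_lt_of_le hu.2 hq)
      rcases hz with h | h
      · exact (lt_of_lt_of_le hu.2 h).ne
      · exact (lt_of_le_of_lt h hu.1).ne'
    exact (convex_Icc p q).mul_sub_le_image_sub_of_le_deriv hf.continuousOn
      (fun u h => (hu u h).1.differentiableWithinAt) (fun u h => (hu u h).2) p
      (left_mem_Icc.2 hpq) q (right_mem_Icc.2 hpq) hpq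
  by_cases h1 : b ≤ z
  · exact base a b hab le_rfl le_rfl (Or.inl h1)
  by_cases h2 : z ≤ a
  · exact base a b hab le_rfl le_rfl (Or.inr h2)
  push Not at h1 h2
  have := base a z h2.le le_rfl h1.le (Or.inl le_rfl)
  have := base z b h1.le h2.le le_rfl (Or.inr le_rfl)
  nlinarith

lemma stn_deriv_bd (z u : ℝ) (h : u ≠ z) : DifferentiableAt ℝ (stn z) u ∧
    u * stn z u - Phi z ≤ deriv (stn z) u ∧ |deriv (stn z) u| ≤ 2 := by
  have h1 := Phi_nonneg z; have h2 := Phi_le_one z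
  have h3 := abs_le.1 (stn_mul_le z u)
  rcases lt_or_gt_of_ne h with h | h
  · have := stn_deriv_lt h
    refine ⟨this.differentiableAt, ?_, ?_⟩
    · rw [this.deriv]; linarith
    · rw [this.deriv, abs_le]; constructor <;> linarith
  · have := stn_deriv_gt h
    refine ⟨this.differentiableAt, ?_, ?_⟩
    · rw [this.deriv]
    · rw [this.deriv, abs_le]; constructor <;> linarith

lemma stn_lip_aux (z : ℝ) {a b : ℝ} (hab : a ≤ b) : |stn z b - stn z a| ≤ 2 * (b - a) := by
  rw [abs_le]; constructor
  · have := mv_split (stn_cont z) (m := -2) hab z (fun u _ _ hu =>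
      ⟨(stn_deriv_bd z u hu).1, (abs_le.1 (stn_deriv_bd z u hu).2.2).1⟩)
    linarith
  · have := mv_split (stn_cont z).neg (m := -2) hab z (fun u _ _ hu =>
      ⟨(stn_deriv_bd z u hu).1.neg, by
        rw [deriv.neg]; linarith [(abs_le.1 (stn_deriv_bd z u hu).2.2).2]⟩)
    simp only [Pi.neg_apply] at this
    linarith

lemma stn_lip (z a b : ℝ) : |stn z b - stn z a| ≤ 2 * |b - a| := by
  rcases le_total a b with h | h
  · rw [abs_of_nonneg (by linarith : 0 ≤ b - a)]; exact stn_lip_aux z h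
  · rw [abs_sub_comm, abs_sub_comm b a, abs_of_nonneg (by linarith : 0 ≤ a - b)]
    exact stn_lip_aux z h

lemma stn_g_lip (z u w : ℝ) : |u * stn z u - w * stn z w| ≤ |u - w| * (6 + 2 * |w|) := by
  have : u * stn z u - w * stn z w = (u - w) * stn z u + w * (stn z u - stn z w) := by ring
  rw [this]
  refine (abs_add_le _ _).trans ?_
  rw [abs_mul, abs_mul, abs_of_nonneg (stn_nonneg z u)]
  have := stn_lip z w u
  have := stn_le z u
  nlinarith [abs_nonneg (u - w), abs_nonneg w]

/-- pointwise Stein inequality -/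
lemma stn_step (z w x δ : ℝ) (hx : |x| ≤ δ) :
    x ^ 2 * (w * stn z w + (if w + δ ≤ z then 1 else 0) - Phi z - δ * (6 + 2 * |w|)) ≤
      x * (stn z (w + x) - stn z w) := by
  set m := w * stn z w + (if w + δ ≤ z then 1 else 0) - Phi z - δ * (6 + 2 * |w|) with hm
  have hδ := abs_le.1 hx
  have key : ∀ u, |u - w| ≤ δ → u ≠ z → DifferentiableAt ℝ (stn z) u ∧ m ≤ deriv (stn z) u := by
    intro u hu huz
    refine ⟨(stn_deriv_bd z u huz).1, ?_⟩
    have g := (abs_le.1 (stn_g_lip z u w)).1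
    have g2 : |u - w| * (6 + 2 * |w|) ≤ δ * (6 + 2 * |w|) :=
      mul_le_mul_of_nonneg_right hu (by positivity)
    by_cases h : w + δ ≤ z
    · have : u < z := lt_of_le_of_ne (by linarith [(abs_le.1 hu).2]) huz
      rw [(stn_deriv_lt this).deriv, hm, if_pos h]; linarith
    · rw [hm, if_neg h]
      linarith [(stn_deriv_bd z u huz).2.1]
  rcases le_total 0 x with h | h
  · have := mv_split (stn_cont z) (a := w) (b := w + x) (m := m) (by linarith) z (fun u h1 h2 h3 =>
      key u (by rw [abs_le]; constructor <;> linarith) h3)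
    nlinarith
  · have := mv_split (stn_cont z) (a := w + x) (b := w) (m := m) (by linarith) z (fun u h1 h2 h3 =>
      key u (by rw [abs_le]; constructor <;> linarith) h3)
    nlinarith
end

open scoped BigOperators
noncomputable section
open Real Set Filter Topology

/-- numerical indicator of a proposition -/
def ind (p : Prop) : ℝ := open Classical in if p then 1 else 0

lemma ind_true {p : Prop} (h : p) : ind p = 1 := by simp [ind, h]
lemma ind_false {p : Prop} (h : ¬ p) : ind p = 0 := by simp [ind, h]
lemma ind_nonneg (p : Prop) : 0 ≤ ind p := by unfold ind; split_ifs <;> norm_num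
lemma ind_le_one (p : Prop) : ind p ≤ 1 := by unfold ind; split_ifs <;> norm_num
lemma ind_mono {p q : Prop} (h : p → q) : ind p ≤ ind q := by
  by_cases hp : p
  · rw [ind_true hp, ind_true (h hp)]
  · rw [ind_false hp]; exact ind_nonneg q
lemma ind_not (p : Prop) : ind (¬ p) = 1 - ind p := by
  by_cases hp : p
  · rw [ind_true hp, ind_false (not_not.2 hp)]; ring
  · rw [ind_false hp, ind_true hp]; ring
lemma ind_congr {p q : Prop} (h : p ↔ q) : ind p = ind q := by rw [propext h]

section
variable {α : Type} [Fintype α] {n : ℕ}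

/-- mean of a function under weights -/
def mn (p : α → ℝ) (f : α → ℝ) : ℝ := ∑ a, p a * f a
/-- variance of a function under weights -/
def vr (p : α → ℝ) (f : α → ℝ) : ℝ := ∑ a, p a * (f a - mn p f) ^ 2

/-- expectation under a product law -/
def ew (w : Fin n → α → ℝ) (F : (Fin n → α) → ℝ) : ℝ := ∑ ω, (∏ i, w i (ω i)) * F ω

lemma mn_mono {p : α → ℝ} (hp : ∀ a, 0 ≤ p a) {f g : α → ℝ} (h : ∀ a, p a ≠ 0 → f a ≤ g a) :
    mn p f ≤ mn p g := by
  apply Finset.sum_le_sum; intro a _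
  by_cases h0 : p a = 0
  · simp [h0]
  · exact mul_le_mul_of_nonneg_left (h a h0) (hp a)

lemma mn_const {p : α → ℝ} (hp : ∑ a, p a = 1) (c : ℝ) : mn p (fun _ => c) = c := by
  unfold mn; rw [← Finset.sum_mul, hp, one_mul]

lemma mn_add (p f g : α → ℝ) : mn p (fun a => f a + g a) = mn p f + mn p g := by
  unfold mn; simp_rw [mul_add]; rw [Finset.sum_add_distrib]
lemma mn_sub (p f g : α → ℝ) : mn p (fun a => f a - g a) = mn p f - mn p g := by
  unfold mn; simp_rw [mul_sub]; rw [Finset.sum_sub_distrib]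
lemma mn_mul (p f : α → ℝ) (c : ℝ) : mn p (fun a => c * f a) = c * mn p f := by
  unfold mn; rw [Finset.mul_sum]; apply Finset.sum_congr rfl; intros; ring

lemma abs_mn_le {p : α → ℝ} (hp : ∀ a, 0 ≤ p a) (h1 : ∑ a, p a = 1) {f : α → ℝ} {b : ℝ}
    (h : ∀ a, |f a| ≤ b) : |mn p f| ≤ b := by
  rw [abs_le]; constructor
  · have := mn_mono hp (f := fun _ => -b) (g := f) (fun a _ => (abs_le.1 (h a)).1)
    rwa [mn_const h1] at this
  · have := mn_mono hp (g := fun _ => b) (f := f) (fun a _ => (abs_le.1 (h a)).2)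
    rwa [mn_const h1] at this

lemma vr_eq {p : α → ℝ} (h1 : ∑ a, p a = 1) (f : α → ℝ) (c : ℝ) :
    mn p (fun a => (f a - c) ^ 2) = vr p f + (mn p f - c) ^ 2 := by
  have : ∀ a, p a * (f a - c) ^ 2 = p a * (f a - mn p f) ^ 2 + 2 * (mn p f - c) * (p a * f a)
    + p a * (c ^ 2 - (mn p f) ^ 2) := by intro a; ring
  unfold vr mn at *
  simp_rw [this]
  rw [Finset.sum_add_distrib, Finset.sum_add_distrib, ← Finset.mul_sum, ← Finset.sum_mul, h1]
  ring

lemma vr_nonneg {p : α → ℝ} (hp : ∀ a, 0 ≤ p a) (f : α → ℝ) : 0 ≤ vr p f :=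
  Finset.sum_nonneg fun a _ => mul_nonneg (hp a) (sq_nonneg _)

lemma ew_mono {w : Fin n → α → ℝ} (hw : IsChannel w) {F G : (Fin n → α) → ℝ}
    (h : ∀ ω, (∀ i, w i (ω i) ≠ 0) → F ω ≤ G ω) : ew w F ≤ ew w G := by
  apply Finset.sum_le_sum; intro ω _
  by_cases h0 : ∀ i, w i (ω i) ≠ 0
  · exact mul_le_mul_of_nonneg_left (h ω h0) (Finset.prod_nonneg fun i _ => (hw i).1 _)
  · push Not at h0
    obtain ⟨i, hi⟩ := h0
    rw [Finset.prod_eq_zero (Finset.mem_univ i) hi]; simp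

lemma ew_add (w : Fin n → α → ℝ) (F G : (Fin n → α) → ℝ) :
    ew w (fun ω => F ω + G ω) = ew w F + ew w G := by
  unfold ew; simp_rw [mul_add]; rw [Finset.sum_add_distrib]
lemma ew_sub (w : Fin n → α → ℝ) (F G : (Fin n → α) → ℝ) :
    ew w (fun ω => F ω - G ω) = ew w F - ew w G := by
  unfold ew; simp_rw [mul_sub]; rw [Finset.sum_sub_distrib]
lemma ew_mul (w : Fin n → α → ℝ) (c : ℝ) (F : (Fin n → α) → ℝ) :
    ew w (fun ω => c * F ω) = c * ew w F := by
  unfold ew; rw [Finset.mul_sum]; apply Finset.sum_congr rfl; intros; ring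
lemma ew_sum {κ : Type} (s : Finset κ) (w : Fin n → α → ℝ) (F : κ → (Fin n → α) → ℝ) :
    ew w (fun ω => ∑ k ∈ s, F k ω) = ∑ k ∈ s, ew w (F k) := by
  unfold ew; rw [Finset.sum_comm]; apply Finset.sum_congr rfl; intros; rw [Finset.mul_sum]

lemma ew_prod (w h : Fin n → α → ℝ) :
    ew w (fun ω => ∏ i, h i (ω i)) = ∏ i, mn (w i) (h i) := by
  unfold ew mn
  rw [Finset.prod_univ_sum]
  simp_rw [← Finset.prod_mul_distrib]
  rw [Fintype.piFinset_univ]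

lemma ew_const {w : Fin n → α → ℝ} (hw : IsChannel w) (c : ℝ) : ew w (fun _ => c) = c := by
  have := ew_prod w (fun _ _ => 1)
  have h2 : ew w (fun _ => c) = c * ew w (fun _ => 1) := by rw [← ew_mul]; simp
  rw [h2]
  simp only [Finset.prod_const_one] at this
  rw [this]
  have : ∀ i, mn (w i) (fun _ => 1) = 1 := fun i => mn_const (hw i).2 1
  simp [this]

lemma ew_nonneg {w : Fin n → α → ℝ} (hw : IsChannel w) {F : (Fin n → α) → ℝ}
    (h : ∀ ω, 0 ≤ F ω) : 0 ≤ ew w F :=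
  Finset.sum_nonneg fun ω _ => mul_nonneg (Finset.prod_nonneg fun i _ => (hw i).1 _) (h ω)

lemma ew_ind_le_one {w : Fin n → α → ℝ} (hw : IsChannel w) (A : (Fin n → α) → Prop) :
    ew w (fun ω => ind (A ω)) ≤ 1 := by
  have := ew_mono hw (F := fun ω => ind (A ω)) (G := fun _ => 1) (fun ω _ => ind_le_one _)
  rwa [ew_const hw] at this

/-- resampling one coordinate -/
lemma ew_resample {w : Fin n → α → ℝ} (hw : IsChannel w) (i : Fin n) (F : (Fin n → α) → ℝ) :
    ew w F = ew w (fun ω => mn (w i) (fun a => F (Function.update ω i a))) := by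
  classical
  let e : ((Fin n → α) × α) ≃ ((Fin n → α) × α) :=
    Function.Involutive.toPerm (fun p => (Function.update p.1 i p.2, p.1 i)) (by
      intro p; simp)
  have h1 : ew w F = ∑ p : (Fin n → α) × α, (∏ j, w j (p.1 j)) * (w i p.2) * F p.1 := by
    rw [Fintype.sum_prod_type]
    unfold ew
    apply Finset.sum_congr rfl; intro ω _
    simp only
    rw [← Finset.sum_mul, ← Finset.mul_sum, (hw i).2, mul_one]
  rw [h1, ← e.sum_comp]
  rw [Fintype.sum_prod_type]
  unfold ew mn
  apply Finset.sum_congr rfl; intro ω _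
  rw [Finset.mul_sum]
  apply Finset.sum_congr rfl; intro a _
  change (∏ j, w j (Function.update ω i a j)) * w i (ω i) * F (Function.update ω i a) = _
  have h2 : (∏ j, w j (Function.update ω i a j)) * w i (ω i) = (∏ j, w j (ω j)) * w i a := by
    rw [← Finset.mul_prod_erase Finset.univ (fun j => w j (Function.update ω i a j))
      (Finset.mem_univ i), ← Finset.mul_prod_erase Finset.univ (fun j => w j (ω j))
      (Finset.mem_univ i)]
    have : ∏ x ∈ Finset.univ.erase i, w x (Function.update ω i a x)
        = ∏ x ∈ Finset.univ.erase i, w x (ω x) := by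
      apply Finset.prod_congr rfl
      intro x hx
      rw [Function.update_of_ne (Finset.ne_of_mem_erase hx)]
    rw [this]; simp only [Function.update_self]; ring
  rw [h2]; ring

lemma sum_update (f : Fin n → α → ℝ) (ω : Fin n → α) (i : Fin n) (a : α) :
    ∑ j, f j (Function.update ω i a j) = (∑ j, f j (ω j) - f i (ω i)) + f i a := by
  classical
  rw [← Finset.add_sum_erase Finset.univ (fun j => f j (Function.update ω i a j))
      (Finset.mem_univ i), ← Finset.add_sum_erase Finset.univ (fun j => f j (ω j))
      (Finset.mem_univ i)]
  have : ∑ x ∈ Finset.univ.erase i, f x (Function.update ω i a x)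
        = ∑ x ∈ Finset.univ.erase i, f x (ω x) := by
      apply Finset.sum_congr rfl
      intro x hx
      rw [Function.update_of_ne (Finset.ne_of_mem_erase hx)]
  rw [this]; simp only [Function.update_self]; ring

/-- Stein identity in difference form -/
lemma stein_id {w : Fin n → α → ℝ} (hw : IsChannel w) (f : Fin n → α → ℝ)
    (h0 : ∀ i, mn (w i) (f i) = 0) (G : ℝ → ℝ) :
    ew w (fun ω => (∑ i, f i (ω i)) * G (∑ i, f i (ω i))) =
      ∑ i, ew w (fun ω => mn (w i) (fun a => f i a *
        (G ((∑ j, f j (ω j) - f i (ω i)) + f i a) - G (∑ j, f j (ω j) - f i (ω i))))) := by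
  have h1 : ew w (fun ω => (∑ i, f i (ω i)) * G (∑ i, f i (ω i))) =
      ∑ i, ew w (fun ω => f i (ω i) * G (∑ j, f j (ω j))) := by
    rw [← ew_sum]; congr 1; ext ω; rw [Finset.sum_mul]
  rw [h1]
  apply Finset.sum_congr rfl; intro i _
  rw [ew_resample hw i]
  congr 1; ext ω
  simp only [sum_update, Function.update_self]
  simp_rw [mul_sub]
  rw [mn_sub]
  have : mn (w i) (fun a => f i a * G (∑ j, f j (ω j) - f i (ω i))) = 0 := by
    have := h0 i
    unfold mn at *
    simp_rw [← mul_assoc]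
    rw [← Finset.sum_mul, this, zero_mul]
  rw [this, sub_zero]

lemma second_moment {w : Fin n → α → ℝ} (hw : IsChannel w) (f : Fin n → α → ℝ)
    (h0 : ∀ i, mn (w i) (f i) = 0) :
    ew w (fun ω => (∑ i, f i (ω i)) ^ 2) = ∑ i, mn (w i) (fun a => f i a ^ 2) := by
  have := stein_id hw f h0 id
  simp only [id, add_sub_cancel_left] at this
  simp_rw [sq]
  rw [this]
  apply Finset.sum_congr rfl; intro i _
  rw [ew_const hw]

lemma be_upper {w : Fin n → α → ℝ} (hw : IsChannel w) (f : Fin n → α → ℝ)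
    (h0 : ∀ i, mn (w i) (f i) = 0) {δ : ℝ} (hδ : ∀ i a, |f i a| ≤ δ) (hδ0 : 0 ≤ δ)
    (hv : ∑ i, mn (w i) (fun a => f i a ^ 2) = 1) (x : ℝ) :
    ew w (fun ω => ind (∑ i, f i (ω i) ≤ x)) ≤ Phi x + 20 * δ := by
  by_cases hδ1 : 1 < δ
  · have := ew_ind_le_one hw (fun ω => ∑ i, f i (ω i) ≤ x)
    have := Phi_nonneg x
    linarith
  push Not at hδ1
  set z := x + 2 * δ with hz
  have hid := stein_id hw f h0 (stn z)
  have step : ∀ i, mn (w i) (fun a => f i a ^ 2) * (ew w (fun ω =>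
      (∑ j, f j (ω j)) * stn z (∑ j, f j (ω j)) + ind (∑ j, f j (ω j) ≤ x) - Phi z
        - δ * (16 + 2 * (∑ j, f j (ω j)) ^ 2))) ≤
      ew w (fun ω => mn (w i) (fun a => f i a *
        (stn z ((∑ j, f j (ω j) - f i (ω i)) + f i a) - stn z (∑ j, f j (ω j) - f i (ω i))))) := by
    intro i
    rw [← ew_mul]
    apply ew_mono hw
    intro ω _
    set W := ∑ j, f j (ω j) with hW
    set y := W - f i (ω i) with hy
    have hyW : |y - W| ≤ δ := by
      rw [hy, abs_sub_comm]; simpa using hδ i (ω i)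
    rw [mul_comm, ← mn_mul]
    apply mn_mono (hw i).1
    intro a _
    refine le_trans ?_ (stn_step z y (f i a) δ (hδ i a))
    rw [mul_comm]
    apply mul_le_mul_of_nonneg_left _ (sq_nonneg _)
    have g := (abs_le.1 (stn_g_lip z y W)).1
    have g2 : |y - W| * (6 + 2 * |W|) ≤ δ * (6 + 2 * |W|) :=
      mul_le_mul_of_nonneg_right hyW (by positivity)
    have g3 : |y| ≤ |W| + 1 := by
      have := abs_sub_abs_le_abs_sub y W; linarith
    have g4 : ind (W ≤ x) ≤ (if y + δ ≤ z then (1 : ℝ) else 0) := by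
      by_cases h : W ≤ x
      · rw [ind_true h, if_pos]; linarith [(abs_le.1 hyW).2]
      · rw [ind_false h]; split_ifs <;> norm_num
    have g5 : |W| ≤ (1 + W ^ 2) / 2 := by
      rw [← sq_abs W]; nlinarith [sq_nonneg (|W| - 1)]
    have g6 : δ * (14 + 4 * |W|) ≤ δ * (16 + 2 * W ^ 2) :=
      mul_le_mul_of_nonneg_left (by linarith) hδ0
    have g7 : δ * (6 + 2 * |y|) ≤ δ * (8 + 2 * |W|) :=
      mul_le_mul_of_nonneg_left (by linarith) hδ0
    linarith
  have hs := Finset.sum_le_sum (fun i (_ : i ∈ Finset.univ) => step i)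
  rw [← Finset.sum_mul, hv, one_mul, ← hid] at hs
  rw [ew_sub, ew_sub, ew_add, ew_const hw, ew_mul, ew_add, ew_const hw, ew_mul,
    second_moment hw f h0, hv] at hs
  have := Phi_lip (show x ≤ z by linarith)
  linarith

theorem berry {w : Fin n → α → ℝ} (hw : IsChannel w) (f : Fin n → α → ℝ)
    {b : ℝ} (hf : ∀ i a, |f i a| ≤ b) (hb : 0 ≤ b) {σ : ℝ} (hσ : 0 < σ)
    (hv : ∑ i, vr (w i) (f i) = σ ^ 2) (x : ℝ) :
    |ew w (fun ω => ind (∑ i, f i (ω i) ≤ x)) - Phi ((x - ∑ i, mn (w i) (f i)) / σ)|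
      ≤ 40 * b / σ := by
  have hm : ∀ i, |mn (w i) (f i)| ≤ b := fun i => abs_mn_le (hw i).1 (hw i).2 (hf i)
  set μ := ∑ i, mn (w i) (f i)
  have A : ∀ s : ℝ, |s| = 1 → ∀ y, ew w (fun ω => ind (∑ i, (s * (f i (ω i) - mn (w i) (f i)) / σ) ≤ y))
      ≤ Phi y + 20 * (2 * b / σ) := by
    intro s hs y
    have hs2 : s ^ 2 = 1 := by rw [← sq_abs, hs]; norm_num
    refine be_upper hw (fun i a => s * (f i a - mn (w i) (f i)) / σ) ?_ ?_ (by positivity) ?_ y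
    · intro i
      have : mn (w i) (fun a => s * (f i a - mn (w i) (f i)) / σ)
          = (s / σ) * (mn (w i) (f i) - mn (w i) (fun _ => mn (w i) (f i))) := by
        rw [← mn_sub, ← mn_mul]; congr 1; ext a; ring
      rw [this, mn_const (hw i).2]; ring
    · intro i a
      rw [abs_div, abs_mul, hs, abs_of_pos hσ, one_mul]
      apply div_le_div_of_nonneg_right _ hσ.le
      have := abs_sub (f i a) (mn (w i) (f i))
      linarith [hf i a, hm i]
    · have : ∀ i, mn (w i) (fun a => (s * (f i a - mn (w i) (f i)) / σ) ^ 2) =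
        vr (w i) (f i) / σ ^ 2 := by
        intro i
        unfold vr mn
        rw [Finset.sum_div]
        apply Finset.sum_congr rfl; intro a _
        beta_reduce
        rw [div_pow, mul_pow, hs2]; ring
      simp_rw [this]
      rw [← Finset.sum_div, hv, div_self (by positivity)]
  have hsum : ∀ (s : ℝ) (ω : Fin n → α), ∑ i, (s * (f i (ω i) - mn (w i) (f i)) / σ) =
      s * (∑ i, f i (ω i) - μ) / σ := by
    intro s ω
    rw [← Finset.sum_div, ← Finset.mul_sum, Finset.sum_sub_distrib]
  rw [abs_le]
  constructor
  · have h := A (-1) (by simp) (-((x - μ) / σ))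
    have h2 : ew w (fun ω => ind (¬ (∑ i, f i (ω i) ≤ x))) ≤
        ew w (fun ω => ind (∑ i, ((-1) * (f i (ω i) - mn (w i) (f i)) / σ) ≤ -((x - μ) / σ))) := by
      apply ew_mono hw
      intro ω _
      apply ind_mono
      intro h
      push Not at h
      rw [hsum, ← neg_div]
      apply div_le_div_of_nonneg_right _ hσ.le
      linarith
    simp_rw [ind_not] at h2
    rw [ew_sub, ew_const hw] at h2
    rw [Phi_neg] at h
    have : 20 * (2 * b / σ) = 40 * b / σ := by ring
    linarith
  · have h := A 1 (by simp) ((x - μ) / σ)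
    have h2 : ew w (fun ω => ind (∑ i, f i (ω i) ≤ x)) ≤
        ew w (fun ω => ind (∑ i, (1 * (f i (ω i) - mn (w i) (f i)) / σ) ≤ ((x - μ) / σ))) := by
      apply ew_mono hw
      intro ω _
      apply ind_mono
      intro h
      rw [hsum]
      apply div_le_div_of_nonneg_right _ hσ.le
      linarith
    have : 20 * (2 * b / σ) = 40 * b / σ := by ring
    linarith

/-- Hoeffding, lower tail -/
theorem hoeff_aux {w : Fin n → α → ℝ} (hw : IsChannel w) (f : Fin n → α → ℝ)
    (h0 : ∀ i, mn (w i) (f i) = 0) {b : Fin n → ℝ} (hf : ∀ i a, w i a ≠ 0 → |f i a| ≤ b i)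
    {B : ℝ} (hB : 0 < B) (hbB : ∑ i, b i ^ 2 ≤ B) {t : ℝ} (ht : 0 ≤ t) :
    ew w (fun ω => ind (t ≤ ∑ i, f i (ω i))) ≤ Real.exp (-(t ^ 2 / (2 * B))) := by
  set s := t / B with hs
  have hs0 : 0 ≤ s := by positivity
  have h1 : ew w (fun ω => ind (t ≤ ∑ i, f i (ω i))) ≤
      ew w (fun ω => Real.exp (-(s * t)) * ∏ i, Real.exp (s * f i (ω i))) := by
    apply ew_mono hw
    intro ω _
    rw [← Real.exp_sum, ← Real.exp_add]
    by_cases h : t ≤ ∑ i, f i (ω i)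
    · rw [ind_true h, ← Finset.mul_sum]
      apply Real.one_le_exp
      nlinarith
    · rw [ind_false h]; positivity
  rw [ew_mul, ew_prod w (fun i a => Real.exp (s * f i a))] at h1
  have h2 : ∀ i, mn (w i) (fun a => Real.exp (s * f i a)) ≤ Real.exp (s ^ 2 * b i ^ 2 / 2) := by
    intro i
    have hw1 := hw i
    have bnn : 0 ≤ b i := by
      obtain ⟨a, ha⟩ : ∃ a, w i a ≠ 0 := by
        by_contra hc
        push Not at hc
        have := hw1.2
        simp [hc] at this
      exact (abs_nonneg _).trans (hf i a ha)
    rcases eq_or_lt_of_le bnn with hb | hb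
    · have : mn (w i) (fun a => Real.exp (s * f i a)) ≤ mn (w i) (fun _ => 1) := by
        apply mn_mono hw1.1
        intro a ha
        have := hf i a ha
        rw [← hb] at this
        have : f i a = 0 := abs_eq_zero.1 (le_antisymm this (abs_nonneg _))
        simp [this]
      rw [mn_const hw1.2] at this
      refine this.trans (Real.one_le_exp (by positivity))
    · have : mn (w i) (fun a => Real.exp (s * f i a)) ≤
          mn (w i) (fun a => Real.cosh (s * b i) + (Real.sinh (s * b i) / b i) * f i a) := by
        apply mn_mono hw1.1
        intro a ha
        have hfa := abs_le.1 (hf i a ha)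
        have c1 : 0 ≤ (1 + f i a / b i) / 2 := by
          have : -1 ≤ f i a / b i := by rw [le_div_iff₀ hb]; linarith
          linarith
        have c2 : 0 ≤ (1 - f i a / b i) / 2 := by
          have : f i a / b i ≤ 1 := by rw [div_le_iff₀ hb]; linarith
          linarith
        have conv := convexOn_exp.2 (mem_univ (s * b i)) (mem_univ (-(s * b i))) c1 c2 (by ring)
        simp only [smul_eq_mul] at conv
        have e1 : (1 + f i a / b i) / 2 * (s * b i) + (1 - f i a / b i) / 2 * -(s * b i)
          = s * f i a := by field_simp; ring
        rw [e1] at conv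
        refine conv.trans (le_of_eq ?_)
        rw [Real.cosh_eq, Real.sinh_eq]
        field_simp
        ring
      rw [mn_add, mn_const hw1.2, mn_mul, h0 i, mul_zero, add_zero] at this
      refine this.trans ?_
      have := Real.cosh_le_exp_half_sq (s * b i)
      rwa [mul_pow] at this
  have h3 : ∏ i, mn (w i) (fun a => Real.exp (s * f i a)) ≤ Real.exp (s ^ 2 * B / 2) := by
    calc _ ≤ ∏ i, Real.exp (s ^ 2 * b i ^ 2 / 2) := by
          apply Finset.prod_le_prod
          · intro i _
            exact Finset.sum_nonneg fun a _ => mul_nonneg ((hw i).1 a) (Real.exp_pos _).le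
          · intro i _; exact h2 i
      _ = Real.exp (s ^ 2 * (∑ i, b i ^ 2) / 2) := by
          rw [← Real.exp_sum, ← Finset.sum_div, Finset.mul_sum]
      _ ≤ _ := by
          apply Real.exp_le_exp.2
          have : s ^ 2 * (∑ i, b i ^ 2) ≤ s ^ 2 * B := mul_le_mul_of_nonneg_left hbB (sq_nonneg _)
          linarith
  refine h1.trans ((mul_le_mul_of_nonneg_left h3 (Real.exp_pos _).le).trans ?_)
  rw [← Real.exp_add]
  apply Real.exp_le_exp.2
  rw [hs]
  apply le_of_eq
  field_simp
  ring

/-- Hoeffding two sided, general mean, with threshold `4 b √(n log n)`. -/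
theorem hoeff2 {w : Fin n → α → ℝ} (hw : IsChannel w) (f : Fin n → α → ℝ)
    {b : ℝ} (hb : 0 < b) (hf : ∀ i a, |f i a| ≤ b) (hn : 1 ≤ n) :
    ew w (fun ω => ind (4 * b * Real.sqrt (n * Real.log n) <
      |∑ i, f i (ω i) - ∑ i, mn (w i) (f i)|)) ≤ 2 / n := by
  have hm : ∀ i, |mn (w i) (f i)| ≤ b := fun i => abs_mn_le (hw i).1 (hw i).2 (hf i)
  have hn0 : (0 : ℝ) < n := by exact_mod_cast hn
  have hL : 0 ≤ Real.log n := Real.log_nonneg (by exact_mod_cast hn)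
  set t := 4 * b * Real.sqrt (n * Real.log n) with ht
  have A : ∀ s : ℝ, |s| = 1 → ew w (fun ω => ind (t ≤ ∑ i, s * (f i (ω i) - mn (w i) (f i))))
      ≤ 1 / n := by
    intro s hs
    have := hoeff_aux hw (fun i a => s * (f i a - mn (w i) (f i))) (by
        intro i
        rw [mn_mul, mn_sub, mn_const (hw i).2]; ring) (b := fun _ => 2 * b) (by
        intro i a _
        rw [abs_mul, hs, one_mul]
        have := abs_sub (f i a) (mn (w i) (f i))
        linarith [hf i a, hm i]) (B := 4 * b ^ 2 * n) (by positivity) (by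
        simp; apply le_of_eq; ring) (t := t) (by positivity)
    refine this.trans ?_
    have e : -(t ^ 2 / (2 * (4 * b ^ 2 * n))) = - (2 * Real.log n) := by
      rw [ht, mul_pow, Real.sq_sqrt (by positivity)]
      field_simp; ring
    rw [e, Real.exp_neg, one_div]
    apply inv_anti₀ hn0
    rw [two_mul, Real.exp_add, Real.exp_log hn0]
    have : (1 : ℝ) ≤ n := by exact_mod_cast hn
    nlinarith
  have h : ew w (fun ω => ind (t < |∑ i, f i (ω i) - ∑ i, mn (w i) (f i)|)) ≤
      ew w (fun ω => ind (t ≤ ∑ i, 1 * (f i (ω i) - mn (w i) (f i))) +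
        ind (t ≤ ∑ i, (-1) * (f i (ω i) - mn (w i) (f i)))) := by
    apply ew_mono hw
    intro ω _
    simp only [← Finset.mul_sum, Finset.sum_sub_distrib]
    by_cases hh : t < |∑ i, f i (ω i) - ∑ i, mn (w i) (f i)|
    · rw [ind_true hh]
      rcases lt_abs.1 hh with h | h
      · rw [ind_true (by linarith)]; linarith [ind_nonneg (t ≤ -1 * (∑ i, f i (ω i) - ∑ i, mn (w i) (f i)))]
      · rw [ind_true (p := t ≤ -1 * _) (by linarith)]; linarith [ind_nonneg (t ≤ 1 * (∑ i, f i (ω i) - ∑ i, mn (w i) (f i)))]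
    · rw [ind_false hh]; exact add_nonneg (ind_nonneg _) (ind_nonneg _)
  rw [ew_add] at h
  have a1 := A 1 (by simp)
  have a2 := A (-1) (by simp)
  have : 2 / (n : ℝ) = 1 / n + 1 / n := by ring
  linarith

end
end

open scoped BigOperators
noncomputable section
open Real Set Filter Topology

lemma exb {α : Type} [Fintype α] (f : α → ℝ) : ∃ b > 0, ∀ a, |f a| ≤ b := by
  refine ⟨1 + ∑ a, |f a|, by positivity, fun a => ?_⟩
  have := Finset.single_le_sum (f := fun a => |f a|) (fun i _ => abs_nonneg _) (Finset.mem_univ a)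
  linarith

/-- pmf on a finite type -/
def IsPmf {α : Type} [Fintype α] (p : α → ℝ) : Prop := (∀ a, 0 ≤ p a) ∧ ∑ a, p a = 1

lemma IsPmf.ch {α : Type} [Fintype α] {p : α → ℝ} (h : IsPmf p) (n : ℕ) :
    IsChannel (fun _ : Fin n => p) := fun _ => h

lemma typ {α : Type} [Fintype α] {p : α → ℝ} (hp : IsPmf p) (f : α → ℝ) :
    ∃ K > 0, ∀ n : ℕ, 1 ≤ n → ew (fun _ : Fin n => p) (fun ω => ind (K * √(n * log n) <
      |∑ i, f (ω i) - n * mn p f|)) ≤ 2 / n := by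
  obtain ⟨b, hb, hf⟩ := exb f
  refine ⟨4 * b, by positivity, fun n hn => ?_⟩
  have := hoeff2 (hp.ch n) (fun _ => f) hb (fun _ => hf) hn
  simpa using this

lemma cmp_sqrt {v V0 : ℝ} (h0 : 0 < V0) (hv : |v - V0| ≤ V0 / 2) (A : ℝ) :
    |A / √v - A / √V0| ≤ 2 * |A| * |v - V0| / (V0 * √V0) := by
  have hv' := abs_le.1 hv
  have hvp : 0 < v := by linarith
  have s0 := Real.sqrt_pos.2 h0
  have s1 := Real.sqrt_pos.2 hvp
  have e0 := Real.sq_sqrt h0.le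
  have e1 := Real.sq_sqrt hvp.le
  have hs : √V0 ≤ 2 * √v := by
    by_contra h; push Not at h
    nlinarith
  have key : A / √v - A / √V0 = A * (V0 - v) / (√v * √V0 * (√v + √V0)) := by
    have : V0 - v = (√V0 - √v) * (√V0 + √v) := by ring_nf; rw [e0, e1]
    rw [this]; field_simp; ring
  rw [key, abs_div, abs_mul, abs_sub_comm V0 v, abs_of_pos (by positivity : 0 < √v * √V0 * (√v + √V0))]
  rw [div_le_div_iff₀ (by positivity) (by positivity)]
  have : V0 * √V0 ≤ 2 * (√v * √V0 * (√v + √V0)) := by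
    calc V0 * √V0 = √V0 * √V0 * √V0 := by rw [← sq, e0]
      _ ≤ (2 * √v) * √V0 * √V0 := by gcongr
      _ ≤ (2 * √v) * √V0 * (√v + √V0) := by gcongr; linarith
      _ = _ := by ring
  calc |A| * |v - V0| * (V0 * √V0) ≤ |A| * |v - V0| * (2 * (√v * √V0 * (√v + √V0))) := by gcongr
    _ = _ := by ring

lemma ew_pair {α β : Type} [Fintype α] [Fintype β] {n : ℕ} (p : Fin n → α → ℝ) (K : Fin n → α → β → ℝ)
    (F : (Fin n → α × β) → ℝ) :
    ew (fun (i : Fin n) (ab : α × β) => p i ab.1 * K i ab.1 ab.2) F =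
      ew p (fun y => ew (fun i => K i (y i)) (fun z => F (fun i => (y i, z i)))) := by
  unfold ew
  rw [← (Equiv.arrowProdEquivProdArrow (Fin n) (fun _ => α) (fun _ => β)).symm.sum_comp, Fintype.sum_prod_type]
  apply Finset.sum_congr rfl; intro y _
  rw [Finset.mul_sum]
  apply Finset.sum_congr rfl; intro z _
  simp only [Equiv.arrowProdEquivProdArrow, Equiv.coe_fn_symm_mk]
  rw [Finset.prod_mul_distrib]
  ring

lemma mn_pair {α β : Type} [Fintype α] [Fintype β] (p : α → ℝ) (K : α → β → ℝ) (f : α × β → ℝ) :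
    mn (fun ab : α × β => p ab.1 * K ab.1 ab.2) f = mn p (fun a => mn (K a) (fun b => f (a, b))) := by
  unfold mn
  rw [Fintype.sum_prod_type]
  apply Finset.sum_congr rfl; intro y _
  rw [Finset.mul_sum]
  apply Finset.sum_congr rfl; intro z _
  ring

lemma pmf_pair {α β : Type} [Fintype α] [Fintype β] {p : α → ℝ} {K : α → β → ℝ} (hp : IsPmf p)
    (hK : IsChannel K) : IsPmf (fun ab : α × β => p ab.1 * K ab.1 ab.2) := by
  refine ⟨fun ab => mul_nonneg (hp.1 _) ((hK _).1 _), ?_⟩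
  rw [Fintype.sum_prod_type]
  simp only [← Finset.mul_sum, (hK _).2, mul_one, hp.2]

/-- Data of the reduced problem. -/
structure Core (𝒳 𝒴 Xh : Type) [Fintype 𝒳] [Fintype 𝒴] [Fintype Xh] where
  p : 𝒴 → ℝ
  hp : IsPmf p
  W : 𝒴 → 𝒳 → ℝ
  hW : IsChannel W
  d : 𝒳 → Xh → ℝ
  dm : ℝ
  dm0 : 0 < dm
  hdm : ∀ x z, |d x z| ≤ dm
  Q : Xh → ℝ
  hQ : IsPmf Q
  lam : ℝ
  lam0 : 0 < lam
  D : ℝ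

namespace Core
variable {𝒳 𝒴 Xh : Type} [Fintype 𝒳] [Fintype 𝒴] [Fintype Xh] (c : Core 𝒳 𝒴 Xh)

def db (y : 𝒴) (z : Xh) : ℝ := mn (c.W y) (fun x => c.d x z)
def S (y : 𝒴) : ℝ := ∑ z, c.Q z * Real.exp (-(c.lam * c.db y z))
def be (y : 𝒴) : ℝ := - Real.log (c.S y)
def ker (y : 𝒴) (z : Xh) : ℝ := Real.exp (c.be y - c.lam * c.db y z)
def U (y : 𝒴) (z : Xh) : ℝ := c.Q z * c.ker y z
def ww (z : Xh) (y : 𝒴) : ℝ := c.p y * c.ker y z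
def v (y : 𝒴) (z : Xh) : ℝ := vr (c.W y) (fun x => c.d x z)
def vs : ℝ := mn c.p (fun y => mn (c.U y) (c.v y))
def R : ℝ := mn c.p c.be - c.lam * c.D
def Vt : ℝ := vr c.p c.be + c.lam ^ 2 * c.vs
/-- tilted information of the block -/
def jn {n : ℕ} (y : Fin n → 𝒴) : ℝ := ∑ i, (c.be (y i) - c.lam * c.D)
/-- probability of success given the observation and the codeword -/
def g {n : ℕ} (y : Fin n → 𝒴) (z : Fin n → Xh) : ℝ :=
  ew (fun i => c.W (y i)) (fun x => ind (∑ i, c.d (x i) (z i) ≤ n * c.D))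

/-- Optimality conditions. -/
structure Opt : Prop where
  hm : ∀ z, c.Q z = 0 → ∑ y, c.ww z y < 1
  hm1 : ∀ z, ∑ y, c.p y * c.U y z = c.Q z
  hD : mn c.p (fun y => mn (c.U y) (c.db y)) = c.D
  huniq : ∀ a : Xh → ℝ, (∀ z, c.Q z = 0 → a z = 0) → (∀ y, ∑ z, a z * c.ww z y = 0) →
    ∑ z, a z * (∑ y, c.ww z y * c.db y z) = 0 → a = 0
  hΔ : c.D < mn c.p (fun y => mn c.Q (c.db y))
  hV : 0 < c.Vt

lemma S_pos (y : 𝒴) : 0 < c.S y := by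
  obtain ⟨z, _, hz⟩ : ∃ z ∈ Finset.univ, 0 < c.Q z := by
    apply Finset.exists_lt_of_sum_lt (f := fun _ => (0 : ℝ))
    rw [c.hQ.2]; simp
  refine lt_of_lt_of_le (mul_pos hz (Real.exp_pos _)) (Finset.single_le_sum
    (f := fun z => c.Q z * Real.exp (-(c.lam * c.db y z)))
    (fun i _ => mul_nonneg (c.hQ.1 i) (Real.exp_pos _).le) (Finset.mem_univ z))

lemma ker_pos (y : 𝒴) (z : Xh) : 0 < c.ker y z := Real.exp_pos _

lemma ker_eq (y : 𝒴) (z : Xh) : c.ker y z = Real.exp (-(c.lam * c.db y z)) / c.S y := by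
  unfold ker be
  rw [sub_eq_add_neg, Real.exp_add, Real.exp_neg, Real.exp_log (c.S_pos y)]
  field_simp

lemma hU : IsChannel c.U := by
  intro y
  refine ⟨fun z => mul_nonneg (c.hQ.1 z) (c.ker_pos y z).le, ?_⟩
  unfold U
  simp_rw [ker_eq, ← mul_div_assoc]
  rw [← Finset.sum_div]
  exact div_self (c.S_pos y).ne'

lemma v_nonneg (y z) : 0 ≤ c.v y z := vr_nonneg (c.hW y).1 _

lemma vs_nonneg : 0 ≤ c.vs :=
  Finset.sum_nonneg fun y _ => mul_nonneg (c.hp.1 y) (Finset.sum_nonneg fun z _ =>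
    mul_nonneg ((c.hU y).1 z) (c.v_nonneg y z))

/-- law of the pair `(Y, Z)` -/
def pyz : 𝒴 × Xh → ℝ := fun ab => c.p ab.1 * c.U ab.1 ab.2

lemma hpyz : IsPmf c.pyz := pmf_pair c.hp c.hU

/-- law of the triple -/
def pyzx : (𝒴 × Xh) × 𝒳 → ℝ := fun t => c.pyz t.1 * c.W t.1.1 t.2

lemma hpyzx : IsPmf c.pyzx :=
  pmf_pair (K := fun (yz : 𝒴 × Xh) x => c.W yz.1 x) c.hpyz (fun yz => c.hW yz.1)

/-- tilted information -/
def j3 (t : (𝒴 × Xh) × 𝒳) : ℝ :=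
  c.be t.1.1 - c.lam * c.D + c.lam * (c.d t.2 t.1.2 - c.db t.1.1 t.1.2)

lemma j3_mean_W (y z) : mn (c.W y) (fun x => c.j3 ((y, z), x)) = c.be y - c.lam * c.D := by
  change mn (c.W y) (fun x => (c.be y - c.lam * c.D) + c.lam * (c.d x z - c.db y z)) = _
  rw [mn_add, mn_const (c.hW y).2, mn_mul, mn_sub, mn_const (c.hW y).2]
  simp [db]

lemma j3_var_W (y z) : vr (c.W y) (fun x => c.j3 ((y, z), x)) = c.lam ^ 2 * c.v y z := by
  unfold vr
  rw [j3_mean_W]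
  unfold j3 v vr db
  rw [Finset.mul_sum]
  apply Finset.sum_congr rfl; intros; ring

lemma j3_mean : mn c.pyzx c.j3 = c.R := by
  have h := mn_pair c.pyz (fun (yz : 𝒴 × Xh) x => c.W yz.1 x) c.j3
  unfold pyzx; rw [h]
  simp_rw [j3_mean_W]
  have h := mn_pair c.p c.U (fun yz => c.be yz.1 - c.lam * c.D)
  unfold pyz; rw [h]
  simp_rw [mn_const (c.hU _).2]
  rw [mn_sub, mn_const c.hp.2]; rfl

lemma j3_var : vr c.pyzx c.j3 = c.Vt := by
  have h := mn_pair c.pyz (fun (yz : 𝒴 × Xh) x => c.W yz.1 x) (fun t => (c.j3 t - c.R) ^ 2)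
  have h0 : vr c.pyzx c.j3 = mn c.pyzx (fun t => (c.j3 t - c.R) ^ 2) := by
    unfold vr; rw [j3_mean]; rfl
  rw [h0]
  unfold pyzx; rw [h]
  have : ∀ yz : 𝒴 × Xh, mn (c.W yz.1) (fun x => (c.j3 (yz, x) - c.R) ^ 2) =
      c.lam ^ 2 * c.v yz.1 yz.2 + (c.be yz.1 - mn c.p c.be) ^ 2 := by
    intro yz
    rw [vr_eq (c.hW yz.1).2, j3_var_W, j3_mean_W]
    unfold R; ring
  simp_rw [this]
  rw [mn_add]
  have h := mn_pair c.p c.U (fun yz => c.lam ^ 2 * c.v yz.1 yz.2)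
  have h' := mn_pair c.p c.U (fun yz => (c.be yz.1 - mn c.p c.be) ^ 2)
  unfold pyz; rw [h, h']
  simp_rw [mn_const (c.hU _).2, mn_mul]
  unfold Vt vs vr
  rw [add_comm]; rfl

set_option maxHeartbeats 1600000 in
/-- averaging the conditional Gaussian approximation -/
lemma unrep (hV : 0 < c.Vt) (hvs : 0 < c.vs) (B : ℝ) (hB : 0 ≤ B) :
    ∃ C > 0, ∃ n0 : ℕ, ∀ n ≥ n0, ∀ l : ℝ, |l - n * c.R| ≤ B * √n →
      |ew (fun _ : Fin n => c.p) (fun y => Phi ((l - c.jn y) / √(n * (c.lam ^ 2 * c.vs))))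
        - Phi ((l - n * c.R) / √(n * c.Vt))| ≤ C * log n / √n := by
  obtain ⟨K1, hK1, hT1⟩ := typ c.hpyz (fun yz => c.be yz.1 - c.lam * c.D)
  obtain ⟨K2, hK2, hT2⟩ := typ c.hpyz (fun yz => c.v yz.1 yz.2)
  obtain ⟨b, hb, hjb⟩ := exb c.j3
  have lam0 := c.lam0
  set V1 := c.lam ^ 2 * c.vs with hV1
  have hV1p : 0 < V1 := by positivity
  have hmean1 : mn c.pyz (fun yz => c.be yz.1 - c.lam * c.D) = c.R := by
    have h := mn_pair c.p c.U (fun yz => c.be yz.1 - c.lam * c.D)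
    unfold pyz; rw [h]
    simp_rw [mn_const (c.hU _).2]
    rw [mn_sub, mn_const c.hp.2]; rfl
  have hmean2 : mn c.pyz (fun yz => c.v yz.1 yz.2) = c.vs := by
    have h := mn_pair c.p c.U (fun yz => c.v yz.1 yz.2)
    unfold pyz; rw [h]; rfl
  rw [hmean1] at hT1
  rw [hmean2] at hT2
  -- eventually the variance deviation is at most half
  have hev : ∀ᶠ n : ℕ in atTop, c.lam ^ 2 * K2 * √(n * log n) ≤ n * V1 / 2 := by
    have h1 : Tendsto (fun n : ℕ => log n / n) atTop (𝓝 0) := by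
      have := (Real.isLittleO_log_id_atTop.tendsto_div_nhds_zero).comp tendsto_natCast_atTop_atTop
      simpa [Function.comp_def] using this
    have h2 := (h1.sqrt).const_mul (c.lam ^ 2 * K2)
    simp only [Real.sqrt_zero, mul_zero] at h2
    filter_upwards [h2.eventually (gt_mem_nhds (show 0 < V1 / 2 by positivity)),
      eventually_ge_atTop 1] with n hn hn1
    have hn0 : (0 : ℝ) < n := by exact_mod_cast hn1
    have : √(n * log n) = n * √(log n / n) := by
      have : (n : ℝ) * log n = (n : ℝ) ^ 2 * (log n / n) := by field_simp
      rw [this, Real.sqrt_mul (by positivity), Real.sqrt_sq hn0.le]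
    rw [this]; nlinarith
  obtain ⟨n1, hn1⟩ := eventually_atTop.1 hev
  refine ⟨40 * b / √c.Vt + 80 * b / √V1 + 2 * (B + K1) * (c.lam ^ 2 * K2) / (V1 * √V1) + 4,
    by positivity, max n1 3, ?_⟩
  intro n hn l hl
  have hn3 : 3 ≤ n := le_trans (le_max_right _ _) hn
  have hn0 : (0 : ℝ) < n := by positivity
  have hnR : (3 : ℝ) ≤ n := by exact_mod_cast hn3
  have hL : 1 ≤ log n := by
    rw [Real.le_log_iff_exp_le hn0]; linarith [Real.exp_one_lt_d9]
  have hdev := hn1 n (le_trans (le_max_left _ _) hn)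
  have hsn : 0 < √(n : ℝ) := Real.sqrt_pos.2 hn0
  have hsq : √(n : ℝ) ^ 2 = n := Real.sq_sqrt hn0.le
  have hsL : √(n * log n) ^ 2 = n * log n := Real.sq_sqrt (by positivity)
  have hsn1 : √(n : ℝ) ≤ √(n * log n) := Real.sqrt_le_sqrt (by nlinarith)
  -- step 1: BE on triple
  have be1 := berry (c.hpyzx.ch n) (fun _ => c.j3) (fun _ => hjb) hb.le
    (σ := √(n * c.Vt)) (Real.sqrt_pos.2 (by positivity)) (by
      rw [Real.sq_sqrt (by positivity)]; simp [j3_var]) l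
  simp only [j3_mean, Finset.sum_const, Finset.card_univ, Fintype.card_fin, nsmul_eq_mul] at be1
  have tr := ew_pair (fun _ : Fin n => c.pyz) (fun _ (yz : 𝒴 × Xh) x => c.W yz.1 x)
    (fun ω => ind (∑ i, c.j3 (ω i) ≤ l))
  have tr' : ew (fun _ : Fin n => c.pyzx) (fun ω => ind (∑ i, c.j3 (ω i) ≤ l)) = _ := tr
  rw [tr'] at be1
  -- step 2: marginalize
  have mg : ew (fun _ : Fin n => c.p) (fun y => Phi ((l - c.jn y) / √(n * V1))) =
      ew (fun _ : Fin n => c.pyz) (fun yz => Phi ((l - c.jn (fun i => (yz i).1)) / √(n * V1))) := by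
    have := ew_pair (fun _ : Fin n => c.p) (fun _ => c.U)
      (fun yz => Phi ((l - c.jn (fun i => (yz i).1)) / √(n * V1)))
    have t2 : ew (fun _ : Fin n => c.pyz) (fun yz => Phi ((l - c.jn (fun i => (yz i).1)) / √(n * V1))) = _ := this
    rw [t2]
    congr 1; ext y
    exact (ew_const (fun i => c.hU (y i)) _).symm
  rw [mg]
  -- step 3: pointwise comparison
  have pt : ∀ yz : Fin n → 𝒴 × Xh,
      |Phi ((l - c.jn (fun i => (yz i).1)) / √(n * V1)) -
        ew (fun i => c.W (yz i).1) (fun x => ind (∑ i, c.j3 (yz i, x i) ≤ l))| ≤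
      (80 * b / √V1 + 2 * (B + K1) * (c.lam ^ 2 * K2) / (V1 * √V1)) * (log n / √n) +
      (ind (K1 * √(n * log n) < |∑ i, (c.be (yz i).1 - c.lam * c.D) - n * c.R|) +
       ind (K2 * √(n * log n) < |∑ i, c.v (yz i).1 (yz i).2 - n * c.vs|)) := by
    intro yz
    have hnn : 0 ≤ (80 * b / √V1 + 2 * (B + K1) * (c.lam ^ 2 * K2) / (V1 * √V1)) * (log n / √n) := by
      positivity
    have triv : |Phi ((l - c.jn (fun i => (yz i).1)) / √(n * V1)) -
        ew (fun i => c.W (yz i).1) (fun x => ind (∑ i, c.j3 (yz i, x i) ≤ l))| ≤ 1 := by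
      have a1 := Phi_nonneg ((l - c.jn (fun i => (yz i).1)) / √(n * V1))
      have a2 := Phi_le_one ((l - c.jn (fun i => (yz i).1)) / √(n * V1))
      have a3 := ew_ind_le_one (fun i => c.hW (yz i).1) (fun x => ∑ i, c.j3 (yz i, x i) ≤ l)
      have a4 := ew_nonneg (fun i => c.hW (yz i).1) (F := fun x => ind (∑ i, c.j3 (yz i, x i) ≤ l))
        (fun x => ind_nonneg _)
      rw [abs_le]; constructor <;> linarith
    by_cases h1 : K1 * √(n * log n) < |∑ i, (c.be (yz i).1 - c.lam * c.D) - n * c.R|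
    · rw [ind_true h1]
      have := ind_nonneg (K2 * √(n * log n) < |∑ i, c.v (yz i).1 (yz i).2 - n * c.vs|)
      linarith
    by_cases h2 : K2 * √(n * log n) < |∑ i, c.v (yz i).1 (yz i).2 - n * c.vs|
    · rw [ind_true h2]
      have := ind_nonneg (K1 * √(n * log n) < |∑ i, (c.be (yz i).1 - c.lam * c.D) - n * c.R|)
      linarith
    rw [ind_false h1, ind_false h2]
    push Not at h1 h2
    set vn := c.lam ^ 2 * ∑ i, c.v (yz i).1 (yz i).2 with hvn
    have hvd : |vn - n * V1| ≤ c.lam ^ 2 * K2 * √(n * log n) := by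
      have : vn - n * V1 = c.lam ^ 2 * (∑ i, c.v (yz i).1 (yz i).2 - n * c.vs) := by
        rw [hvn, hV1]; ring
      rw [this, abs_mul, abs_of_pos (by positivity : 0 < c.lam ^ 2), mul_assoc]
      gcongr
    have hA : |l - c.jn (fun i => (yz i).1)| ≤ (B + K1) * √(n * log n) := by
      have : l - c.jn (fun i => (yz i).1) = (l - n * c.R) - (c.jn (fun i => (yz i).1) - n * c.R) := by ring
      rw [this]
      refine (abs_sub _ _).trans ?_
      have : |c.jn (fun i => (yz i).1) - n * c.R| ≤ K1 * √(n * log n) := h1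
      nlinarith
    have hV0 : 0 < n * V1 := by positivity
    have hhalf : |vn - n * V1| ≤ n * V1 / 2 := hvd.trans hdev
    have hvnp : n * V1 / 2 ≤ vn := by linarith [(abs_le.1 hhalf).1]
    have cs := cmp_sqrt hV0 hhalf (l - c.jn (fun i => (yz i).1))
    have be2 := berry (fun i => c.hW (yz i).1) (fun i x => c.j3 (yz i, x)) (fun i x => hjb _) hb.le
      (σ := √vn) (Real.sqrt_pos.2 (by linarith)) (by
        rw [Real.sq_sqrt (by linarith), hvn, Finset.mul_sum]
        apply Finset.sum_congr rfl; intro i _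
        exact c.j3_var_W (yz i).1 (yz i).2) l
    have hms : ∑ i, mn (c.W (yz i).1) (fun x => c.j3 (yz i, x)) = c.jn (fun i => (yz i).1) := by
      apply Finset.sum_congr rfl; intro i _
      exact c.j3_mean_W (yz i).1 (yz i).2
    rw [hms] at be2
    have e1 : 40 * b / √vn ≤ 80 * b / √V1 * (log n / √n) := by
      have : √n * √V1 ≤ 2 * √vn := by
        rw [← Real.sqrt_mul hn0.le]
        apply Real.sqrt_le_iff.2 ⟨by positivity, ?_⟩
        rw [mul_pow, Real.sq_sqrt (by linarith)]; linarith
      have p1 : 0 < √vn := Real.sqrt_pos.2 (by linarith)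
      have p2 : 0 < √V1 := Real.sqrt_pos.2 hV1p
      calc 40 * b / √vn ≤ 80 * b / (√n * √V1) := by
            rw [div_le_div_iff₀ p1 (by positivity)]; nlinarith
        _ = 80 * b / √V1 * (1 / √n) := by field_simp
        _ ≤ _ := by gcongr
    have e2 : 2 * |l - c.jn (fun i => (yz i).1)| * |vn - n * V1| / (n * V1 * √(n * V1)) ≤
        2 * (B + K1) * (c.lam ^ 2 * K2) / (V1 * √V1) * (log n / √n) := by
      calc _ ≤ 2 * ((B + K1) * √(n * log n)) * (c.lam ^ 2 * K2 * √(n * log n)) / (n * V1 * √(n * V1)) := by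
            gcongr
        _ = 2 * (B + K1) * (c.lam ^ 2 * K2) * (√(n * log n) ^ 2) / (n * V1 * √(n * V1)) := by ring
        _ = _ := by
            rw [hsL, Real.sqrt_mul hn0.le]
            have p2 : 0 < √V1 := Real.sqrt_pos.2 hV1p
            field_simp
    have lip : |Phi ((l - c.jn (fun i => (yz i).1)) / √vn) - Phi ((l - c.jn (fun i => (yz i).1)) / √(n * V1))|
        ≤ |(l - c.jn (fun i => (yz i).1)) / √vn - (l - c.jn (fun i => (yz i).1)) / √(n * V1)| := by
      rw [abs_le]
      have a1 := Phi_lip' ((l - c.jn (fun i => (yz i).1)) / √vn) ((l - c.jn (fun i => (yz i).1)) / √(n * V1))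
      have a2 := Phi_lip' ((l - c.jn (fun i => (yz i).1)) / √(n * V1)) ((l - c.jn (fun i => (yz i).1)) / √vn)
      rw [abs_sub_comm] at a1
      constructor <;> linarith
    have b2 := abs_le.1 be2
    have b3 := abs_le.1 (lip.trans cs)
    rw [abs_le]; constructor <;> linarith
  -- step 4: integrate
  have s4 : |ew (fun _ : Fin n => c.pyz) (fun yz => Phi ((l - c.jn (fun i => (yz i).1)) / √(n * V1))) -
      ew (fun _ : Fin n => c.pyz) (fun yz => ew (fun i => c.W (yz i).1)
        (fun x => ind (∑ i, c.j3 (yz i, x i) ≤ l)))| ≤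
      (80 * b / √V1 + 2 * (B + K1) * (c.lam ^ 2 * K2) / (V1 * √V1)) * (log n / √n) + (2 / n + 2 / n) := by
    have hch := c.hpyz.ch n
    have up := ew_mono hch (fun yz _ => (abs_le.1 (pt yz)).2)
    have lo := ew_mono hch (fun yz _ => (abs_le.1 (pt yz)).1)
    rw [ew_sub, ew_add, ew_const hch, ew_add] at up
    have : ∀ F : (Fin n → 𝒴 × Xh) → ℝ, ew (fun _ : Fin n => c.pyz) (fun yz => - F yz) =
        - ew (fun _ : Fin n => c.pyz) F := by
      intro F
      have := ew_mul (fun _ : Fin n => c.pyz) (-1) F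
      simpa using this
    rw [this, ew_sub, ew_add, ew_const hch, ew_add] at lo
    have t1 := hT1 n (by omega)
    have t2 := hT2 n (by omega)
    rw [abs_le]; constructor <;> linarith
  have f1 : 2 / (n : ℝ) + 2 / n ≤ 4 * (log n / √n) := by
    have : 1 / (n : ℝ) ≤ log n / √n := by
      rw [div_le_div_iff₀ hn0 hsn]
      have : 1 ≤ √(n : ℝ) := by rw [Real.one_le_sqrt]; linarith
      nlinarith
    have e : 2 / (n : ℝ) + 2 / n = 4 * (1 / n) := by ring
    rw [e]; linarith
  have f2 : 40 * b / √(n * c.Vt) ≤ 40 * b / √c.Vt * (log n / √n) := by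
    rw [Real.sqrt_mul hn0.le]
    have p2 : 0 < √c.Vt := Real.sqrt_pos.2 hV
    calc 40 * b / (√n * √c.Vt) = 40 * b / √c.Vt * (1 / √n) := by field_simp
      _ ≤ _ := by gcongr
  have b1 := abs_le.1 be1
  have b4 := abs_le.1 s4
  have e5 : (40 * b / √c.Vt + 80 * b / √V1 + 2 * (B + K1) * (c.lam ^ 2 * K2) / (V1 * √V1) + 4) * log n / √n
    = 40 * b / √c.Vt * (log n / √n) + ((80 * b / √V1 + 2 * (B + K1) * (c.lam ^ 2 * K2) / (V1 * √V1)) * (log n / √n)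
      + 4 * (log n / √n)) := by ring
  rw [e5, abs_le]
  constructor <;> linarith
end Core
end

open scoped BigOperators
noncomputable section
open Real Set Filter Topology
set_option linter.unusedSectionVars false

section counts
open Classical
variable {𝒴 Xh : Type} [Fintype 𝒴] [Fintype Xh] {n : ℕ}

/-- joint counts -/
def cn (y : Fin n → 𝒴) (z : Fin n → Xh) (b : 𝒴) (e : Xh) : ℝ :=
  ∑ i, if y i = b ∧ z i = e then 1 else 0
/-- counts of the second component -/
def cc (z : Fin n → Xh) (e : Xh) : ℝ := ∑ i, if z i = e then 1 else 0
/-- counts of the first component -/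
def cy (y : Fin n → 𝒴) (b : 𝒴) : ℝ := ∑ i, if y i = b then 1 else 0

lemma cn_sum (y : Fin n → 𝒴) (z : Fin n → Xh) (f : 𝒴 → Xh → ℝ) :
    ∑ b, ∑ e, cn y z b e * f b e = ∑ i, f (y i) (z i) := by
  unfold cn
  simp_rw [Finset.sum_mul]
  have : ∀ b, ∑ e, ∑ i, (if y i = b ∧ z i = e then (1 : ℝ) else 0) * f b e =
      ∑ i, ∑ e, (if y i = b ∧ z i = e then (1 : ℝ) else 0) * f b e := fun b => Finset.sum_comm
  simp_rw [this]
  rw [Finset.sum_comm]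
  apply Finset.sum_congr rfl; intro i _
  simp [ite_and]

lemma cc_sum (z : Fin n → Xh) (f : Xh → ℝ) :
    ∑ e, cc z e * f e = ∑ i, f (z i) := by
  unfold cc
  simp_rw [Finset.sum_mul]
  rw [Finset.sum_comm]
  apply Finset.sum_congr rfl; intro i _
  simp

lemma cn_row (y : Fin n → 𝒴) (z : Fin n → Xh) (e : Xh) : ∑ b, cn y z b e = cc z e := by
  unfold cn cc
  rw [Finset.sum_comm]
  apply Finset.sum_congr rfl; intro i _
  simp [ite_and]

lemma cn_col (y : Fin n → 𝒴) (z : Fin n → Xh) (b : 𝒴) : ∑ e, cn y z b e = cy y b := by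
  unfold cn cy
  rw [Finset.sum_comm]
  apply Finset.sum_congr rfl; intro i _
  simp [ite_and]

lemma cn_nonneg (y : Fin n → 𝒴) (z : Fin n → Xh) (b e) : 0 ≤ cn y z b e := by
  unfold cn; positivity
lemma cc_nonneg (z : Fin n → Xh) (e) : 0 ≤ cc z e := by
  unfold cc; positivity
lemma cn_le_cc (y : Fin n → 𝒴) (z : Fin n → Xh) (b e) : cn y z b e ≤ cc z e := by
  rw [← cn_row y z e]
  exact Finset.single_le_sum (f := fun b => cn y z b e) (fun b _ => cn_nonneg y z b e) (Finset.mem_univ b)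
lemma cc_le (z : Fin n → Xh) (e) : cc z e ≤ n := by
  unfold cc
  calc _ ≤ ∑ i : Fin n, (1 : ℝ) := by
        apply Finset.sum_le_sum; intro i _; split_ifs <;> norm_num
    _ = n := by simp
lemma cn_pos (y : Fin n → 𝒴) (z : Fin n → Xh) (i) : 0 < cn y z (y i) (z i) := by
  unfold cn
  refine lt_of_lt_of_le one_pos ?_
  have := Finset.single_le_sum (f := fun j => if y j = y i ∧ z j = z i then (1 : ℝ) else 0)
    (fun j _ => by split_ifs <;> norm_num) (Finset.mem_univ i)
  simpa using this
lemma cc_pos (z : Fin n → Xh) (i) : 0 < cc z (z i) :=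
  lt_of_lt_of_le (cn_pos z z i) (cn_le_cc z z _ _)
lemma cn_zero (y : Fin n → 𝒴) (z : Fin n → Xh) (b e) (h : ∀ i, y i ≠ b) : cn y z b e = 0 := by
  unfold cn
  apply Finset.sum_eq_zero; intro i _; simp [h i]

/-- empirical conditional likelihood -/
def Kw (y : Fin n → 𝒴) (z : Fin n → Xh) : ℝ := ∏ i, cn y z (y i) (z i) / cc z (z i)

lemma Kw_pos (y : Fin n → 𝒴) (z : Fin n → Xh) : 0 < Kw y z :=
  Finset.prod_pos fun i _ => div_pos (cn_pos y z i) (cc_pos z i)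

lemma cn_nat (y : Fin n → 𝒴) (z : Fin n → Xh) (b e) : ∃ k : Fin (n + 1), cn y z b e = (k : ℕ) := by
  refine ⟨⟨(Finset.univ.filter (fun i => y i = b ∧ z i = e)).card, ?_⟩, ?_⟩
  · have := Finset.card_filter_le (Finset.univ : Finset (Fin n)) (fun i => y i = b ∧ z i = e)
    simp at this; omega
  · unfold cn; simp

lemma Kw_sum (z : Fin n → Xh) :
    ∑ y : Fin n → 𝒴, Kw y z ≤ ((n : ℝ) + 1) ^ (Fintype.card 𝒴 * Fintype.card Xh) := by
  let T := 𝒴 × Xh → Fin (n + 1)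
  let F : T → (Fin n → 𝒴) → ℝ := fun k y =>
    ∏ i, (((k (y i, z i) : ℕ) : ℝ) / ∑ b, ((k (b, z i) : ℕ) : ℝ))
  have hF : ∀ k y, 0 ≤ F k y := fun k y => Finset.prod_nonneg fun i _ => by positivity
  have h1 : ∀ y, Kw y z ≤ ∑ k, F k y := by
    intro y
    choose k hk using fun be : 𝒴 × Xh => cn_nat y z be.1 be.2
    have : Kw y z = F k y := by
      unfold Kw
      apply Finset.prod_congr rfl; intro i _
      rw [← cn_row y z]
      congr 1
      · exact hk (y i, z i)
      · apply Finset.sum_congr rfl; intro b _; exact hk (b, z i)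
    rw [this]
    exact Finset.single_le_sum (f := fun k => F k y) (fun k _ => hF k y) (Finset.mem_univ k)
  have h2 : ∀ k, ∑ y, F k y ≤ 1 := by
    intro k
    have : ∑ y, F k y = ∏ i : Fin n, ∑ b, (((k (b, z i) : ℕ) : ℝ) / ∑ b', ((k (b', z i) : ℕ) : ℝ)) := by
      rw [Finset.prod_univ_sum]; simp [F]
    rw [this]
    apply Finset.prod_le_one
    · intro i _; positivity
    · intro i _
      rw [← Finset.sum_div]
      exact div_self_le_one _
  calc ∑ y, Kw y z ≤ ∑ y, ∑ k, F k y := Finset.sum_le_sum fun y _ => h1 y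
    _ = ∑ k, ∑ y, F k y := Finset.sum_comm
    _ ≤ ∑ k : T, (1 : ℝ) := Finset.sum_le_sum fun k _ => h2 k
    _ = _ := by simp [T]

lemma conv_union {p : 𝒴 → ℝ} (hp : IsPmf p) (C : Finset (Fin n → Xh)) (ζ : (Fin n → 𝒴) → (Fin n → Xh))
    (hζ : ∀ y, ζ y ∈ C) (γ : ℝ) :
    ew (fun _ : Fin n => p) (fun y => ind (exp γ * ∏ i, p (y i) ≤ Kw y (ζ y))) ≤
      C.card * ((n : ℝ) + 1) ^ (Fintype.card 𝒴 * Fintype.card Xh) * exp (-γ) := by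
  unfold ew
  calc _ ≤ ∑ y, exp (-γ) * ∑ z ∈ C, Kw y z := by
        apply Finset.sum_le_sum; intro y _
        have h0 : Kw y (ζ y) ≤ ∑ z ∈ C, Kw y z :=
          Finset.single_le_sum (f := fun z => Kw y z) (fun z _ => (Kw_pos y z).le) (hζ y)
        beta_reduce
        by_cases h : exp γ * ∏ i, p (y i) ≤ Kw y (ζ y)
        · rw [ind_true h, mul_one]
          have e : ∏ i, p (y i) = exp (-γ) * (exp γ * ∏ i, p (y i)) := by
            rw [← mul_assoc, ← Real.exp_add]; simp
          rw [e]
          exact mul_le_mul_of_nonneg_left (h.trans h0) (exp_pos _).le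
        · rw [ind_false h, mul_zero]
          exact mul_nonneg (exp_pos _).le (Finset.sum_nonneg fun z _ => (Kw_pos y z).le)
    _ = exp (-γ) * ∑ z ∈ C, ∑ y, Kw y z := by rw [← Finset.mul_sum, Finset.sum_comm]
    _ ≤ exp (-γ) * ∑ z ∈ C, ((n : ℝ) + 1) ^ (Fintype.card 𝒴 * Fintype.card Xh) := by
        gcongr with z hz; exact Kw_sum z
    _ = _ := by simp; ring

lemma alog {a b : ℝ} (ha : 0 < a) (hb : 0 < b) : a - b + (√a - √b) ^ 2 ≤ a * log (a / b) := by
  have sa := Real.sqrt_pos.2 ha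
  have sb := Real.sqrt_pos.2 hb
  have ea := Real.sq_sqrt ha.le
  have eb := Real.sq_sqrt hb.le
  have h := Real.log_le_sub_one_of_pos (div_pos sb sa)
  have e : log (a / b) = - 2 * log (√b / √a) := by
    rw [Real.log_div ha.ne' hb.ne', Real.log_div sb.ne' sa.ne', Real.log_sqrt ha.le, Real.log_sqrt hb.le]; ring
  rw [e]
  have : a * (√b / √a) = √a * √b := by
    nth_rewrite 1 [← ea]; field_simp
  nlinarith
end counts

namespace Core
open Classical
variable {𝒳 𝒴 Xh : Type} [Fintype 𝒳] [Fintype 𝒴] [Fintype Xh] (c : Core 𝒳 𝒴 Xh)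

/-- mass of the tilted backward kernel -/
def m (z : Xh) : ℝ := ∑ y, c.ww z y

/-- empirical divergence -/
def G {n : ℕ} (y : Fin n → 𝒴) (z : Fin n → Xh) : ℝ :=
  ∑ b, ∑ e, cn y z b e * log (cn y z b e / (cc z e * c.ww e b))

lemma ww_nonneg (z y) : 0 ≤ c.ww z y := mul_nonneg (c.hp.1 y) (c.ker_pos y z).le

variable {c}
lemma Opt.m_one (h : c.Opt) (z) (hz : c.Q z ≠ 0) : c.m z = 1 := by
  have := h.hm1 z
  unfold m ww
  unfold U at this
  have e : ∑ y, c.p y * (c.Q z * c.ker y z) = c.Q z * ∑ y, c.p y * c.ker y z := by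
    rw [Finset.mul_sum]; apply Finset.sum_congr rfl; intros; ring
  rw [e] at this
  exact mul_left_cancel₀ hz (by rw [this, mul_one])

lemma Opt.m_le (h : c.Opt) (z) : c.m z ≤ 1 := by
  by_cases hz : c.Q z = 0
  · exact (h.hm z hz).le
  · exact (h.m_one z hz).le

lemma Opt.ww_le (h : c.Opt) (z y) : c.ww z y ≤ 1 :=
  (Finset.single_le_sum (f := fun y => c.ww z y) (fun y _ => c.ww_nonneg z y) (Finset.mem_univ y)).trans
    (h.m_le z)

lemma G_lt {n : ℕ} {y : Fin n → 𝒴} {z : Fin n → Xh} (hy : ∀ i, c.p (y i) ≠ 0) {γ : ℝ}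
    (h : Kw y z < exp γ * ∏ i, c.p (y i)) :
    c.G y z < γ - ∑ i, c.be (y i) + c.lam * ∑ i, c.db (y i) (z i) := by
  have hp : ∀ i, 0 < c.p (y i) := fun i => lt_of_le_of_ne (c.hp.1 _) (hy i).symm
  have hl := Real.log_lt_log (Kw_pos y z) h
  rw [Real.log_mul (exp_pos _).ne' (Finset.prod_pos fun i _ => hp i).ne', Real.log_exp,
    Real.log_prod (fun i _ => hy i)] at hl
  unfold Kw at hl
  rw [Real.log_prod (fun i _ => (div_pos (cn_pos y z i) (cc_pos z i)).ne')] at hl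
  have e : c.G y z = ∑ i, (log (cn y z (y i) (z i) / cc z (z i)) - log (c.p (y i)) - c.be (y i)
      + c.lam * c.db (y i) (z i)) := by
    unfold G
    rw [cn_sum y z (fun b e => log (cn y z b e / (cc z e * c.ww e b)))]
    apply Finset.sum_congr rfl; intro i _
    have a1 := cn_pos y z i
    have a2 := cc_pos z i
    unfold ww
    rw [← div_div, Real.log_div (div_pos a1 a2).ne' (mul_pos (hp i) (c.ker_pos _ _)).ne']
    rw [Real.log_mul (hy i) (c.ker_pos _ _).ne']
    unfold ker; rw [Real.log_exp]; ring
  rw [e]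
  rw [Finset.sum_add_distrib, Finset.sum_sub_distrib, Finset.sum_sub_distrib, ← Finset.mul_sum]
  linarith

lemma G_ge {n : ℕ} {y : Fin n → 𝒴} {z : Fin n → Xh} (hy : ∀ i, c.p (y i) ≠ 0) :
    ∑ e, cc z e * (1 - c.m e) + ∑ b, ∑ e, (√(cn y z b e) - √(cc z e * c.ww e b)) ^ 2 ≤ c.G y z := by
  have e1 : ∑ e, cc z e * (1 - c.m e) = ∑ b, ∑ e, (cn y z b e - cc z e * c.ww e b) := by
    rw [Finset.sum_comm]
    apply Finset.sum_congr rfl; intro e _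
    rw [Finset.sum_sub_distrib, cn_row, ← Finset.mul_sum]; unfold m; ring
  rw [e1, ← Finset.sum_add_distrib]
  unfold G
  apply Finset.sum_le_sum; intro b _
  rw [← Finset.sum_add_distrib]
  apply Finset.sum_le_sum; intro e _
  rcases (cn_nonneg y z b e).eq_or_lt with h | h
  · rw [← h]
    have : 0 ≤ cc z e * c.ww e b := mul_nonneg (cc_nonneg _ _) (c.ww_nonneg _ _)
    simp [Real.sq_sqrt this]
  · refine alog h (mul_pos (h.trans_le (cn_le_cc y z b e)) (mul_pos (lt_of_le_of_ne (c.hp.1 _) ?_) (c.ker_pos _ _)))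
    intro h0
    rw [cn_zero y z b e] at h
    · exact lt_irrefl _ h
    · intro i hi; exact hy i (hi ▸ h0.symm)

lemma Opt.G_facts (h : c.Opt) {n : ℕ} {y : Fin n → 𝒴} {z : Fin n → Xh} (hy : ∀ i, c.p (y i) ≠ 0) :
    0 ≤ c.G y z ∧ (∀ b e, |cn y z b e - cc z e * c.ww e b| ≤ 2 * √n * √(c.G y z)) ∧
      ∑ e, cc z e * (1 - c.m e) ≤ c.G y z := by
  have hg := G_ge (z := z) hy
  have s1 : 0 ≤ ∑ e, cc z e * (1 - c.m e) :=
    Finset.sum_nonneg fun e _ => mul_nonneg (cc_nonneg _ _) (by linarith [h.m_le e])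
  have s2 : 0 ≤ ∑ b, ∑ e, (√(cn y z b e) - √(cc z e * c.ww e b)) ^ 2 := by positivity
  refine ⟨by linarith, fun b e => ?_, by linarith⟩
  have h1 : (√(cn y z b e) - √(cc z e * c.ww e b)) ^ 2 ≤ c.G y z := by
    have a1 := Finset.single_le_sum (f := fun b => ∑ e, (√(cn y z b e) - √(cc z e * c.ww e b)) ^ 2)
      (fun b _ => Finset.sum_nonneg fun e _ => sq_nonneg _) (Finset.mem_univ b)
    have a2 := Finset.single_le_sum (f := fun e => (√(cn y z b e) - √(cc z e * c.ww e b)) ^ 2)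
      (fun e _ => sq_nonneg _) (Finset.mem_univ e)
    linarith
  set M := cc z e * c.ww e b with hM
  have hM0 : 0 ≤ M := mul_nonneg (cc_nonneg _ _) (c.ww_nonneg _ _)
  have hMn : M ≤ n := by
    have := cc_le z e; have := h.ww_le e b; have := cc_nonneg z e; have := c.ww_nonneg e b
    nlinarith
  have hNn : cn y z b e ≤ n := (cn_le_cc y z b e).trans (cc_le z e)
  have e1 := Real.sq_sqrt hM0
  have e2 := Real.sq_sqrt (cn_nonneg y z b e)
  have : cn y z b e - M = (√(cn y z b e) - √M) * (√(cn y z b e) + √M) := by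
    ring_nf; rw [e1, e2]
  rw [this, abs_mul, mul_comm]
  have b1 : |√(cn y z b e) - √M| ≤ √(c.G y z) := Real.abs_le_sqrt h1
  have b2 : |√(cn y z b e) + √M| ≤ 2 * √n := by
    rw [abs_of_nonneg (by positivity)]
    linarith [Real.sqrt_le_sqrt hNn, Real.sqrt_le_sqrt hMn]
  exact mul_le_mul b2 b1 (abs_nonneg _) (by positivity)
end Core
end

open scoped BigOperators
noncomputable section
open Real Set Filter Topology
set_option linter.unusedSectionVars false

lemma sum2_bd {α β : Type} [Fintype α] [Fintype β] (A f : α → β → ℝ) {X F : ℝ} (_hX : 0 ≤ X)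
    (hA : ∀ a b, |A a b| ≤ X) (hF : 0 ≤ F) (hf : ∀ a b, |f a b| ≤ F) :
    |∑ a, ∑ b, A a b * f a b| ≤ (Fintype.card α * Fintype.card β * F) * X := by
  calc _ ≤ ∑ a, |∑ b, A a b * f a b| := Finset.abs_sum_le_sum_abs _ _
    _ ≤ ∑ a, ∑ b, |A a b * f a b| := Finset.sum_le_sum fun a _ => Finset.abs_sum_le_sum_abs _ _
    _ ≤ ∑ a : α, ∑ b : β, X * F := by
        apply Finset.sum_le_sum; intro a _; apply Finset.sum_le_sum; intro b _
        rw [abs_mul]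
        exact mul_le_mul (hA a b) (hf a b) (abs_nonneg _) _hX
    _ = _ := by simp; ring

namespace Core
open Classical
variable {𝒳 𝒴 Xh : Type} [Fintype 𝒳] [Fintype 𝒴] [Fintype Xh] {c : Core 𝒳 𝒴 Xh}

/-- the linear map governing uniqueness -/
def Lm (c : Core 𝒳 𝒴 Xh) : (Xh → ℝ) →ₗ[ℝ] (Xh → ℝ) × (𝒴 → ℝ) × ℝ where
  toFun a := (fun z => if c.Q z = 0 then a z else 0, fun y => ∑ z, a z * c.ww z y,
    ∑ z, a z * (∑ y, c.ww z y * c.db y z))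
  map_add' a b := by
    refine Prod.ext ?_ (Prod.ext ?_ ?_)
    · ext z; by_cases h : c.Q z = 0 <;> simp [h]
    · ext y; simp [add_mul, Finset.sum_add_distrib]
    · simp [add_mul, Finset.sum_add_distrib]
  map_smul' r a := by
    refine Prod.ext ?_ (Prod.ext ?_ ?_)
    · ext z; by_cases h : c.Q z = 0 <;> simp [h]
    · ext y; simp [mul_assoc, Finset.mul_sum]
    · simp [mul_assoc, Finset.mul_sum]

lemma Opt.Lm_inj (h : c.Opt) : LinearMap.ker c.Lm = ⊥ := by
  rw [LinearMap.ker_eq_bot']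
  intro a ha
  have h1 : (c.Lm a).1 = 0 := by rw [ha]; rfl
  have h2 : (c.Lm a).2.1 = 0 := by rw [ha]; rfl
  have h3 : (c.Lm a).2.2 = 0 := by rw [ha]; rfl
  refine h.huniq a (fun z hz => ?_) (fun y => congrFun h2 y) h3
  have := congrFun h1 z
  simpa [Lm, hz] using this

lemma Opt.inv_bd (h : c.Opt) : ∃ K > 0, ∀ (a : Xh → ℝ) (X : ℝ), 0 ≤ X →
    (∀ z, c.Q z = 0 → |a z| ≤ X) → (∀ y, |∑ z, a z * c.ww z y| ≤ X) →
    |∑ z, a z * (∑ y, c.ww z y * c.db y z)| ≤ X → ∀ z, |a z| ≤ K * X := by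
  obtain ⟨K, hK, hl⟩ := c.Lm.exists_antilipschitzWith h.Lm_inj
  refine ⟨K, by exact_mod_cast hK, fun a X hX h1 h2 h3 z => ?_⟩
  have hd := hl.le_mul_dist a 0
  rw [map_zero, dist_zero_right, dist_zero_right] at hd
  have : ‖c.Lm a‖ ≤ X := by
    refine norm_prod_le_iff.2 ⟨?_, norm_prod_le_iff.2 ⟨?_, ?_⟩⟩
    · refine (pi_norm_le_iff_of_nonneg hX).2 fun z => ?_
      by_cases hz : c.Q z = 0
      · simpa [Lm, hz] using h1 z hz
      · simpa [Lm, hz] using hX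
    · exact (pi_norm_le_iff_of_nonneg hX).2 fun y => h2 y
    · exact h3
  calc |a z| ≤ ‖a‖ := norm_le_pi_norm a z
    _ ≤ K * ‖c.Lm a‖ := hd
    _ ≤ K * X := by gcongr

lemma db_le (c : Core 𝒳 𝒴 Xh) (y z) : |c.db y z| ≤ c.dm :=
  abs_mn_le (c.hW y).1 (c.hW y).2 (fun x => c.hdm x z)

lemma sum_Q_ww (c : Core 𝒳 𝒴 Xh) (y) : ∑ z, c.Q z * c.ww z y = c.p y := by
  have := (c.hU y).2
  unfold U at this
  calc _ = c.p y * ∑ z, c.Q z * c.ker y z := by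
        rw [Finset.mul_sum]; apply Finset.sum_congr rfl; intros; unfold ww; ring
    _ = _ := by rw [this, mul_one]

lemma Q_ww_sum (c : Core 𝒳 𝒴 Xh) (f : 𝒴 → Xh → ℝ) :
    ∑ z, c.Q z * (∑ y, c.ww z y * f y z) = mn c.p (fun y => mn (c.U y) (f y)) := by
  unfold mn U ww
  simp_rw [Finset.mul_sum]
  rw [Finset.sum_comm]
  apply Finset.sum_congr rfl; intro y _
  apply Finset.sum_congr rfl; intro z _
  ring

set_option maxHeartbeats 800000 in
lemma Opt.varctl (h : c.Opt) : ∃ C > 0, ∀ (n : ℕ) (y : Fin n → 𝒴) (z : Fin n → Xh) (E : ℝ),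
    (∀ i, c.p (y i) ≠ 0) → 0 ≤ E → (∀ b, |cy y b - n * c.p b| ≤ E) →
    |∑ i, c.v (y i) (z i) - n * c.vs| ≤
      C * (√n * √(c.G y z) + E + c.G y z + |n * c.D - ∑ i, c.db (y i) (z i)|) := by
  obtain ⟨K, hK, hinv⟩ := h.inv_bd
  obtain ⟨vb, hvb, hv⟩ := exb (fun yz : 𝒴 × Xh => c.v yz.1 yz.2)
  set C0 := ∑ e, |1 / (1 - c.m e)| with hC0
  have hC00 : 0 ≤ C0 := by positivity
  set a := (Fintype.card Xh : ℝ)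
  set b := (Fintype.card 𝒴 : ℝ)
  have ha : 0 ≤ a := by positivity
  have hb : 0 ≤ b := by positivity
  set C1 := C0 + (1 + 2 * a) + (1 + 2 * a * b * c.dm) with hC1
  have dm0 := c.dm0
  have hC10 : 0 ≤ C1 := by positivity
  set Vs := a * b * vb with hVs
  refine ⟨2 * Vs + Vs * K * C1 + 1, by positivity, ?_⟩
  intro n y z E hy hE hty
  obtain ⟨hG, hN, hoff⟩ := h.G_facts (z := z) hy
  set g := c.G y z
  set s := √(n : ℝ) * √g with hs
  have hs0 : 0 ≤ s := by positivity
  set T := |n * c.D - ∑ i, c.db (y i) (z i)| with hT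
  have hT0 : 0 ≤ T := abs_nonneg _
  set X := s + E + g + T with hX
  have hX0 : 0 ≤ X := by positivity
  have hN' : ∀ b e, |cn y z b e - cc z e * c.ww e b| ≤ 2 * s := fun b e => by
    rw [hs, ← mul_assoc]; exact hN b e
  have hA : ∀ e, |cc z e - n * c.Q e| ≤ K * (C1 * X) := by
    apply hinv _ _ (by positivity)
    · intro e he
      rw [he, mul_zero, sub_zero, abs_of_nonneg (cc_nonneg z e)]
      have hme : 0 < 1 - c.m e := by have := h.hm e he; unfold m; linarith
      have h1 : cc z e * (1 - c.m e) ≤ g :=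
        (Finset.single_le_sum (f := fun e => cc z e * (1 - c.m e))
          (fun e _ => mul_nonneg (cc_nonneg _ _) (by linarith [h.m_le e])) (Finset.mem_univ e)).trans hoff
      have h2 : |1 / (1 - c.m e)| ≤ C0 :=
        Finset.single_le_sum (f := fun e => |1 / (1 - c.m e)|) (fun e _ => abs_nonneg _) (Finset.mem_univ e)
      rw [abs_of_pos (by positivity)] at h2
      calc cc z e = (1 / (1 - c.m e)) * (cc z e * (1 - c.m e)) := by field_simp
        _ ≤ C0 * X := mul_le_mul h2 (h1.trans (by linarith)) (mul_nonneg (cc_nonneg _ _) hme.le) hC00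
        _ ≤ C1 * X := by gcongr; rw [hC1]; nlinarith [mul_nonneg (mul_nonneg ha hb) dm0.le]
    · intro b'
      have e1 : ∑ e, (cc z e - n * c.Q e) * c.ww e b' =
          (cy y b' - n * c.p b') - ∑ e, (cn y z b' e - cc z e * c.ww e b') := by
        rw [← cn_col y z b', ← c.sum_Q_ww b', Finset.mul_sum, ← Finset.sum_sub_distrib, ← Finset.sum_sub_distrib]
        apply Finset.sum_congr rfl; intros; ring
      rw [e1]
      have e2 : |∑ e, (cn y z b' e - cc z e * c.ww e b')| ≤ a * (2 * s) := by
        calc _ ≤ ∑ e, |cn y z b' e - cc z e * c.ww e b'| := Finset.abs_sum_le_sum_abs _ _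
          _ ≤ ∑ e : Xh, 2 * s := Finset.sum_le_sum fun e _ => hN' b' e
          _ = _ := by simp [a]
      calc _ ≤ |cy y b' - n * c.p b'| + |∑ e, (cn y z b' e - cc z e * c.ww e b')| := abs_sub _ _
        _ ≤ E + a * (2 * s) := add_le_add (hty b') e2
        _ ≤ (1 + 2 * a) * X := by
            have : 0 ≤ a * (E + g + T) := by positivity
            rw [hX]; nlinarith
        _ ≤ C1 * X := by gcongr; rw [hC1]; nlinarith [mul_nonneg (mul_nonneg ha hb) dm0.le]
    · have e1 : ∑ e, (cc z e - n * c.Q e) * (∑ b', c.ww e b' * c.db b' e) =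
          - (∑ b', ∑ e, (cn y z b' e - cc z e * c.ww e b') * c.db b' e) -
            (n * c.D - ∑ i, c.db (y i) (z i)) := by
        rw [← cn_sum y z c.db, ← h.hD, ← c.Q_ww_sum]
        simp_rw [sub_mul, Finset.sum_sub_distrib]
        rw [Finset.mul_sum]
        have : ∑ b', ∑ e, cc z e * c.ww e b' * c.db b' e = ∑ e, cc z e * ∑ b', c.ww e b' * c.db b' e := by
          rw [Finset.sum_comm]; simp_rw [Finset.mul_sum]
          apply Finset.sum_congr rfl; intros; apply Finset.sum_congr rfl; intros; ring
        rw [this]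
        simp_rw [mul_assoc]
        ring
      rw [e1]
      have e2 := sum2_bd (fun b' e => cn y z b' e - cc z e * c.ww e b') c.db (by positivity) hN' dm0.le
        (fun y z => c.db_le y z)
      calc _ ≤ |∑ b', ∑ e, (cn y z b' e - cc z e * c.ww e b') * c.db b' e| + T := by
            refine (abs_sub _ _).trans ?_
            rw [abs_neg]
        _ ≤ b * a * c.dm * (2 * s) + T := by gcongr
        _ ≤ (1 + 2 * a * b * c.dm) * X := by
            have : 0 ≤ a * b * c.dm * (E + g + T) := by positivity
            rw [hX]; nlinarith
        _ ≤ C1 * X := by gcongr; rw [hC1]; nlinarith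
  have e1 : ∑ i, c.v (y i) (z i) - n * c.vs =
      ∑ b', ∑ e, (cn y z b' e - cc z e * c.ww e b') * c.v b' e +
      ∑ e, ∑ b', (cc z e - n * c.Q e) * (c.ww e b' * c.v b' e) := by
    have : c.vs = ∑ z, c.Q z * (∑ y, c.ww z y * c.v y z) := (c.Q_ww_sum c.v).symm
    rw [← cn_sum y z c.v, this]
    simp_rw [sub_mul, Finset.sum_sub_distrib]
    have : ∑ b', ∑ e, cc z e * c.ww e b' * c.v b' e = ∑ e, ∑ b', cc z e * (c.ww e b' * c.v b' e) := by
      rw [Finset.sum_comm]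
      apply Finset.sum_congr rfl; intros; apply Finset.sum_congr rfl; intros; ring
    rw [this]
    simp_rw [Finset.mul_sum, mul_assoc]
    ring
  rw [e1]
  have f1 := sum2_bd (fun b' e => cn y z b' e - cc z e * c.ww e b') c.v (by positivity) hN' hvb.le
        (fun y z => hv (y, z))
  have f2 := sum2_bd (fun (e : Xh) (_ : 𝒴) => cc z e - n * c.Q e) (fun e b' => c.ww e b' * c.v b' e)
    (by positivity) (fun e _ => hA e) hvb.le (fun e b' => by
      rw [abs_mul, abs_of_nonneg (c.ww_nonneg e b')]
      calc _ ≤ 1 * vb := mul_le_mul (h.ww_le e b') (hv (b', e)) (abs_nonneg _) zero_le_one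
        _ = vb := one_mul _)
  have hVs0 : 0 ≤ Vs := by positivity
  calc _ ≤ |∑ b', ∑ e, (cn y z b' e - cc z e * c.ww e b') * c.v b' e| +
      |∑ e, ∑ b', (cc z e - n * c.Q e) * (c.ww e b' * c.v b' e)| := abs_add_le _ _
    _ ≤ b * a * vb * (2 * s) + a * b * vb * (K * (C1 * X)) := add_le_add f1 f2
    _ = 2 * Vs * s + Vs * K * C1 * X := by rw [hVs]; ring
    _ ≤ 2 * Vs * X + Vs * K * C1 * X := by gcongr; linarith
    _ ≤ _ := by nlinarith
end Core
end

open scoped BigOperators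
noncomputable section
open Real Set Filter Topology
set_option linter.unusedSectionVars false

/-- `√(log n)/√n` is eventually small -/
lemma ev_q {η : ℝ} (hη : 0 < η) : ∃ n0 : ℕ, ∀ n ≥ n0, √(log n) ≤ η * √n := by
  have h1 : Tendsto (fun n : ℕ => log n / n) atTop (𝓝 0) := by
    have := (Real.isLittleO_log_id_atTop.tendsto_div_nhds_zero).comp tendsto_natCast_atTop_atTop
    simpa [Function.comp_def] using this
  have h2 := h1.eventually (gt_mem_nhds (show 0 < η ^ 2 by positivity))
  obtain ⟨n0, hn0⟩ := eventually_atTop.1 h2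
  refine ⟨max n0 1, fun n hn => ?_⟩
  have hn1 : (1 : ℝ) ≤ n := by exact_mod_cast (le_max_right n0 1).trans hn
  have := hn0 n ((le_max_left _ _).trans hn)
  rw [div_lt_iff₀ (by linarith)] at this
  apply Real.sqrt_le_iff.2 ⟨by positivity, ?_⟩
  rw [mul_pow, Real.sq_sqrt (by linarith)]; linarith

lemma log_ge_one {n : ℕ} (hn : 3 ≤ n) : 1 ≤ log (n : ℝ) := by
  have hnR : (3 : ℝ) ≤ n := by exact_mod_cast hn
  rw [Real.le_log_iff_exp_le (by linarith)]; linarith [Real.exp_one_lt_d9]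

lemma alg_t2 {K s q lam C1 hh K4 vs rv n : ℝ} (hs : 0 < s) (hn : s ^ 2 = n) (hl : 0 < lam) (hv : 0 < vs)
    (hr : 0 < rv) : 2 * (K * (s * q) / lam) * (C1 * (s * (hh + K4 * q))) / (n * vs * (s * rv)) =
      2 * (K / lam) * C1 / (vs * rv) * (q * hh + K4 * q ^ 2) / s := by
  rw [← hn]; field_simp

lemma alg_t5 {K5 κ q hh K4 L s : ℝ} (hκ0 : 0 < κ) (hs0 : 0 < s) (hq2 : q ^ 2 = L) :
    K5 * (q * hh + K4 * L) / s - κ * hh ^ 2 / s ≤ (K5 ^ 2 / (4 * κ) + K5 * K4) * (L / s) := by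
  rw [← sub_div, ← mul_div_assoc]
  apply div_le_div_of_nonneg_right _ hs0.le
  have : K5 * (q * hh) ≤ κ * hh ^ 2 + K5 ^ 2 / (4 * κ) * q ^ 2 := by
    have : κ * hh ^ 2 + K5 ^ 2 / (4 * κ) * q ^ 2 - K5 * (q * hh) = (2 * κ * hh - K5 * q) ^ 2 / (4 * κ) := by
      field_simp; ring
    have : 0 ≤ (2 * κ * hh - K5 * q) ^ 2 / (4 * κ) := by positivity
    linarith
  rw [hq2] at this
  nlinarith

lemma conv_real {K lam dm C1 vs : ℝ} (hK : 0 < K) (lam0 : 0 < lam) (dm0 : 0 < dm) (hC1 : 0 < C1) (hvs : 0 < vs) :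
    ∃ C > 0, ∃ η > 0, ∀ s q G A T vn γ : ℝ, 1 ≤ s → 1 ≤ q → q ≤ η * s → 0 ≤ G → |A| ≤ K * (s * q) →
      G + lam * T < A → -(4 * dm * (s * q)) ≤ T →
      |vn - s ^ 2 * vs| ≤ C1 * (s * √G + K * (s * q) + G + |T|) → γ ≤ K * q ^ 2 →
      0 < vn ∧ Phi (T / √vn) + 40 * dm / √vn ≤ Phi ((A - γ) / (lam * (s * √vs))) + C * (q ^ 2 / s) := by
  obtain ⟨K2, hK2⟩ : ∃ x, x = K / lam + 4 * dm := ⟨_, rfl⟩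
  obtain ⟨K3, hK3⟩ : ∃ x, x = K + 4 * dm * lam := ⟨_, rfl⟩
  have hK20 : 0 < K2 := by rw [hK2]; positivity
  have hK30 : 0 < K3 := by rw [hK3]; positivity
  obtain ⟨K4, hK4⟩ : ∃ x, x = K + K3 + K2 := ⟨_, rfl⟩
  have hK40 : 0 < K4 := by rw [hK4]; positivity
  obtain ⟨θ, hθ⟩ : ∃ x, x = vs / (4 * C1) := ⟨_, rfl⟩
  have hθ0 : 0 < θ := by rw [hθ]; positivity
  obtain ⟨rv, hrv⟩ : ∃ x, x = √vs := ⟨_, rfl⟩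
  have hrv0 : 0 < rv := by rw [hrv]; exact Real.sqrt_pos.2 hvs
  have hrv2 : rv ^ 2 = vs := by rw [hrv]; exact Real.sq_sqrt hvs.le
  obtain ⟨K5, hK5⟩ : ∃ x, x = 2 * (K / lam) * C1 / (vs * rv) := ⟨_, rfl⟩
  have hK50 : 0 < K5 := by rw [hK5]; positivity
  obtain ⟨κ, hκ⟩ : ∃ x, x = 1 / (2 * lam * rv) := ⟨_, rfl⟩
  have hκ0 : 0 < κ := by rw [hκ]; positivity
  refine ⟨K5 ^ 2 / (4 * κ) + K5 * K4 + K / (lam * rv) + 80 * dm / rv, by positivity,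
    min (θ ^ 2 / K3) (θ / K4), by positivity, ?_⟩
  intro s q G A T vn γ hs1 hq1 hq hG0 hA hGT hTs hΔ hγ
  have hs0 : 0 < s := by linarith
  have hq0 : 0 < q := by linarith
  have hsq0 : 0 < s * q := by positivity
  obtain ⟨hh, hhd⟩ : ∃ x, x = √G := ⟨_, rfl⟩
  have hh0 : 0 ≤ hh := by rw [hhd]; exact Real.sqrt_nonneg _
  have hh2 : hh ^ 2 = G := by rw [hhd]; exact Real.sq_sqrt hG0
  rw [← hhd] at hΔ
  rw [← hrv]
  have hA' := abs_le.1 hA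
  have hG3 : G ≤ K3 * (s * q) := by rw [hK3]; nlinarith
  have hTabs : |T| ≤ K2 * (s * q) := by
    have p1 : 0 ≤ K / lam * (s * q) := by positivity
    have p2 : 0 ≤ 4 * dm * (s * q) := by positivity
    have p3 : K2 * (s * q) = K / lam * (s * q) + 4 * dm * (s * q) := by rw [hK2]; ring
    rw [abs_le]; constructor
    · linarith
    · have : T ≤ K / lam * (s * q) := by
        rw [div_mul_eq_mul_div, le_div_iff₀ lam0]; linarith
      linarith
  have hΔ' : |vn - s ^ 2 * vs| ≤ C1 * (s * (hh + K4 * q)) := by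
    refine hΔ.trans ?_
    apply mul_le_mul_of_nonneg_left _ hC1.le
    have : s * (hh + K4 * q) = s * hh + K * (s * q) + K3 * (s * q) + K2 * (s * q) := by rw [hK4]; ring
    linarith
  have hq3 : q ≤ θ ^ 2 / K3 * s := hq.trans (by gcongr; exact min_le_left _ _)
  have hq4 : q ≤ θ / K4 * s := hq.trans (by gcongr; exact min_le_right _ _)
  have hhθ : hh ≤ θ * s := by
    have h1 : hh ^ 2 ≤ (θ * s) ^ 2 := by
      rw [hh2]
      calc _ ≤ K3 * (s * q) := hG3
        _ ≤ K3 * (s * (θ ^ 2 / K3 * s)) := by gcongr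
        _ = _ := by field_simp
    exact (abs_le_of_sq_le_sq' h1 (by positivity)).2
  have hqθ : K4 * q ≤ θ * s := by
    calc _ ≤ K4 * (θ / K4 * s) := by gcongr
      _ = _ := by field_simp
  have hhalf : |vn - s ^ 2 * vs| ≤ s ^ 2 * vs / 2 := by
    refine hΔ'.trans ?_
    calc C1 * (s * (hh + K4 * q)) ≤ C1 * (s * (θ * s + θ * s)) := by gcongr
      _ = s ^ 2 * vs / 2 := by rw [hθ]; field_simp; ring
  have hV0 : 0 < s ^ 2 * vs := by positivity
  have hab := abs_le.1 hhalf
  have hvnp : 0 < vn := by linarith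
  refine ⟨hvnp, ?_⟩
  have hsv : √(s ^ 2 * vs) = s * rv := by rw [Real.sqrt_mul (by positivity), Real.sqrt_sq hs0.le, hrv]
  have cs := (abs_le.1 (cmp_sqrt hV0 hhalf (A / lam))).2
  rw [hsv] at cs
  have hsvn0 : 0 < √vn := Real.sqrt_pos.2 hvnp
  have hsvn2 : √vn ^ 2 = vn := Real.sq_sqrt hvnp.le
  generalize √vn = w at *
  have hw1 : s * rv ≤ 2 * w := by
    refine (abs_le_of_sq_le_sq' ?_ (by positivity)).2
    rw [mul_pow, mul_pow, hrv2, hsvn2]; linarith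
  have hw2 : w ≤ 2 * (s * rv) := by
    refine (abs_le_of_sq_le_sq' ?_ (by positivity)).2
    rw [mul_pow, mul_pow, hrv2, hsvn2]; linarith
  have hqq : 1 ≤ q ^ 2 := one_le_pow₀ hq1
  have t1 : 40 * dm / w ≤ 80 * dm / rv * (q ^ 2 / s) := by
    calc 40 * dm / w ≤ 80 * dm / (s * rv) := by
          rw [div_le_div_iff₀ hsvn0 (by positivity)]
          have := mul_le_mul_of_nonneg_left hw1 (by positivity : 0 ≤ 40 * dm)
          linarith
      _ = 80 * dm / rv * (1 / s) := by field_simp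
      _ ≤ _ := by gcongr
  have t2 : 2 * |A / lam| * |vn - s ^ 2 * vs| / (s ^ 2 * vs * (s * rv)) ≤ K5 * (q * hh + K4 * q ^ 2) / s := by
    rw [abs_div, abs_of_pos lam0]
    calc _ ≤ 2 * (K * (s * q) / lam) * (C1 * (s * (hh + K4 * q))) / (s ^ 2 * vs * (s * rv)) := by gcongr
      _ = K5 * (q * hh + K4 * q ^ 2) / s := by rw [hK5]; exact alg_t2 hs0 rfl lam0 hvs hrv0
  have t3 : T / w ≤ A / lam / w - κ * hh ^ 2 / s := by
    have a1 : T ≤ (A - G) / lam := by rw [le_div_iff₀ lam0]; linarith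
    have a2 : κ * hh ^ 2 / s ≤ G / lam / w := by
      rw [hh2, hκ, div_div, div_le_div_iff₀ hs0 (by positivity)]
      have : 1 / (2 * lam * rv) * G * (lam * w) = G * (w / (2 * rv)) := by field_simp
      rw [this]
      apply mul_le_mul_of_nonneg_left _ hG0
      rw [div_le_iff₀ (by positivity)]; linarith
    calc T / w ≤ (A - G) / lam / w := by gcongr
      _ = A / lam / w - G / lam / w := by ring
      _ ≤ _ := by linarith
  have t4 : A / lam / (s * rv) ≤ (A - γ) / (lam * (s * rv)) + K / (lam * rv) * (q ^ 2 / s) := by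
    have e : A / lam / (s * rv) = (A - γ) / (lam * (s * rv)) + γ / (lam * (s * rv)) := by
      rw [div_div]; ring
    rw [e]
    gcongr
    calc γ / (lam * (s * rv)) ≤ K * q ^ 2 / (lam * (s * rv)) := by gcongr
      _ = _ := by field_simp
  have t5 : K5 * (q * hh + K4 * q ^ 2) / s - κ * hh ^ 2 / s ≤ (K5 ^ 2 / (4 * κ) + K5 * K4) * (q ^ 2 / s) :=
    alg_t5 hκ0 hs0 rfl
  have e6 : (K5 ^ 2 / (4 * κ) + K5 * K4 + K / (lam * rv)) * (q ^ 2 / s) =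
    (K5 ^ 2 / (4 * κ) + K5 * K4) * (q ^ 2 / s) + K / (lam * rv) * (q ^ 2 / s) := by ring
  have t6 := Phi_lip'' (a := (A - γ) / (lam * (s * rv))) (b := T / w)
    (c := (K5 ^ 2 / (4 * κ) + K5 * K4 + K / (lam * rv)) * (q ^ 2 / s)) (by positivity) (by
      rw [e6]; linarith)
  have : (K5 ^ 2 / (4 * κ) + K5 * K4 + K / (lam * rv) + 80 * dm / rv) * (q ^ 2 / s) =
    (K5 ^ 2 / (4 * κ) + K5 * K4 + K / (lam * rv)) * (q ^ 2 / s) + 80 * dm / rv * (q ^ 2 / s) := by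
    ring
  rw [this]
  linarith

namespace Core
open Classical
variable {𝒳 𝒴 Xh : Type} [Fintype 𝒳] [Fintype 𝒴] [Fintype Xh] {c : Core 𝒳 𝒴 Xh}

/-- Hoeffding for the success probability -/
lemma g_small {n : ℕ} (hn : 1 ≤ n) (y : Fin n → 𝒴) (z : Fin n → Xh)
    (hT : n * c.D - ∑ i, c.db (y i) (z i) < - (4 * c.dm * √(n * log n))) : c.g y z ≤ 2 / n := by
  refine le_trans ?_ (hoeff2 (fun i => c.hW (y i)) (fun i x => c.d x (z i)) c.dm0 (fun i x => c.hdm x _) hn)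
  apply ew_mono (fun i => c.hW (y i)); intro x _
  apply ind_mono; intro hx
  have e : ∑ i, mn (c.W (y i)) (fun x => c.d x (z i)) = ∑ i, c.db (y i) (z i) := rfl
  rw [e, lt_abs]; right; linarith

lemma g_berry {n : ℕ} (y : Fin n → 𝒴) (z : Fin n → Xh) (hv : 0 < ∑ i, c.v (y i) (z i)) :
    |c.g y z - Phi ((n * c.D - ∑ i, c.db (y i) (z i)) / √(∑ i, c.v (y i) (z i)))| ≤
      40 * c.dm / √(∑ i, c.v (y i) (z i)) :=
  berry (fun i => c.hW (y i)) (fun i x => c.d x (z i)) (fun i x => c.hdm x _) c.dm0.le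
    (Real.sqrt_pos.2 hv) (by rw [Real.sq_sqrt hv.le]; rfl) _

lemma two_div_le {n : ℕ} (hn : 3 ≤ n) : 1 / (n : ℝ) ≤ log n / √n := by
  have hL := log_ge_one hn
  have hnR : (3 : ℝ) ≤ n := by exact_mod_cast hn
  have hs0 : 0 < √(n : ℝ) := Real.sqrt_pos.2 (by linarith)
  rw [div_le_div_iff₀ (by linarith) hs0]
  have : √(n : ℝ) ≤ n := by
    rw [Real.sqrt_le_iff]; constructor <;> nlinarith
  nlinarith

lemma Opt.conv_pt_pos (h : c.Opt) (hvs : 0 < c.vs) (K : ℝ) (hK : 0 < K) :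
    ∃ C > 0, ∃ n0 : ℕ, ∀ n ≥ n0, ∀ (y : Fin n → 𝒴) (z : Fin n → Xh) (l γ : ℝ),
      (∀ i, c.p (y i) ≠ 0) → (∀ b, |cy y b - n * c.p b| ≤ K * √(n * log n)) →
      |l + γ - c.jn y| ≤ K * √(n * log n) → γ ≤ K * log n →
      Kw y z < exp (l + γ) * ∏ i, c.p (y i) →
      c.g y z ≤ Phi ((l - c.jn y) / √(n * (c.lam ^ 2 * c.vs))) + C * (log n / √n) := by
  obtain ⟨C1, hC1, hvc⟩ := h.varctl
  have lam0 := c.lam0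
  have dm0 := c.dm0
  obtain ⟨C, hC, η, hη, hr⟩ := conv_real hK lam0 dm0 hC1 hvs
  obtain ⟨n1, hn1⟩ := ev_q hη
  refine ⟨C + 2, by positivity, max n1 3, ?_⟩
  intro n hn y z l γ hy hcy hA hγ hKw
  have hn3 : 3 ≤ n := (le_max_right _ _).trans hn
  have hL := log_ge_one hn3
  have hnR : (3 : ℝ) ≤ n := by exact_mod_cast hn3
  have hq := hn1 n ((le_max_left _ _).trans hn)
  have hs0 : 0 < √(n : ℝ) := Real.sqrt_pos.2 (by linarith)
  have hs1 : 1 ≤ √(n : ℝ) := by rw [Real.one_le_sqrt]; linarith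
  have hs2 : √(n : ℝ) ^ 2 = n := Real.sq_sqrt (by linarith)
  have hq2 : √(log n) ^ 2 = log n := Real.sq_sqrt (by linarith)
  have hq1 : 1 ≤ √(log n) := by rw [Real.one_le_sqrt]; exact hL
  have hsq : √(n * log n) = √(n : ℝ) * √(log n) := Real.sqrt_mul (by linarith) _
  rw [hsq] at hcy hA
  have hGl := G_lt hy hKw
  obtain ⟨hG0, -, -⟩ := h.G_facts (z := z) hy
  have hjn : c.jn y = ∑ i, c.be (y i) - c.lam * (n * c.D) := by
    unfold jn; rw [Finset.sum_sub_distrib]; simp; ring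
  have hGT : c.G y z + c.lam * (n * c.D - ∑ i, c.db (y i) (z i)) < l + γ - c.jn y := by rw [hjn]; linarith
  have PhiN := Phi_nonneg ((l - c.jn y) / √(n * (c.lam ^ 2 * c.vs)))
  have hLs : 0 < log (n : ℝ) / √(n : ℝ) := by positivity
  by_cases hTs : n * c.D - ∑ i, c.db (y i) (z i) < -(4 * c.dm * (√(n : ℝ) * √(log n)))
  · have h1 := g_small (c := c) (by omega) y z (by rw [hsq]; exact hTs)
    have h2 := two_div_le hn3
    have h3 : 2 / (n : ℝ) = 2 * (1 / n) := by ring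
    rw [add_mul]
    have := mul_pos hC hLs
    linarith
  push Not at hTs
  have hΔ := hvc n y z (K * (√(n : ℝ) * √(log n))) hy (by positivity) hcy
  obtain ⟨hv, hf⟩ := hr (√(n : ℝ)) (√(log n)) (c.G y z) (l + γ - c.jn y) (n * c.D - ∑ i, c.db (y i) (z i))
    (∑ i, c.v (y i) (z i)) γ hs1 hq1 hq hG0 hA hGT hTs (by rw [hs2]; exact hΔ) (by rw [hq2]; exact hγ)
  have bb := (abs_le.1 (g_berry (c := c) y z hv)).2
  have e1 : √(n * (c.lam ^ 2 * c.vs)) = c.lam * (√(n : ℝ) * √c.vs) := by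
    rw [← Real.sqrt_mul (by linarith), show (n : ℝ) * (c.lam ^ 2 * c.vs) = c.lam ^ 2 * (n * c.vs) by ring,
      Real.sqrt_mul (by positivity), Real.sqrt_sq lam0.le]
  rw [hq2, show l + γ - c.jn y - γ = l - c.jn y by ring, ← e1] at hf
  rw [add_mul]
  linarith
end Core
end

open scoped BigOperators
noncomputable section
open Real Set Filter Topology
set_option linter.unusedSectionVars false

lemma ex_low {α : Type} [Fintype α] (P : α → Prop) (f : α → ℝ) (h : ∀ a, P a → 0 < f a) :
    ∃ c0 > 0, ∀ a, P a → c0 ≤ f a := by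
  obtain ⟨b, hb, hf⟩ := exb (fun a => 1 / f a)
  refine ⟨1 / b, by positivity, fun a ha => ?_⟩
  have h1 := h a ha
  have h2 := le_of_abs_le (hf a)
  rw [div_le_iff₀ h1] at h2
  rw [div_le_iff₀ hb]; linarith

namespace Core
open Classical
variable {𝒳 𝒴 Xh : Type} [Fintype 𝒳] [Fintype 𝒴] [Fintype Xh] {c : Core 𝒳 𝒴 Xh}

lemma vs_zero (hvs : c.vs = 0) {y z} (hy : c.p y ≠ 0) (hz : c.Q z ≠ 0) {x} (hx : c.W y x ≠ 0) :
    c.d x z = c.db y z := by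
  have n1 : ∀ y, 0 ≤ c.p y * mn (c.U y) (c.v y) := fun y => mul_nonneg (c.hp.1 y) (Finset.sum_nonneg fun z _ =>
    mul_nonneg ((c.hU y).1 z) (c.v_nonneg y z))
  have h1 := (Finset.sum_eq_zero_iff_of_nonneg (fun y _ => n1 y)).1 hvs y (Finset.mem_univ _)
  have h2 := (mul_eq_zero.1 h1).resolve_left hy
  have h3 := (Finset.sum_eq_zero_iff_of_nonneg (fun z _ =>
    mul_nonneg ((c.hU y).1 z) (c.v_nonneg y z))).1 h2 z (Finset.mem_univ _)
  have h4 : c.v y z = 0 := (mul_eq_zero.1 h3).resolve_left (mul_ne_zero hz (c.ker_pos y z).ne')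
  unfold v vr at h4
  have h5 := (Finset.sum_eq_zero_iff_of_nonneg (fun x _ =>
    mul_nonneg ((c.hW y).1 x) (sq_nonneg _))).1 h4 x (Finset.mem_univ _)
  have h6 := (mul_eq_zero.1 h5).resolve_left hx
  have h7 := pow_eq_zero_iff (two_ne_zero) |>.1 h6
  unfold db; linarith

lemma g_le_one {n : ℕ} (y : Fin n → 𝒴) (z : Fin n → Xh) : c.g y z ≤ 1 :=
  ew_ind_le_one (fun i => c.hW (y i)) _

lemma jn_eq {n : ℕ} (y : Fin n → 𝒴) : c.jn y = ∑ i, c.be (y i) - c.lam * (n * c.D) := by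
  unfold jn; rw [Finset.sum_sub_distrib]; simp; ring

lemma Opt.conv_pt_zero (h : c.Opt) (hvs : c.vs = 0) (K : ℝ) (hK : 0 < K) :
    ∃ C > 0, ∀ n ≥ 3, ∀ (y : Fin n → 𝒴) (z : Fin n → Xh) (l γ : ℝ),
      (∀ i, c.p (y i) ≠ 0) → γ ≤ K * log n →
      Kw y z < exp (l + γ) * ∏ i, c.p (y i) →
      c.g y z ≤ ind (c.jn y ≤ l + C * log n) + 1 / n := by
  have lam0 := c.lam0
  have dm0 := c.dm0
  obtain ⟨c0, hc0, hc⟩ := ex_low (fun z => c.Q z = 0) (fun z => 1 - c.m z)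
    (fun z hz => by have := h.hm z hz; unfold m; linarith)
  obtain ⟨K0, hK0⟩ : ∃ K0, K0 = 4 * c.lam * c.dm + 4 * c.lam ^ 2 * c.dm ^ 2 / c0 := ⟨_, rfl⟩
  have hK00 : 0 < K0 := by rw [hK0]; positivity
  have hKa : 16 * c.lam ^ 2 * c.dm ^ 2 ≤ K0 ^ 2 := by
    have : 4 * c.lam * c.dm ≤ K0 := by rw [hK0]; linarith [show 0 < 4 * c.lam ^ 2 * c.dm ^ 2 / c0 by positivity]
    have := pow_le_pow_left₀ (by positivity) this 2
    nlinarith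
  have hKb : 16 * c.lam ^ 2 * c.dm ^ 2 ≤ 4 * K0 * c0 := by
    have : 4 * c.lam ^ 2 * c.dm ^ 2 / c0 ≤ K0 := by rw [hK0]; linarith [show 0 < 4 * c.lam * c.dm by positivity]
    rw [div_le_iff₀ hc0] at this; linarith
  refine ⟨K + K0, by positivity, ?_⟩
  intro n hn y z l γ hy hγ hKw
  have hL := log_ge_one hn
  have hn0 : (0 : ℝ) < n := by positivity
  by_cases hj : c.jn y ≤ l + (K + K0) * log n
  · rw [ind_true hj]
    have := g_le_one (c := c) y z
    have : 0 < 1 / (n : ℝ) := by positivity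
    linarith
  rw [ind_false hj, zero_add]
  push Not at hj
  have hGl := G_lt hy hKw
  obtain ⟨hG0, -, hoff⟩ := h.G_facts (z := z) hy
  rw [jn_eq] at hj
  obtain ⟨N, hN⟩ : ∃ N, N = ∑ i, (if c.Q (z i) = 0 then (1 : ℝ) else 0) := ⟨_, rfl⟩
  have hN0 : 0 ≤ N := by rw [hN]; positivity
  have hGN : c0 * N ≤ c.G y z := by
    refine le_trans ?_ hoff
    rw [hN, cc_sum z (fun e => 1 - c.m e), Finset.mul_sum]
    apply Finset.sum_le_sum; intro i _
    split_ifs with hi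
    · simpa using hc _ hi
    · simpa using h.m_le (z i)
  have hoe := hoeff_aux (fun i => c.hW (y i)) (fun i x => c.db (y i) (z i) - c.d x (z i))
    (fun i => by rw [mn_sub, mn_const (c.hW _).2]; simp [db])
    (b := fun i => if c.Q (z i) = 0 then 2 * c.dm else 0) (fun i x hx => by
      split_ifs with hi
      · have := c.db_le (y i) (z i)
        have := c.hdm x (z i)
        exact (abs_sub _ _).trans (by linarith)
      · rw [vs_zero hvs (hy i) hi hx]; simp)
    (B := (2 * c.dm) ^ 2 * (N + 1)) (by positivity) (by
      have : ∀ i, (if c.Q (z i) = 0 then 2 * c.dm else 0) ^ 2 = (2 * c.dm) ^ 2 * (if c.Q (z i) = 0 then (1 : ℝ) else 0) := by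
        intro i; split_ifs <;> simp
      simp_rw [this]
      rw [← Finset.mul_sum, ← hN]
      have : 0 ≤ (2 * c.dm) ^ 2 := by positivity
      nlinarith)
    (t := (K0 * log n + c0 * N) / c.lam) (by positivity)
  refine le_trans ?_ (hoe.trans ?_)
  · apply ew_mono (fun i => c.hW (y i)); intro x _
    apply ind_mono; intro hx
    rw [Finset.sum_sub_distrib, div_le_iff₀ lam0]
    have : c.lam * ∑ i, c.d (x i) (z i) ≤ c.lam * (n * c.D) := by gcongr
    linarith
  · rw [show 1 / (n : ℝ) = exp (-log n) by rw [Real.exp_neg, Real.exp_log hn0, one_div]]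
    apply Real.exp_le_exp.2
    rw [neg_le_neg_iff, le_div_iff₀ (by positivity), div_pow, le_div_iff₀ (by positivity)]
    have a1 : 16 * c.lam ^ 2 * c.dm ^ 2 * log n ≤ K0 ^ 2 * log n ^ 2 := by
      calc _ ≤ K0 ^ 2 * log n := by gcongr
        _ ≤ _ := by gcongr; nlinarith
    have a2 : 16 * c.lam ^ 2 * c.dm ^ 2 * (log n * N) ≤ 4 * K0 * c0 * (log n * N) := by gcongr
    nlinarith [sq_nonneg (K0 * log n - c0 * N)]
end Core
end

open scoped BigOperators
noncomputable section
open Real Set Filter Topology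
set_option linter.unusedSectionVars false

namespace Core
open Classical
variable {𝒳 𝒴 Xh : Type} [Fintype 𝒳] [Fintype 𝒴] [Fintype Xh] {c : Core 𝒳 𝒴 Xh}

lemma Opt.jn_berry (h : c.Opt) (hvs : c.vs = 0) : ∃ C > 0, ∀ n : ℕ, 1 ≤ n → ∀ x : ℝ,
    |ew (fun _ : Fin n => c.p) (fun y => ind (c.jn y ≤ x)) - Phi ((x - n * c.R) / √(n * c.Vt))| ≤ C / √n := by
  obtain ⟨b, hb, hbe⟩ := exb (fun y => c.be y - c.lam * c.D)
  have hV := h.hV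
  have sV := Real.sqrt_pos.2 hV
  refine ⟨40 * b / √c.Vt, by positivity, fun n hn x => ?_⟩
  have hn0 : (0 : ℝ) < n := by exact_mod_cast hn
  have hm : mn c.p (fun y => c.be y - c.lam * c.D) = c.R := by
    rw [mn_sub, mn_const c.hp.2]; rfl
  have hvr : vr c.p (fun y => c.be y - c.lam * c.D) = c.Vt := by
    unfold Vt; rw [hvs, mul_zero, add_zero]
    unfold vr; rw [hm]; unfold R
    apply Finset.sum_congr rfl; intros; ring
  have := berry (c.hp.ch n) (fun _ y => c.be y - c.lam * c.D) (fun _ => hbe) hb.le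
    (σ := √(n * c.Vt)) (Real.sqrt_pos.2 (by positivity)) (by
      rw [Real.sq_sqrt (by positivity)]; simp [hvr]) x
  simp only [hm, Finset.sum_const, Finset.card_univ, Fintype.card_fin, nsmul_eq_mul] at this
  have e : 40 * b / √(n * c.Vt) = 40 * b / √c.Vt / √n := by
    rw [Real.sqrt_mul hn0.le, div_div, mul_comm (√c.Vt)]
  rw [← e]; exact this

lemma mn_ind {α : Type} [Fintype α] (p : α → ℝ) (b : α) : mn p (fun a => if a = b then 1 else 0) = p b := by
  unfold mn; simp

/-- simultaneous typicality -/
lemma typ_all (c : Core 𝒳 𝒴 Xh) : ∃ K > 0, ∃ B : ∀ n : ℕ, (Fin n → 𝒴) → ℝ,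
    (∀ n y, 0 ≤ B n y) ∧ (∀ n : ℕ, 1 ≤ n → ew (fun _ : Fin n => c.p) (B n) ≤ K / n) ∧
    ∀ (n : ℕ) (y : Fin n → 𝒴), 1 ≤ B n y ∨ ((∀ b, |cy y b - n * c.p b| ≤ K * √(n * log n)) ∧
      |c.jn y - n * c.R| ≤ K * √(n * log n)) := by
  have hb := fun b : 𝒴 => typ c.hp (fun a => if a = b then 1 else 0)
  choose Kb hKb hT using hb
  obtain ⟨Kj, hKj, hTj⟩ := typ c.hp (fun y => c.be y - c.lam * c.D)
  have hm : mn c.p (fun y => c.be y - c.lam * c.D) = c.R := by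
    rw [mn_sub, mn_const c.hp.2]; rfl
  rw [hm] at hTj
  simp_rw [mn_ind] at hT
  have hKs : 0 ≤ ∑ b, Kb b := Finset.sum_nonneg fun b _ => (hKb b).le
  refine ⟨Kj + ∑ b, Kb b + 2 + 2 * Fintype.card 𝒴, by positivity, fun n y =>
    ind (Kj * √(n * log n) < |∑ i, (c.be (y i) - c.lam * c.D) - n * c.R|) +
    ∑ b, ind (Kb b * √(n * log n) < |∑ i, (if y i = b then (1 : ℝ) else 0) - n * c.p b|), ?_, ?_, ?_⟩
  · intro n y
    exact add_nonneg (ind_nonneg _) (Finset.sum_nonneg fun b _ => ind_nonneg _)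
  · intro n hn
    have hn0 : (0 : ℝ) < n := by exact_mod_cast hn
    rw [ew_add, ew_sum]
    have h1 := hTj n hn
    have h2 := Finset.sum_le_sum (fun b (_ : b ∈ Finset.univ) => hT b n hn)
    simp only [Finset.sum_const, Finset.card_univ, nsmul_eq_mul] at h2
    calc _ ≤ 2 / (n : ℝ) + Fintype.card 𝒴 * (2 / n) := add_le_add h1 h2
      _ = (2 + 2 * Fintype.card 𝒴) / n := by ring
      _ ≤ _ := by gcongr; linarith
  · intro n y; beta_reduce
    by_cases hj : Kj * √(n * log n) < |∑ i, (c.be (y i) - c.lam * c.D) - n * c.R|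
    · left; rw [ind_true hj]
      have : 0 ≤ ∑ b, ind (Kb b * √(n * log n) < |∑ i, (if y i = b then (1 : ℝ) else 0) - n * c.p b|) :=
        Finset.sum_nonneg fun b _ => ind_nonneg _
      linarith
    by_cases hbb : ∃ b, Kb b * √(n * log n) < |∑ i, (if y i = b then (1 : ℝ) else 0) - n * c.p b|
    · left
      obtain ⟨b, hb⟩ := hbb
      have h1 := Finset.single_le_sum (f := fun b => ind (Kb b * √(n * log n) < |∑ i, (if y i = b then (1 : ℝ) else 0) - n * c.p b|))
        (fun b _ => ind_nonneg _) (Finset.mem_univ b)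
      beta_reduce at h1
      rw [ind_true hb] at h1
      have := ind_nonneg (Kj * √(n * log n) < |∑ i, (c.be (y i) - c.lam * c.D) - n * c.R|)
      linarith
    right
    push Not at hj hbb
    have hs : 0 ≤ √(n * log n) := Real.sqrt_nonneg _
    have hc : (0 : ℝ) ≤ 2 * Fintype.card 𝒴 := by positivity
    constructor
    · intro b
      refine (hbb b).trans ?_
      have : Kb b ≤ ∑ b, Kb b := Finset.single_le_sum (fun b _ => (hKb b).le) (Finset.mem_univ b)
      gcongr; linarith
    · refine le_trans hj ?_
      gcongr; linarith

lemma log_succ_le {n : ℕ} (hn : 3 ≤ n) : log ((n : ℝ) + 1) ≤ 2 * log n := by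
  have hnR : (3 : ℝ) ≤ n := by exact_mod_cast hn
  have : 2 * log (n : ℝ) = log ((n : ℝ) ^ 2) := by rw [Real.log_pow]; norm_num
  rw [this]
  apply Real.log_le_log (by linarith); nlinarith

set_option maxHeartbeats 800000 in
theorem Opt.conv (h : c.Opt) (B : ℝ) (hB : 0 ≤ B) :
    ∃ C > 0, ∃ n0 : ℕ, ∀ n ≥ n0, ∀ l : ℝ, |l - n * c.R| ≤ B * √n →
      ∀ (𝒞 : Finset (Fin n → Xh)), (𝒞.card : ℝ) ≤ exp l → ∀ ζ : (Fin n → 𝒴) → (Fin n → Xh),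
      (∀ y, ζ y ∈ 𝒞) →
      ew (fun _ : Fin n => c.p) (fun y => c.g y (ζ y)) ≤ Phi ((l - n * c.R) / √(n * c.Vt)) + C * (log n / √n) := by
  obtain ⟨ab, hab⟩ : ∃ k : ℕ, k = Fintype.card 𝒴 * Fintype.card Xh := ⟨_, rfl⟩
  have hab0 : (0 : ℝ) ≤ ab := by positivity
  have union : ∀ n : ℕ, 3 ≤ n → ∀ l : ℝ, ∀ (𝒞 : Finset (Fin n → Xh)), (𝒞.card : ℝ) ≤ exp l →
      ∀ ζ : (Fin n → 𝒴) → (Fin n → Xh), (∀ y, ζ y ∈ 𝒞) →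
      ew (fun _ : Fin n => c.p) (fun y => ind (exp (l + (ab + 1) * log ((n : ℝ) + 1)) * ∏ i, c.p (y i) ≤ Kw y (ζ y))) ≤ 1 / n := by
    intro n hn l 𝒞 hM ζ hζ
    refine (conv_union c.hp 𝒞 ζ hζ _).trans ?_
    rw [← hab]
    have hn0 : (0 : ℝ) < n := by positivity
    have hn1 : (0 : ℝ) < n + 1 := by positivity
    have e : exp (-(l + (ab + 1) * log ((n : ℝ) + 1))) = exp (-l) * (((n : ℝ) + 1) ^ ab)⁻¹ * ((n : ℝ) + 1)⁻¹ := by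
      rw [neg_add, Real.exp_add, Real.exp_neg ((ab + 1) * log ((n : ℝ) + 1)), mul_comm _ (log _),
        ← Real.rpow_def_of_pos hn1, Real.rpow_add hn1, Real.rpow_natCast, Real.rpow_one, mul_inv]
      ring
    rw [e]
    have hp : 0 < ((n : ℝ) + 1) ^ ab := by positivity
    calc _ = (𝒞.card * exp (-l)) * ((n : ℝ) + 1)⁻¹ := by field_simp
      _ ≤ (exp l * exp (-l)) * ((n : ℝ) + 1)⁻¹ := by gcongr
      _ = ((n : ℝ) + 1)⁻¹ := by rw [← Real.exp_add]; simp
      _ ≤ _ := by rw [one_div]; gcongr; linarith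
  rcases c.vs_nonneg.eq_or_lt with hvs | hvs
  · -- zero conditional variance
    have hvs := hvs.symm
    obtain ⟨C1, hC1, hpt⟩ := h.conv_pt_zero hvs (2 * (ab + 1)) (by positivity)
    obtain ⟨C2, hC2, hbe⟩ := h.jn_berry hvs
    have sV := Real.sqrt_pos.2 h.hV
    refine ⟨C1 / √c.Vt + C2 + 2, by positivity, 3, ?_⟩
    intro n hn l hl 𝒞 hM ζ hζ
    have hn0 : (0 : ℝ) < n := by positivity
    have hL := log_ge_one hn
    have hs0 : 0 < √(n : ℝ) := Real.sqrt_pos.2 hn0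
    have hu := union n hn l 𝒞 hM ζ hζ
    have hγ := log_succ_le hn
    have hmono := ew_mono (c.hp.ch n) (F := fun y => c.g y (ζ y)) (G := fun y =>
      ind (c.jn y ≤ l + C1 * log n) + 1 / n + ind (exp (l + (ab + 1) * log ((n : ℝ) + 1)) * ∏ i, c.p (y i) ≤ Kw y (ζ y)))
      (fun y hy => by
        by_cases hk : exp (l + (ab + 1) * log ((n : ℝ) + 1)) * ∏ i, c.p (y i) ≤ Kw y (ζ y)
        · rw [ind_true hk]
          have := g_le_one (c := c) y (ζ y)
          have := ind_nonneg (c.jn y ≤ l + C1 * log n)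
          have : 0 < 1 / (n : ℝ) := by positivity
          linarith
        · have := ind_nonneg (exp (l + (ab + 1) * log ((n : ℝ) + 1)) * ∏ i, c.p (y i) ≤ Kw y (ζ y))
          push Not at hk
          have := hpt n hn y (ζ y) l _ hy (by
            calc (ab + 1) * log ((n : ℝ) + 1) ≤ (ab + 1) * (2 * log n) := by gcongr
              _ = _ := by ring) hk
          linarith)
    rw [ew_add, ew_add, ew_const (c.hp.ch n)] at hmono
    have hb := (abs_le.1 (hbe n (by omega) (l + C1 * log n))).2
    have hphi := Phi_lip'' (a := (l - n * c.R) / √(n * c.Vt)) (b := (l + C1 * log n - n * c.R) / √(n * c.Vt))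
      (c := C1 / √c.Vt * (log n / √n)) (by positivity) (by
        apply le_of_eq
        rw [Real.sqrt_mul hn0.le]; field_simp; ring)
    have h2 := two_div_le hn
    have h3 : C2 / √n ≤ C2 * (log n / √n) := by
      rw [← mul_div_assoc]; gcongr; nlinarith
    have : (C1 / √c.Vt + C2 + 2) * (log n / √n) = C1 / √c.Vt * (log n / √n) + C2 * (log n / √n) + 2 * (log n / √n) := by ring
    rw [this]
    linarith
  · obtain ⟨K, hK, Bd, hBd0, hBd1, hBd2⟩ := c.typ_all
    obtain ⟨K', hK'⟩ : ∃ K', K' = K + B + 2 * ((ab : ℝ) + 1) := ⟨_, rfl⟩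
    have hK'0 : 0 < K' := by rw [hK']; positivity
    obtain ⟨C1, hC1, n1, hpt⟩ := h.conv_pt_pos hvs K' hK'0
    obtain ⟨C2, hC2, n2, hur⟩ := c.unrep h.hV hvs B hB
    refine ⟨C1 + C2 + K + 1, by positivity, max 3 (max n1 n2), ?_⟩
    intro n hn l hl 𝒞 hM ζ hζ
    have hn3 : 3 ≤ n := (le_max_left _ _).trans hn
    have hn1 : n1 ≤ n := ((le_max_left _ _).trans (le_max_right _ _)).trans hn
    have hn2 : n2 ≤ n := ((le_max_right _ _).trans (le_max_right _ _)).trans hn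
    have hn0 : (0 : ℝ) < n := by positivity
    have hL := log_ge_one hn3
    have hs0 : 0 < √(n : ℝ) := Real.sqrt_pos.2 hn0
    have hu := union n hn3 l 𝒞 hM ζ hζ
    have hγ := log_succ_le hn3
    have hγ0 : 0 ≤ log ((n : ℝ) + 1) := Real.log_nonneg (by linarith)
    have hγ1 : (ab + 1) * log ((n : ℝ) + 1) ≤ 2 * (ab + 1) * log n := by
      calc (ab + 1) * log ((n : ℝ) + 1) ≤ (ab + 1) * (2 * log n) := by gcongr
        _ = _ := by ring
    have hsl : √(n : ℝ) ≤ √(n * log n) := Real.sqrt_le_sqrt (by nlinarith)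
    have hll : log n ≤ √(n * log n) := by
      apply Real.le_sqrt_of_sq_le
      have : log n ≤ n := (Real.log_le_sub_one_of_pos hn0).trans (by linarith)
      nlinarith
    have hPn : ∀ y : Fin n → 𝒴, 0 ≤ Phi ((l - c.jn y) / √(n * (c.lam ^ 2 * c.vs))) := fun y => Phi_nonneg _
    have hLs : 0 < log (n : ℝ) / √n := by positivity
    have hmono := ew_mono (c.hp.ch n) (F := fun y => c.g y (ζ y)) (G := fun y =>
      Phi ((l - c.jn y) / √(n * (c.lam ^ 2 * c.vs))) + C1 * (log n / √n) + Bd n y +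
        ind (exp (l + (ab + 1) * log ((n : ℝ) + 1)) * ∏ i, c.p (y i) ≤ Kw y (ζ y)))
      (fun y hy => by
        have g1 := g_le_one (c := c) y (ζ y)
        have p1 := hPn y
        have p2 := hBd0 n y
        have p3 : 0 < C1 * (log n / √n) := by positivity
        have p4 := ind_nonneg (exp (l + (ab + 1) * log ((n : ℝ) + 1)) * ∏ i, c.p (y i) ≤ Kw y (ζ y))
        by_cases hk : exp (l + (ab + 1) * log ((n : ℝ) + 1)) * ∏ i, c.p (y i) ≤ Kw y (ζ y)
        · rw [ind_true hk]; linarith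
        push Not at hk
        rcases hBd2 n y with hb | ⟨hb1, hb2⟩
        · linarith
        have := hpt n hn1 y (ζ y) l _ hy (fun b => (hb1 b).trans (by
            gcongr; rw [hK']; linarith)) (by
            have e : l + (ab + 1) * log ((n : ℝ) + 1) - c.jn y =
              (l - n * c.R) + (ab + 1) * log ((n : ℝ) + 1) - (c.jn y - n * c.R) := by ring
            rw [e]
            have q1 := abs_le.1 hl
            have q2 := abs_le.1 hb2
            have q3 : 0 ≤ (ab + 1) * log ((n : ℝ) + 1) := by positivity
            have q4 : B * √n ≤ B * √(n * log n) := by gcongr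
            have q5 : 2 * (ab + 1) * log n ≤ 2 * ((ab : ℝ) + 1) * √(n * log n) := by gcongr
            have q6 : K' * √(n * log n) = K * √(n * log n) + B * √(n * log n) + 2 * ((ab : ℝ) + 1) * √(n * log n) := by
              rw [hK']; ring
            rw [q6, abs_le]; constructor <;> linarith) (by
            refine hγ1.trans ?_
            gcongr; rw [hK']; linarith) hk
        linarith)
    rw [ew_add, ew_add, ew_add, ew_const (c.hp.ch n)] at hmono
    have hb := (abs_le.1 (hur n hn2 l hl)).2
    have h2 := two_div_le hn3
    have h3 := hBd1 n (by omega)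
    have h4 : K / n ≤ K * (log n / √n) := by
      calc K / n = K * (1 / n) := by ring
        _ ≤ _ := by gcongr
    have : (C1 + C2 + K + 1) * (log n / √n) = C1 * (log n / √n) + C2 * log n / √n + K * (log n / √n) + log n / √n := by ring
    rw [this]
    linarith
end Core
end

open scoped BigOperators
noncomputable section
open Real Set Filter Topology
set_option linter.unusedSectionVars false

/-- window lower bound -/
lemma window {α : Type} [Fintype α] {n : ℕ} {w : Fin n → α → ℝ} (hw : IsChannel w) (f : Fin n → α → ℝ)
    {b : ℝ} (hf : ∀ i a, |f i a| ≤ b) (hb : 0 < b) (hn : 1 ≤ n)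
    (hv : (300 * b) ^ 2 ≤ ∑ i, vr (w i) (f i)) (τ : ℝ) (hm : ∑ i, mn (w i) (f i) = τ - 300 * b) :
    20 / √n ≤ ew w (fun ω => ind (τ - 600 * b ≤ ∑ i, f i (ω i) ∧ ∑ i, f i (ω i) ≤ τ)) := by
  have hn0 : (0 : ℝ) < n := by exact_mod_cast hn
  obtain ⟨V, hV⟩ : ∃ x, x = ∑ i, vr (w i) (f i) := ⟨_, rfl⟩
  rw [← hV] at hv
  have hV0 : 0 < V := lt_of_lt_of_le (by positivity) hv
  obtain ⟨σ, hσ⟩ : ∃ x, x = √V := ⟨_, rfl⟩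
  have hσ0 : 0 < σ := by rw [hσ]; exact Real.sqrt_pos.2 hV0
  have hσ2 : σ ^ 2 = V := by rw [hσ]; exact Real.sq_sqrt hV0.le
  have hσ3 : 300 * b ≤ σ := by
    rw [hσ]; exact Real.le_sqrt_of_sq_le hv
  have hσ4 : σ ≤ b * √n := by
    have : V ≤ b ^ 2 * n := by
      rw [hV]
      calc _ ≤ ∑ i : Fin n, b ^ 2 := by
            apply Finset.sum_le_sum; intro i _
            have h1 := vr_eq (hw i).2 (f i) 0
            have h2 : mn (w i) (fun a => (f i a - 0) ^ 2) ≤ b ^ 2 := by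
              have := mn_mono (hw i).1 (f := fun a => (f i a - 0) ^ 2) (g := fun _ => b ^ 2) (fun a _ => by
                rw [sub_zero]; exact sq_le_sq' (abs_le.1 (hf i a)).1 (abs_le.1 (hf i a)).2)
              rwa [mn_const (hw i).2] at this
            nlinarith [sq_nonneg (mn (w i) (f i) - 0)]
        _ = b ^ 2 * n := by simp [mul_comm]
    rw [hσ]
    calc √V ≤ √(b ^ 2 * n) := Real.sqrt_le_sqrt this
      _ = b * √n := by rw [Real.sqrt_mul (by positivity), Real.sqrt_sq hb.le]
  have b1 := berry hw f hf hb.le hσ0 (by rw [hσ2, hV]) τ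
  have b2 := berry hw f hf hb.le hσ0 (by rw [hσ2, hV]) (τ - 600 * b)
  rw [hm] at b1 b2
  have e1 : (τ - (τ - 300 * b)) / σ = 300 * b / σ := by ring
  have e2 : (τ - 600 * b - (τ - 300 * b)) / σ = -(300 * b / σ) := by ring
  rw [e1] at b1; rw [e2] at b2
  have hw1 := Phi_window (x := 300 * b / σ) (by positivity) ((div_le_one hσ0).2 hσ3)
  have key : ew w (fun ω => ind (∑ i, f i (ω i) ≤ τ)) - ew w (fun ω => ind (∑ i, f i (ω i) ≤ τ - 600 * b))
      ≤ ew w (fun ω => ind (τ - 600 * b ≤ ∑ i, f i (ω i) ∧ ∑ i, f i (ω i) ≤ τ)) := by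
    rw [← ew_sub]
    apply ew_mono hw; intro ω _
    by_cases h1 : ∑ i, f i (ω i) ≤ τ - 600 * b
    · rw [ind_true h1]
      linarith [ind_le_one (∑ i, f i (ω i) ≤ τ), ind_nonneg (τ - 600 * b ≤ ∑ i, f i (ω i) ∧ ∑ i, f i (ω i) ≤ τ)]
    · rw [ind_false h1, sub_zero]
      exact ind_mono fun h => ⟨(not_le.1 h1).le, h⟩
  have h20 : 20 / √n ≤ 20 * b / σ := by
    rw [div_le_div_iff₀ (Real.sqrt_pos.2 hn0) hσ0]; nlinarith
  have e3 : 2 * (300 * b / σ) / 6 = 100 * (b / σ) := by ring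
  have e4 : 40 * b / σ = 40 * (b / σ) := by ring
  have e5 : 20 * b / σ = 20 * (b / σ) := by ring
  rw [e4] at b1 b2; rw [e3] at hw1; rw [e5] at h20
  have := (abs_le.1 b1).1
  have := (abs_le.1 b2).2
  linarith

namespace Core
open Classical
variable {𝒳 𝒴 Xh : Type} [Fintype 𝒳] [Fintype 𝒴] [Fintype Xh] {c : Core 𝒳 𝒴 Xh}

lemma emp (c : Core 𝒳 𝒴 Xh) (f : 𝒴 → ℝ) : ∃ F > 0, ∀ (n : ℕ) (y : Fin n → 𝒴) (E : ℝ),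
    (∀ b, |cy y b - n * c.p b| ≤ E) → |∑ i, f (y i) - n * mn c.p f| ≤ F * E := by
  refine ⟨∑ b, |f b| + 1, by positivity, fun n y E hE => ?_⟩
  have h1 : ∑ i, f (y i) = ∑ b, cy y b * f b := (cc_sum y f).symm
  have h2 : ∑ i, f (y i) - n * mn c.p f = ∑ b, (cy y b - n * c.p b) * f b := by
    rw [h1]; unfold mn; rw [Finset.mul_sum, ← Finset.sum_sub_distrib]
    apply Finset.sum_congr rfl; intros; ring
  have hne : Nonempty 𝒴 := by
    by_contra h
    have h1 := c.hp.2
    have := not_nonempty_iff.1 h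
    simp at h1
  have hE0 : 0 ≤ E := (abs_nonneg _).trans (hE hne.some)
  rw [h2]
  calc _ ≤ ∑ b, |(cy y b - n * c.p b) * f b| := Finset.abs_sum_le_sum_abs _ _
    _ ≤ ∑ b, E * |f b| := by
        apply Finset.sum_le_sum; intro b _
        rw [abs_mul]; exact mul_le_mul_of_nonneg_right (hE b) (abs_nonneg _)
    _ = E * ∑ b, |f b| := by rw [Finset.mul_sum]
    _ ≤ _ := by nlinarith

/-- tilting function -/
def hh (c : Core 𝒳 𝒴 Xh) (y : 𝒴) (z : Xh) : ℝ := 1 / c.ker y z - 1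
/-- perturbed channel -/
def Us (c : Core 𝒳 𝒴 Xh) (s : ℝ) (y : 𝒴) (z : Xh) : ℝ := c.U y z * (1 + s * c.hh y z)

lemma U_hh (c : Core 𝒳 𝒴 Xh) (y z) : c.U y z * c.hh y z = c.Q z - c.U y z := by
  unfold U hh
  have := (c.ker_pos y z).ne'
  field_simp

lemma Us_eq (c : Core 𝒳 𝒴 Xh) (s y z) : c.Us s y z = c.U y z + s * (c.Q z - c.U y z) := by
  rw [← U_hh]; unfold Us; ring

lemma mn_Us (c : Core 𝒳 𝒴 Xh) (s y) (f : Xh → ℝ) :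
    mn (c.Us s y) f = mn (c.U y) f + s * (mn c.Q f - mn (c.U y) f) := by
  unfold mn
  rw [← Finset.sum_sub_distrib, Finset.mul_sum, ← Finset.sum_add_distrib]
  apply Finset.sum_congr rfl; intro z _
  rw [Us_eq]; ring

lemma Us_half {s b : ℝ} (hb : ∀ y z, |c.hh y z| ≤ b) (hs : |s| * b ≤ 1 / 2) (y z) :
    c.U y z * (1 / 2) ≤ c.Us s y z := by
  unfold Us
  apply mul_le_mul_of_nonneg_left _ ((c.hU y).1 z)
  have : |s * c.hh y z| ≤ 1 / 2 := by
    rw [abs_mul]; exact (mul_le_mul_of_nonneg_left (hb y z) (abs_nonneg _)).trans hs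
  linarith [(abs_le.1 this).1]

lemma Us_ch {s b : ℝ} (hb : ∀ y z, |c.hh y z| ≤ b) (hs : |s| * b ≤ 1 / 2) : IsChannel (c.Us s) := by
  intro y
  refine ⟨fun z => le_trans (mul_nonneg ((c.hU y).1 z) (by norm_num)) (Us_half hb hs y z), ?_⟩
  have h := mn_Us c s y (fun _ => 1)
  rw [mn_const (c.hU y).2, mn_const c.hQ.2] at h
  unfold mn at h; simpa using h

lemma Us_vr {s b : ℝ} (hb : ∀ y z, |c.hh y z| ≤ b) (hs : |s| * b ≤ 1 / 2) (y) (f : Xh → ℝ) :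
    1 / 2 * vr (c.U y) f ≤ vr (c.Us s y) f := by
  have h1 := vr_eq (c.hU y).2 f (mn (c.Us s y) f)
  have h2 : 1 / 2 * mn (c.U y) (fun a => (f a - mn (c.Us s y) f) ^ 2) ≤ vr (c.Us s y) f := by
    have e : mn (c.U y) (fun a => (f a - mn (c.Us s y) f) ^ 2) =
      ∑ z, c.U y z * (f z - mn (c.Us s y) f) ^ 2 := rfl
    unfold vr
    rw [e, Finset.mul_sum]
    apply Finset.sum_le_sum; intro z _
    have := mul_le_mul_of_nonneg_right (Us_half hb hs y z) (sq_nonneg (f z - mn (c.Us s y) f))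
    linarith
  nlinarith [sq_nonneg (mn (c.U y) f - mn (c.Us s y) f)]

lemma Opt.kappa (h : c.Opt) : 0 < mn c.p (fun y => vr (c.U y) (c.db y)) := by
  have h0 : 0 ≤ mn c.p (fun y => vr (c.U y) (c.db y)) :=
    Finset.sum_nonneg fun y _ => mul_nonneg (c.hp.1 y) (vr_nonneg (c.hU y).1 _)
  rcases h0.lt_or_eq with h1 | h1
  · exact h1
  exfalso
  have h2 := (Finset.sum_eq_zero_iff_of_nonneg (fun y _ => mul_nonneg (c.hp.1 y) (vr_nonneg (c.hU y).1 _))).1 h1.symm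
  have h3 : mn c.p (fun y => mn c.Q (c.db y)) = mn c.p (fun y => mn (c.U y) (c.db y)) := by
    apply Finset.sum_congr rfl; intro y hy
    rcases mul_eq_zero.1 (h2 y hy) with h4 | h4
    · rw [h4]; simp
    congr 1
    have h5 := (Finset.sum_eq_zero_iff_of_nonneg (fun z _ => mul_nonneg ((c.hU y).1 z) (sq_nonneg _))).1 h4
    have h6 : ∀ z, c.Q z * c.db y z = c.Q z * mn (c.U y) (c.db y) := by
      intro z
      rcases mul_eq_zero.1 (h5 z (Finset.mem_univ _)) with h6 | h6
      · have : c.Q z = 0 := by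
          rcases mul_eq_zero.1 h6 with h7 | h7
          · exact h7
          · exact absurd h7 (c.ker_pos y z).ne'
        rw [this]; simp
      · rw [sub_eq_zero.1 (pow_eq_zero_iff (two_ne_zero)|>.1 h6)]
    conv_lhs => unfold mn
    simp_rw [h6]
    rw [← Finset.sum_mul, c.hQ.2, one_mul]
  have := h.hΔ
  rw [h3, h.hD] at this
  exact lt_irrefl _ this

end Core
end

open scoped BigOperators
noncomputable section
open Real Set Filter Topology
set_option linter.unusedSectionVars false

namespace Core
open Classical
variable {𝒳 𝒴 Xh : Type} [Fintype 𝒳] [Fintype 𝒴] [Fintype Xh] {c : Core 𝒳 𝒴 Xh}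

/-- good codewords for an observation -/
def AA (c : Core 𝒳 𝒴 Xh) (K l : ℝ) {n : ℕ} (y : Fin n → 𝒴) (z : Fin n → Xh) : Prop :=
  (∀ i, c.Q (z i) ≠ 0) ∧ ∑ i, c.db (y i) (z i) ≤ n * c.D + (c.jn y - l) / c.lam ∧
    |∑ i, c.v (y i) (z i) - n * c.vs| ≤ K * √(n * log n)

lemma cover_a {n : ℕ} (y : Fin n → 𝒴) (s : ℝ) {b vb : ℝ} (hb0 : 0 < b) (hb : ∀ y z, |c.hh y z| ≤ b)
    (hs : |s| * b ≤ 1 / 2) (hvb0 : 0 < vb) (hvb : ∀ y z, |c.v y z| ≤ vb) (hn : 3 ≤ n) (τ : ℝ)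
    (hmean : ∑ i, mn (c.Us s (y i)) (c.db (y i)) = τ - 300 * c.dm)
    (hvar : (300 * c.dm) ^ 2 ≤ ∑ i, vr (c.Us s (y i)) (c.db (y i))) :
    1 / (n : ℝ) ≤ ew (fun i => c.Us s (y i)) (fun z => ind ((τ - 600 * c.dm ≤ ∑ i, c.db (y i) (z i) ∧
      ∑ i, c.db (y i) (z i) ≤ τ) ∧ (∀ i, c.Q (z i) ≠ 0) ∧
      |∑ i, c.hh (y i) (z i) - ∑ i, mn (c.Us s (y i)) (c.hh (y i))| ≤ 4 * b * √(n * log n) ∧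
      |∑ i, c.v (y i) (z i) - ∑ i, mn (c.Us s (y i)) (c.v (y i))| ≤ 4 * vb * √(n * log n))) := by
  have hch : IsChannel (fun i => c.Us s (y i)) := fun i => Us_ch hb hs (y i)
  have hn1 : 1 ≤ n := by omega
  have hn0 : (0 : ℝ) < n := by exact_mod_cast hn1
  have h1 := window hch (fun i => c.db (y i)) (fun i z => c.db_le (y i) z) c.dm0 hn1 hvar τ hmean
  have h2 := hoeff2 hch (fun i => c.hh (y i)) hb0 (fun i z => hb (y i) z) hn1
  have h3 := hoeff2 hch (fun i => c.v (y i)) hvb0 (fun i z => hvb (y i) z) hn1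
  have key : ew (fun i => c.Us s (y i)) (fun z => ind (τ - 600 * c.dm ≤ ∑ i, c.db (y i) (z i) ∧
      ∑ i, c.db (y i) (z i) ≤ τ)) ≤ ew (fun i => c.Us s (y i)) (fun z => (ind ((τ - 600 * c.dm ≤ ∑ i, c.db (y i) (z i) ∧
      ∑ i, c.db (y i) (z i) ≤ τ) ∧ (∀ i, c.Q (z i) ≠ 0) ∧
      |∑ i, c.hh (y i) (z i) - ∑ i, mn (c.Us s (y i)) (c.hh (y i))| ≤ 4 * b * √(n * log n) ∧
      |∑ i, c.v (y i) (z i) - ∑ i, mn (c.Us s (y i)) (c.v (y i))| ≤ 4 * vb * √(n * log n)) +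
      ind (4 * b * √(n * log n) < |∑ i, c.hh (y i) (z i) - ∑ i, mn (c.Us s (y i)) (c.hh (y i))|)) +
      ind (4 * vb * √(n * log n) < |∑ i, c.v (y i) (z i) - ∑ i, mn (c.Us s (y i)) (c.v (y i))|)) := by
    apply ew_mono hch; intro z hz
    have hQ : ∀ i, c.Q (z i) ≠ 0 := by
      intro i h0
      apply hz i
      unfold Us U; rw [h0]; ring
    by_cases ha : 4 * b * √(n * log n) < |∑ i, c.hh (y i) (z i) - ∑ i, mn (c.Us s (y i)) (c.hh (y i))|
    · rw [ind_true ha]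
      refine le_trans (ind_le_one _) ?_
      linarith [ind_nonneg ((τ - 600 * c.dm ≤ ∑ i, c.db (y i) (z i) ∧
      ∑ i, c.db (y i) (z i) ≤ τ) ∧ (∀ i, c.Q (z i) ≠ 0) ∧
      |∑ i, c.hh (y i) (z i) - ∑ i, mn (c.Us s (y i)) (c.hh (y i))| ≤ 4 * b * √(n * log n) ∧
      |∑ i, c.v (y i) (z i) - ∑ i, mn (c.Us s (y i)) (c.v (y i))| ≤ 4 * vb * √(n * log n)), ind_nonneg (4 * vb * √(n * log n) < |∑ i, c.v (y i) (z i) - ∑ i, mn (c.Us s (y i)) (c.v (y i))|)]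
    by_cases hbb : 4 * vb * √(n * log n) < |∑ i, c.v (y i) (z i) - ∑ i, mn (c.Us s (y i)) (c.v (y i))|
    · rw [ind_true hbb, ind_false ha]
      refine le_trans (ind_le_one _) ?_
      linarith [ind_nonneg ((τ - 600 * c.dm ≤ ∑ i, c.db (y i) (z i) ∧
      ∑ i, c.db (y i) (z i) ≤ τ) ∧ (∀ i, c.Q (z i) ≠ 0) ∧
      |∑ i, c.hh (y i) (z i) - ∑ i, mn (c.Us s (y i)) (c.hh (y i))| ≤ 4 * b * √(n * log n) ∧
      |∑ i, c.v (y i) (z i) - ∑ i, mn (c.Us s (y i)) (c.v (y i))| ≤ 4 * vb * √(n * log n))]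
    rw [ind_false ha, ind_false hbb, add_zero, add_zero]
    exact ind_mono fun hw => ⟨hw, hQ, not_lt.1 ha, not_lt.1 hbb⟩
  rw [ew_add, ew_add] at key
  have h5 : 5 / (n : ℝ) ≤ 20 / √n := by
    have hs1 : 1 ≤ √(n : ℝ) := Real.one_le_sqrt.2 (by exact_mod_cast hn1)
    have hsq : √(n : ℝ) ^ 2 = n := Real.sq_sqrt hn0.le
    rw [div_le_div_iff₀ hn0 (by positivity)]
    nlinarith
  have e5 : 5 / (n : ℝ) = 1 / n + 2 / n + 2 / n := by ring
  rw [e5] at h5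
  linarith

lemma cover_b {n : ℕ} (y : Fin n → 𝒴) (s : ℝ) {b vb : ℝ} (hb0 : 0 < b) (hb : ∀ y z, |c.hh y z| ≤ b)
    (hs : |s| * b ≤ 1 / 2) (hvb0 : 0 < vb) (hvb : ∀ y z, |c.v y z| ≤ vb) (hn : 3 ≤ n) (l : ℝ)
    (hmean : ∑ i, mn (c.Us s (y i)) (c.db (y i)) = n * c.D + (c.jn y - l) / c.lam - 300 * c.dm)
    (hvar : (300 * c.dm) ^ 2 ≤ ∑ i, vr (c.Us s (y i)) (c.db (y i))) {K2 K3 : ℝ} (hK2 : 0 < K2)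
    (hs2 : |s| * n ≤ K2 * √(n * log n))
    (hv3 : |∑ i, mn (c.Us s (y i)) (c.v (y i)) - n * c.vs| ≤ K3 * √(n * log n)) :
    exp (-(l + (600 * c.dm * c.lam + K2 * (4 + K2) * b + 1) * log n)) ≤
      ew (fun _ : Fin n => c.Q) (fun z => ind (c.AA (4 * vb + K3) l y z)) := by
  have h1 := cover_a y s hb0 hb hs hvb0 hvb hn _ hmean hvar
  have hn1 : 1 ≤ n := by omega
  have hn0 : (0 : ℝ) < n := by exact_mod_cast hn1
  have hL := log_ge_one hn
  have lam0 := c.lam0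
  have dm0 := c.dm0
  have hr2 : √(n * log n) * √(n * log n) = n * log n := Real.mul_self_sqrt (by positivity)
  have hr0 : 0 ≤ √(n * log n) := Real.sqrt_nonneg _
  have hmh : |∑ i, mn (c.Us s (y i)) (c.hh (y i))| ≤ n * (|s| * b) := by
    calc _ ≤ ∑ i, |mn (c.Us s (y i)) (c.hh (y i))| := Finset.abs_sum_le_sum_abs _ _
      _ ≤ ∑ i : Fin n, |s| * b := by
          apply Finset.sum_le_sum; intro i _
          rw [mn_Us]
          have : mn (c.U (y i)) (c.hh (y i)) = 0 := by
            unfold mn; simp_rw [U_hh]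
            rw [Finset.sum_sub_distrib, c.hQ.2, (c.hU (y i)).2, sub_self]
          rw [this, zero_add, sub_zero, abs_mul]
          exact mul_le_mul_of_nonneg_left (abs_mn_le c.hQ.1 c.hQ.2 (hb (y i))) (abs_nonneg _)
      _ = _ := by simp
  have h2 : ew (fun i => c.Us s (y i)) (fun z => ind ((n * c.D + (c.jn y - l) / c.lam - 600 * c.dm ≤ ∑ i, c.db (y i) (z i) ∧
      ∑ i, c.db (y i) (z i) ≤ n * c.D + (c.jn y - l) / c.lam) ∧ (∀ i, c.Q (z i) ≠ 0) ∧
      |∑ i, c.hh (y i) (z i) - ∑ i, mn (c.Us s (y i)) (c.hh (y i))| ≤ 4 * b * √(n * log n) ∧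
      |∑ i, c.v (y i) (z i) - ∑ i, mn (c.Us s (y i)) (c.v (y i))| ≤ 4 * vb * √(n * log n))) ≤
      exp (l + (600 * c.dm * c.lam + K2 * (4 + K2) * b) * log n) *
      ew (fun _ : Fin n => c.Q) (fun z => ind (c.AA (4 * vb + K3) l y z)) := by
    rw [← ew_mul]
    unfold ew
    apply Finset.sum_le_sum; intro z _
    beta_reduce
    by_cases hA : ((n * c.D + (c.jn y - l) / c.lam - 600 * c.dm ≤ ∑ i, c.db (y i) (z i) ∧
      ∑ i, c.db (y i) (z i) ≤ n * c.D + (c.jn y - l) / c.lam) ∧ (∀ i, c.Q (z i) ≠ 0) ∧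
      |∑ i, c.hh (y i) (z i) - ∑ i, mn (c.Us s (y i)) (c.hh (y i))| ≤ 4 * b * √(n * log n) ∧
      |∑ i, c.v (y i) (z i) - ∑ i, mn (c.Us s (y i)) (c.v (y i))| ≤ 4 * vb * √(n * log n))
    swap
    · rw [ind_false hA, mul_zero]
      exact mul_nonneg (Finset.prod_nonneg fun i _ => c.hQ.1 _) (mul_nonneg (exp_pos _).le (ind_nonneg _))
    have hAA : c.AA (4 * vb + K3) l y z := by
      obtain ⟨⟨a1, a2⟩, a3, a4, a5⟩ := hA
      refine ⟨a3, a2, ?_⟩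
      have := abs_add_le (∑ i, c.v (y i) (z i) - ∑ i, mn (c.Us s (y i)) (c.v (y i))) (∑ i, mn (c.Us s (y i)) (c.v (y i)) - n * c.vs)
      rw [sub_add_sub_cancel] at this
      linarith
    rw [ind_true hA, ind_true hAA, mul_one, mul_one]
    obtain ⟨⟨a1, a2⟩, a3, a4, a5⟩ := hA
    have hp1 : ∏ i, c.Us s (y i) (z i) ≤ ∏ i, (c.Q (z i) * exp (c.be (y i) - c.lam * c.db (y i) (z i) + s * c.hh (y i) (z i))) := by
      apply Finset.prod_le_prod
      · intro i _; exact (Us_ch hb hs (y i)).1 _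
      · intro i _
        have e : c.Us s (y i) (z i) = c.Q (z i) * (exp (c.be (y i) - c.lam * c.db (y i) (z i)) * (1 + s * c.hh (y i) (z i))) := by
          unfold Us U ker; ring
        rw [e, exp_add]
        apply mul_le_mul_of_nonneg_left _ (c.hQ.1 _)
        apply mul_le_mul_of_nonneg_left _ (exp_pos _).le
        linarith [Real.add_one_le_exp (s * c.hh (y i) (z i))]
    refine hp1.trans ?_
    rw [Finset.prod_mul_distrib, ← exp_sum]
    apply mul_le_mul_of_nonneg_left _ (Finset.prod_nonneg fun i _ => c.hQ.1 _)
    apply Real.exp_le_exp.2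
    rw [Finset.sum_add_distrib, Finset.sum_sub_distrib, ← Finset.mul_sum, ← Finset.mul_sum]
    have hj := c.jn_eq y
    have hd1 : ∑ i, c.be (y i) - c.lam * ∑ i, c.db (y i) (z i) ≤ l + 600 * c.dm * c.lam := by
      have := mul_le_mul_of_nonneg_left a1 lam0.le
      have e : c.lam * (n * c.D + (c.jn y - l) / c.lam - 600 * c.dm) = c.lam * (n * c.D) + (c.jn y - l) - 600 * c.dm * c.lam := by
        field_simp
      rw [e] at this
      linarith
    have hh1 : |∑ i, c.hh (y i) (z i)| ≤ (4 + K2) * b * √(n * log n) := by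
      have t := abs_sub_abs_le_abs_sub (∑ i, c.hh (y i) (z i)) (∑ i, mn (c.Us s (y i)) (c.hh (y i)))
      have t2 := mul_le_mul_of_nonneg_left hs2 hb0.le
      linarith
    have hh2 : s * ∑ i, c.hh (y i) (z i) ≤ K2 * (4 + K2) * b * log n := by
      have t1 : s * ∑ i, c.hh (y i) (z i) ≤ |s| * ((4 + K2) * b * √(n * log n)) := by
        refine (le_abs_self _).trans ?_
        rw [abs_mul]; exact mul_le_mul_of_nonneg_left hh1 (abs_nonneg _)
      have t2 : (|s| * n) * ((4 + K2) * b * √(n * log n)) ≤ (K2 * √(n * log n)) * ((4 + K2) * b * √(n * log n)) :=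
        mul_le_mul_of_nonneg_right hs2 (by positivity)
      have t3 : (K2 * √(n * log n)) * ((4 + K2) * b * √(n * log n)) = n * (K2 * (4 + K2) * b * log n) := by
        linear_combination K2 * (4 + K2) * b * hr2
      have t4 : n * (|s| * ((4 + K2) * b * √(n * log n))) ≤ n * (K2 * (4 + K2) * b * log n) := by
        rw [← t3]; linarith
      exact t1.trans (le_of_mul_le_mul_left t4 hn0)
    have : 600 * c.dm * c.lam ≤ 600 * c.dm * c.lam * log n := le_mul_of_one_le_right (by positivity) hL
    linarith
  have h3 := h1.trans h2
  have e1 : exp (-(l + (600 * c.dm * c.lam + K2 * (4 + K2) * b + 1) * log n)) =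
      exp (-(l + (600 * c.dm * c.lam + K2 * (4 + K2) * b) * log n)) * (1 / n) := by
    have : (1 : ℝ) / n = exp (- log n) := by rw [exp_neg, exp_log hn0, one_div]
    rw [this, ← exp_add]; congr 1; ring
  rw [e1]
  calc _ ≤ exp (-(l + (600 * c.dm * c.lam + K2 * (4 + K2) * b) * log n)) * (exp (l + (600 * c.dm * c.lam + K2 * (4 + K2) * b) * log n) *
      ew (fun _ : Fin n => c.Q) (fun z => ind (c.AA (4 * vb + K3) l y z))) :=
        mul_le_mul_of_nonneg_left h3 (exp_pos _).le
    _ = _ := by rw [← mul_assoc, ← exp_add, neg_add_cancel, exp_zero, one_mul]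

end Core
end

open scoped BigOperators
noncomputable section
open Real Set Filter Topology
set_option linter.unusedSectionVars false

lemma ev_r {η : ℝ} (hη : 0 < η) : ∃ n0 : ℕ, ∀ n ≥ n0, √((n : ℝ) * log n) ≤ η * n := by
  obtain ⟨n0, h⟩ := ev_q hη
  refine ⟨n0, fun n hn => ?_⟩
  have h1 := h n hn
  have h2 := Real.mul_self_sqrt (Nat.cast_nonneg (α := ℝ) n)
  rw [Real.sqrt_mul (Nat.cast_nonneg n)]
  have := mul_le_mul_of_nonneg_left h1 (Real.sqrt_nonneg (n : ℝ))
  calc _ ≤ _ := this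
    _ = η * (√(n : ℝ) * √n) := by ring
    _ = _ := by rw [h2]

namespace Core
open Classical
variable {𝒳 𝒴 Xh : Type} [Fintype 𝒳] [Fintype 𝒴] [Fintype Xh] {c : Core 𝒳 𝒴 Xh}

lemma Opt.cover (h : c.Opt) (K0 : ℝ) (hK0 : 0 < K0) : ∃ K > 0, ∃ n0 : ℕ, ∀ n ≥ n0, ∀ (y : Fin n → 𝒴) (l : ℝ),
    (∀ b, |cy y b - n * c.p b| ≤ K0 * √(n * log n)) → |c.jn y - l| ≤ K0 * √(n * log n) →
    exp (-(l + K * log n)) ≤ ew (fun _ : Fin n => c.Q) (fun z => ind (c.AA K l y z)) := by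
  obtain ⟨b, hb0, hb'⟩ := exb (fun yz : 𝒴 × Xh => c.hh yz.1 yz.2)
  obtain ⟨vb, hvb0, hvb'⟩ := exb (fun yz : 𝒴 × Xh => c.v yz.1 yz.2)
  have hb : ∀ y z, |c.hh y z| ≤ b := fun y z => hb' (y, z)
  have hvb : ∀ y z, |c.v y z| ≤ vb := fun y z => hvb' (y, z)
  obtain ⟨F1, hF1, e1⟩ := c.emp (fun y => mn (c.U y) (c.db y))
  obtain ⟨F2, hF2, e2⟩ := c.emp (fun y => mn c.Q (c.db y))
  obtain ⟨F3, hF3, e3⟩ := c.emp (fun y => vr (c.U y) (c.db y))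
  obtain ⟨F4, hF4, e4⟩ := c.emp (fun y => mn (c.U y) (c.v y))
  have hκ := h.kappa
  obtain ⟨κ, hκe⟩ : ∃ x, x = mn c.p (fun y => vr (c.U y) (c.db y)) := ⟨_, rfl⟩
  have hΔ := h.hΔ
  obtain ⟨Δ, hΔe⟩ : ∃ x, x = mn c.p (fun y => mn c.Q (c.db y)) - c.D := ⟨_, rfl⟩
  have hΔ0 : 0 < Δ := by rw [hΔe]; linarith
  have hQD : mn c.p (fun y => mn c.Q (c.db y)) = c.D + Δ := by rw [hΔe]; ring
  rw [h.hD] at e1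
  rw [hQD] at e2
  rw [← hκe] at e3 hκ
  have e4' : mn c.p (fun y => mn (c.U y) (c.v y)) = c.vs := rfl
  rw [e4'] at e4
  have lam0 := c.lam0
  have dm0 := c.dm0
  obtain ⟨K1, hK1⟩ : ∃ x, x = K0 / c.lam + 300 * c.dm + F1 * K0 := ⟨_, rfl⟩
  have hK1p : 0 < K1 := by rw [hK1]; positivity
  obtain ⟨K2, hK2⟩ : ∃ x, x = 2 * K1 / Δ := ⟨_, rfl⟩
  have hK2p : 0 < K2 := by rw [hK2]; positivity
  obtain ⟨n1, hn1⟩ := ev_r (η := Δ / (2 * (F1 + F2) * K0)) (by positivity)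
  obtain ⟨n2, hn2⟩ := ev_r (η := 1 / (2 * b * K2)) (by positivity)
  obtain ⟨n3, hn3⟩ := ev_r (η := κ / (2 * F3 * K0)) (by positivity)
  obtain ⟨n4, hn4⟩ := exists_nat_ge (4 * (300 * c.dm) ^ 2 / κ)
  obtain ⟨K3, hK3⟩ : ∃ x, x = F4 * K0 + K2 * (2 * vb) := ⟨_, rfl⟩
  have hK3p : 0 < K3 := by rw [hK3]; positivity
  obtain ⟨KA, hKA⟩ : ∃ x, x = 600 * c.dm * c.lam + K2 * (4 + K2) * b + 1 := ⟨_, rfl⟩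
  have hKAp : 0 < KA := by rw [hKA]; positivity
  refine ⟨KA + (4 * vb + K3), by positivity, 3 + n1 + n2 + n3 + n4, ?_⟩
  intro n hn y l hy hl
  have h3n : 3 ≤ n := by omega
  have g1 := hn1 n (by omega)
  have g2 := hn2 n (by omega)
  have g3 := hn3 n (by omega)
  have g4 : 4 * (300 * c.dm) ^ 2 / κ ≤ n := hn4.trans (by exact_mod_cast (by omega : n4 ≤ n))
  have hnR : (3 : ℝ) ≤ n := by exact_mod_cast h3n
  have hn0 : (0 : ℝ) < n := by linarith
  have hL := log_ge_one h3n
  have e1 := e1 n y _ hy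
  have e2 := e2 n y _ hy
  have e3 := e3 n y _ hy
  have e4 := e4 n y _ hy
  obtain ⟨r, hr⟩ : ∃ x, x = √((n : ℝ) * log n) := ⟨_, rfl⟩
  have hr1 : 1 ≤ r := by rw [hr]; exact Real.one_le_sqrt.2 (by nlinarith)
  rw [← hr] at e1 e2 e3 e4 g1 g2 g3 hl
  obtain ⟨μ0, hμ0⟩ : ∃ x, x = ∑ i, mn (c.U (y i)) (c.db (y i)) := ⟨_, rfl⟩
  obtain ⟨μQ, hμQ⟩ : ∃ x, x = ∑ i, mn c.Q (c.db (y i)) := ⟨_, rfl⟩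
  rw [← hμ0] at e1
  rw [← hμQ] at e2
  have g1' : (F1 + F2) * K0 * r ≤ n * Δ / 2 := by
    have := mul_le_mul_of_nonneg_left g1 (by positivity : 0 ≤ (F1 + F2) * K0)
    calc _ ≤ _ := this
      _ = _ := by field_simp
  have hden : n * Δ / 2 ≤ μQ - μ0 := by
    have a := (abs_le.1 e1).2
    have b := (abs_le.1 e2).1
    linarith
  have hden0 : 0 < μQ - μ0 := lt_of_lt_of_le (by positivity) hden
  obtain ⟨t, ht⟩ : ∃ x, x = n * c.D + (c.jn y - l) / c.lam - 300 * c.dm - μ0 := ⟨_, rfl⟩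
  have htb : |t| ≤ K1 * r := by
    have a1 : |(c.jn y - l) / c.lam| ≤ K0 / c.lam * r := by
      rw [abs_div, abs_of_pos lam0, div_mul_eq_mul_div]
      exact div_le_div_of_nonneg_right hl lam0.le
    have a2 := abs_le.1 e1
    have a3 := abs_le.1 a1
    have a4 : 300 * c.dm ≤ 300 * c.dm * r := le_mul_of_one_le_right (by positivity) hr1
    rw [ht, hK1, abs_le]
    constructor <;> linarith
  obtain ⟨s, hs⟩ : ∃ x, x = t / (μQ - μ0) := ⟨_, rfl⟩
  have hst : s * (μQ - μ0) = t := by rw [hs]; field_simp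
  have hsn : |s| * n ≤ K2 * r := by
    have a1 : |s| * (n * Δ / 2) ≤ K1 * r := by
      refine le_trans (mul_le_mul_of_nonneg_left hden (abs_nonneg _)) ?_
      rw [← abs_of_pos hden0, ← abs_mul, hst]; exact htb
    rw [hK2]
    calc |s| * n = |s| * (n * Δ / 2) * (2 / Δ) := by field_simp
      _ ≤ K1 * r * (2 / Δ) := mul_le_mul_of_nonneg_right a1 (by positivity)
      _ = _ := by ring
  have hsb : |s| * b ≤ 1 / 2 := by
    have a1 := mul_le_mul_of_nonneg_left g2 (by positivity : 0 ≤ K2)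
    have a2 : |s| * n ≤ (1 / (2 * b)) * n := by
      refine hsn.trans (a1.trans (le_of_eq ?_)); field_simp
    have a3 := le_of_mul_le_mul_right a2 hn0
    have a4 := mul_le_mul_of_nonneg_right a3 hb0.le
    refine a4.trans (le_of_eq ?_); field_simp
  have hmean : ∑ i, mn (c.Us s (y i)) (c.db (y i)) = n * c.D + (c.jn y - l) / c.lam - 300 * c.dm := by
    simp_rw [mn_Us]
    rw [Finset.sum_add_distrib, ← Finset.mul_sum, Finset.sum_sub_distrib, ← hμ0, ← hμQ, hst, ht]; ring
  have hvar : (300 * c.dm) ^ 2 ≤ ∑ i, vr (c.Us s (y i)) (c.db (y i)) := by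
    have a1 : 1 / 2 * ∑ i, vr (c.U (y i)) (c.db (y i)) ≤ ∑ i, vr (c.Us s (y i)) (c.db (y i)) := by
      rw [Finset.mul_sum]
      exact Finset.sum_le_sum fun i _ => Us_vr hb hsb (y i) _
    have a2 := (abs_le.1 e3).1
    have a3 : F3 * (K0 * r) ≤ n * κ / 2 := by
      have := mul_le_mul_of_nonneg_left g3 (by positivity : 0 ≤ F3 * K0)
      calc _ = F3 * K0 * r := by ring
        _ ≤ _ := this
        _ = _ := by field_simp
    have a4 : (300 * c.dm) ^ 2 ≤ n * κ / 4 := by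
      rw [div_le_iff₀ hκ] at g4; linarith
    linarith
  have hv3 : |∑ i, mn (c.Us s (y i)) (c.v (y i)) - n * c.vs| ≤ K3 * √(n * log n) := by
    rw [← hr]
    simp_rw [mn_Us]
    rw [Finset.sum_add_distrib, ← Finset.mul_sum]
    have a1 : |∑ i, (mn c.Q (c.v (y i)) - mn (c.U (y i)) (c.v (y i)))| ≤ n * (2 * vb) := by
      calc _ ≤ ∑ i, |mn c.Q (c.v (y i)) - mn (c.U (y i)) (c.v (y i))| := Finset.abs_sum_le_sum_abs _ _
        _ ≤ ∑ i : Fin n, 2 * vb := by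
          apply Finset.sum_le_sum; intro i _
          have b1 := abs_le.1 (abs_mn_le c.hQ.1 c.hQ.2 (hvb (y i)))
          have b2 := abs_le.1 (abs_mn_le (c.hU (y i)).1 (c.hU (y i)).2 (hvb (y i)))
          rw [abs_le]; constructor <;> linarith
        _ = _ := by simp
    have a2 : |s * ∑ i, (mn c.Q (c.v (y i)) - mn (c.U (y i)) (c.v (y i)))| ≤ K2 * (2 * vb) * r := by
      rw [abs_mul]
      calc _ ≤ |s| * (n * (2 * vb)) := mul_le_mul_of_nonneg_left a1 (abs_nonneg _)
        _ = (|s| * n) * (2 * vb) := by ring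
        _ ≤ (K2 * r) * (2 * vb) := mul_le_mul_of_nonneg_right hsn (by positivity)
        _ = _ := by ring
    have a3 := abs_le.1 a2
    have a4 := abs_le.1 e4
    rw [hK3, abs_le]
    constructor <;> linarith
  have fin := cover_b y s hb0 hb hsb hvb0 hvb h3n l hmean hvar hK2p (by rw [← hr]; exact hsn) hv3
  rw [← hKA] at fin
  refine le_trans (Real.exp_le_exp.2 ?_) (fin.trans ?_)
  · have : 0 ≤ (4 * vb + K3) * log n := by positivity
    linarith
  · apply ew_mono (c.hQ.ch n); intro z _
    apply ind_mono
    rintro ⟨q1, q2, q3⟩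
    refine ⟨q1, q2, q3.trans ?_⟩
    apply mul_le_mul_of_nonneg_right _ (Real.sqrt_nonneg _)
    linarith

end Core
end

open scoped BigOperators
noncomputable section
open Real Set Filter Topology
set_option linter.unusedSectionVars false

lemma ew_exists_le {α : Type} [Fintype α] {n : ℕ} {w : Fin n → α → ℝ} (hw : IsChannel w) (F : (Fin n → α) → ℝ) :
    ∃ ω, F ω ≤ ew w F := by
  by_contra hcon
  push Not at hcon
  have hne : Nonempty (Fin n → α) := by
    by_contra h
    have h1 := ew_const hw 1
    have := not_nonempty_iff.1 h
    unfold ew at h1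
    simp at h1
  obtain ⟨ω0, h0⟩ := Finite.exists_min F
  have h1 := ew_mono hw (F := fun _ => F ω0) (G := F) (fun ω _ => h0 ω)
  rw [ew_const hw] at h1
  exact absurd h1 (not_le.2 (hcon ω0))

lemma random_cov {Y Z : Type} [Fintype Y] [Fintype Z] {q : Z → ℝ} (hq : IsPmf q) {wt : Y → ℝ} (hwt : IsPmf wt)
    (A : Y → Z → Prop) (good : Y → Prop) {pz : ℝ}
    (h : ∀ y, good y → pz ≤ mn q (fun z => ind (A y z))) (M : ℕ) :
    ∃ cb : Fin M → Z, ∑ y, wt y * ind (good y ∧ ∀ m, ¬ A y (cb m)) ≤ exp (-(pz * M)) := by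
  obtain ⟨cb, hcb⟩ := ew_exists_le (hq.ch M) (fun cb => ∑ y, wt y * ind (good y ∧ ∀ m, ¬ A y (cb m)))
  refine ⟨cb, hcb.trans ?_⟩
  have e := ew_sum Finset.univ (fun _ : Fin M => q) (fun y cb => wt y * ind (good y ∧ ∀ m, ¬ A y (cb m)))
  rw [e]
  calc _ ≤ ∑ y, wt y * exp (-(pz * M)) := by
        apply Finset.sum_le_sum; intro y _
        rw [ew_mul]
        apply mul_le_mul_of_nonneg_left _ (hwt.1 y)
        by_cases hg : good y
        · have h1 : ew (fun _ : Fin M => q) (fun cb => ind (good y ∧ ∀ m, ¬ A y (cb m))) ≤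
              ew (fun _ : Fin M => q) (fun cb => ∏ m, (1 - ind (A y (cb m)))) := by
            apply ew_mono (hq.ch M); intro cb _
            by_cases hh : good y ∧ ∀ m, ¬ A y (cb m)
            · rw [ind_true hh, Finset.prod_congr rfl (fun m _ => by rw [ind_false (hh.2 m), sub_zero])]
              simp
            · rw [ind_false hh]
              exact Finset.prod_nonneg fun m _ => by linarith [ind_le_one (A y (cb m))]
          refine h1.trans ?_
          have h2 := ew_prod (fun _ : Fin M => q) (fun _ z => 1 - ind (A y z))
          rw [h2, Finset.prod_const, Finset.card_univ, Fintype.card_fin, mn_sub, mn_const hq.2]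
          have h3 : 1 - mn q (fun z => ind (A y z)) ≤ exp (-pz) := by
            have := Real.add_one_le_exp (-pz)
            linarith [h y hg]
          have h4 : 0 ≤ 1 - mn q (fun z => ind (A y z)) := by
            have := mn_mono hq.1 (f := fun z => ind (A y z)) (g := fun _ => 1) (fun z _ => ind_le_one _)
            rw [mn_const hq.2] at this; linarith
          calc _ ≤ exp (-pz) ^ M := pow_le_pow_left₀ h4 h3 M
            _ = _ := by rw [← Real.exp_nat_mul]; congr 1; ring
        · have : (fun cb : Fin M → Z => ind (good y ∧ ∀ m, ¬ A y (cb m))) = fun _ => 0 := by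
            funext cb; exact ind_false (fun h => hg h.1)
          rw [this, ew_const (hq.ch M)]; positivity
    _ = _ := by rw [← Finset.sum_mul, hwt.2, one_mul]

lemma pmf_prod {α : Type} [Fintype α] {p : α → ℝ} (hp : IsPmf p) (n : ℕ) :
    IsPmf (fun ω : Fin n → α => ∏ i, p (ω i)) := by
  refine ⟨fun ω => Finset.prod_nonneg fun i _ => hp.1 _, ?_⟩
  have := ew_const (hp.ch n) 1
  unfold ew at this; simpa using this

namespace Core
open Classical
variable {𝒳 𝒴 Xh : Type} [Fintype 𝒳] [Fintype 𝒴] [Fintype Xh] {c : Core 𝒳 𝒴 Xh}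

lemma ach_pt_zero (hvs : c.vs = 0) {n : ℕ} {y : Fin n → 𝒴} {z : Fin n → Xh} {K l : ℝ}
    (hy : ∀ i, c.p (y i) ≠ 0) (hA : c.AA K l y z) : ind (c.jn y ≤ l) ≤ c.g y z := by
  by_cases hj : c.jn y ≤ l
  swap
  · rw [ind_false hj]; exact ew_nonneg (fun i => c.hW (y i)) (fun _ => ind_nonneg _)
  rw [ind_true hj]
  have h1 := ew_const (fun i => c.hW (y i)) (1 : ℝ)
  rw [← h1]
  apply ew_mono (fun i => c.hW (y i)); intro x hx
  have : ∑ i, c.d (x i) (z i) ≤ n * c.D := by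
    rw [Finset.sum_congr rfl (fun i _ => c.vs_zero hvs (hy i) (hA.1 i) (hx i))]
    refine hA.2.1.trans ?_
    have : (c.jn y - l) / c.lam ≤ 0 := div_nonpos_of_nonpos_of_nonneg (by linarith) c.lam0.le
    linarith
  rw [ind_true this]

lemma ach_pt_pos (hvs : 0 < c.vs) (K0 K : ℝ) (hK0 : 0 < K0) (hK : 0 < K) : ∃ C > 0, ∃ n0 : ℕ, ∀ n ≥ n0,
    ∀ (y : Fin n → 𝒴) (z : Fin n → Xh) (l : ℝ), |c.jn y - l| ≤ K0 * √(n * log n) → c.AA K l y z →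
    Phi ((l - c.jn y) / √(n * (c.lam ^ 2 * c.vs))) - C * (log n / √n) ≤ c.g y z := by
  obtain ⟨n1, hn1⟩ := ev_r (η := c.vs / (2 * K)) (by positivity)
  have lam0 := c.lam0
  have dm0 := c.dm0
  have sv := Real.sqrt_pos.2 hvs
  refine ⟨2 * (K0 / c.lam) * K / (c.vs * √c.vs) + 80 * c.dm / √c.vs, by positivity, 3 + n1, ?_⟩
  intro n hn y z l hl hA
  have h3n : 3 ≤ n := by omega
  have g1 := hn1 n (by omega)
  have hL := log_ge_one h3n
  have hnR : (3 : ℝ) ≤ n := by exact_mod_cast h3n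
  have hn0 : (0 : ℝ) < n := by linarith
  have hs0 := Real.sqrt_pos.2 hn0
  have hv := hA.2.2
  obtain ⟨r, hr⟩ : ∃ x, x = √((n : ℝ) * log n) := ⟨_, rfl⟩
  have hr2 : r * r = n * log n := by rw [hr]; exact Real.mul_self_sqrt (by positivity)
  have hr0 : 0 ≤ r := by rw [hr]; positivity
  rw [← hr] at hl g1 hv
  have hV0 : 0 < n * c.vs := by positivity
  obtain ⟨vn, hvn⟩ : ∃ x, x = ∑ i, c.v (y i) (z i) := ⟨_, rfl⟩
  have hgb := c.g_berry y z
  rw [← hvn] at hv hgb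
  have hhalf : |vn - n * c.vs| ≤ n * c.vs / 2 := by
    refine hv.trans ?_
    have := mul_le_mul_of_nonneg_left g1 hK.le
    refine this.trans (le_of_eq ?_); field_simp
  have hvn0 : n * c.vs / 2 ≤ vn := by linarith [(abs_le.1 hhalf).1]
  have hvnp : 0 < vn := lt_of_lt_of_le (by positivity) hvn0
  have h1 := (abs_le.1 (hgb hvnp)).1
  have hcmp := cmp_sqrt hV0 hhalf ((l - c.jn y) / c.lam)
  have hA0 : |(l - c.jn y) / c.lam| ≤ K0 / c.lam * r := by
    rw [abs_div, abs_of_pos lam0, div_mul_eq_mul_div, abs_sub_comm]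
    exact div_le_div_of_nonneg_right hl lam0.le
  have hcmp2 : |(l - c.jn y) / c.lam / √vn - (l - c.jn y) / c.lam / √(n * c.vs)| ≤
      2 * (K0 / c.lam) * K / (c.vs * √c.vs) * (log n / √n) := by
    refine hcmp.trans ?_
    calc _ ≤ 2 * (K0 / c.lam * r) * (K * r) / (n * c.vs * √(n * c.vs)) := by gcongr
      _ = 2 * (K0 / c.lam) * K * (r * r) / (n * c.vs * √(n * c.vs)) := by ring
      _ = _ := by
        rw [hr2, Real.sqrt_mul hn0.le]; field_simp
  have e : (l - c.jn y) / c.lam / √(n * c.vs) = (l - c.jn y) / √(n * (c.lam ^ 2 * c.vs)) := by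
    have : (n : ℝ) * (c.lam ^ 2 * c.vs) = c.lam ^ 2 * (n * c.vs) := by ring
    rw [this, Real.sqrt_mul (by positivity : 0 ≤ c.lam ^ 2), Real.sqrt_sq lam0.le, div_div]
  rw [e] at hcmp2
  have h2 : Phi ((l - c.jn y) / c.lam / √vn) ≤ Phi ((n * c.D - ∑ i, c.db (y i) (z i)) / √vn) := by
    apply Phi_mono
    apply div_le_div_of_nonneg_right _ (Real.sqrt_nonneg _)
    have := hA.2.1
    have e2 : (c.jn y - l) / c.lam = - ((l - c.jn y) / c.lam) := by ring
    rw [e2] at this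
    linarith
  have h3 := Phi_lip' ((l - c.jn y) / c.lam / √vn) ((l - c.jn y) / √(n * (c.lam ^ 2 * c.vs)))
  rw [abs_sub_comm] at h3
  have h4 : 40 * c.dm / √vn ≤ 80 * c.dm / √c.vs * (log n / √n) := by
    have a1 : √n * √c.vs / 2 ≤ √vn := by
      rw [← Real.sqrt_mul hn0.le]
      apply Real.le_sqrt_of_sq_le
      rw [div_pow, Real.sq_sqrt hV0.le]; linarith
    have a2 : 0 < √n * √c.vs / 2 := by positivity
    calc _ ≤ 40 * c.dm / (√n * √c.vs / 2) := by gcongr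
      _ = 80 * c.dm / √c.vs * (1 / √n) := by field_simp; norm_num
      _ ≤ _ := by gcongr
  rw [add_mul]
  linarith

end Core
end

open scoped BigOperators
noncomputable section
open Real Set Filter Topology
set_option linter.unusedSectionVars false

namespace Core
open Classical
variable {𝒳 𝒴 Xh : Type} [Fintype 𝒳] [Fintype 𝒴] [Fintype Xh] {c : Core 𝒳 𝒴 Xh}

lemma Opt.ach_aux (h : c.Opt) (B : ℝ) (hB : 0 ≤ B) : ∃ K > 0, ∃ K0 > 0, ∃ n0 : ℕ, ∀ n ≥ n0, ∀ l : ℝ,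
    |l - n * c.R| ≤ B * √n → ∃ M : ℕ, 0 < M ∧ (M : ℝ) ≤ exp (l + (K + 2) * log n) ∧
      ∃ (f : (Fin n → 𝒴) → Fin M) (φ : Fin M → (Fin n → Xh)), ∀ (lo : (Fin n → 𝒴) → ℝ) (e : ℝ), 0 ≤ e →
      (∀ y, lo y ≤ 1) → (∀ y z, (∀ i, c.p (y i) ≠ 0) → |c.jn y - l| ≤ K0 * √(n * log n) → c.AA K l y z →
        lo y - e ≤ c.g y z) →
      ew (fun _ : Fin n => c.p) lo ≤ ew (fun _ : Fin n => c.p) (fun y => c.g y (φ (f y))) + e + K0 / n := by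
  obtain ⟨K1, hK1, Bd, hBd0, hBdE, hBdT⟩ := c.typ_all
  obtain ⟨K, hK, n1, hcov⟩ := h.cover (K1 + B + 1) (by positivity)
  obtain ⟨n2, hn2⟩ := exists_nat_gt K1
  refine ⟨K, hK, K1 + B + 1, by positivity, 3 + n1 + n2, ?_⟩
  intro n hn l hl
  have h3n : 3 ≤ n := by omega
  have hL := log_ge_one h3n
  have hnR : (3 : ℝ) ≤ n := by exact_mod_cast h3n
  have hn0 : (0 : ℝ) < n := by linarith
  have hnK : K1 < n := hn2.trans_le (by exact_mod_cast (by omega : n2 ≤ n))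
  have hrs : √(n : ℝ) ≤ √(n * log n) := Real.sqrt_le_sqrt (by nlinarith)
  have hr0 := Real.sqrt_nonneg ((n : ℝ) * log n)
  have hBE := hBdE n (by omega)
  have hgood : ∀ y : Fin n → 𝒴, ¬ (1 ≤ Bd n y) → (∀ b, |cy y b - n * c.p b| ≤ (K1 + B + 1) * √(n * log n)) ∧
      |c.jn y - l| ≤ (K1 + B + 1) * √(n * log n) := by
    intro y hy
    rcases hBdT n y with h1 | ⟨h1, h2⟩
    · exact absurd h1 hy
    constructor
    · intro b
      refine (h1 b).trans (mul_le_mul_of_nonneg_right (by linarith) hr0)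
    · have := abs_le.1 h2
      have := abs_le.1 hl
      have := mul_le_mul_of_nonneg_left hrs hB
      rw [abs_le]; constructor <;> nlinarith
  have hcov' : ∀ y : Fin n → 𝒴, ¬ (1 ≤ Bd n y) →
      exp (-(l + K * log n)) ≤ mn (fun z : Fin n → Xh => ∏ i, c.Q (z i)) (fun z => ind (c.AA K l y z)) := by
    intro y hy
    exact hcov n (by omega) y l (hgood y hy).1 (hgood y hy).2
  -- a good observation exists
  have hex : 0 ≤ l + K * log n := by
    by_contra hneg
    have hall : ∀ y : Fin n → 𝒴, 1 ≤ Bd n y := by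
      intro y
      by_contra hy
      have h1 := hcov' y hy
      have h2 := ew_ind_le_one (c.hQ.ch n) (fun z => c.AA K l y z)
      have h3 : exp 0 < exp (-(l + K * log n)) := Real.exp_lt_exp.2 (by linarith)
      rw [exp_zero] at h3
      exact absurd (h1.trans h2) (not_le.2 h3)
    have h1 := ew_mono (c.hp.ch n) (F := fun _ => 1) (G := Bd n) (fun y _ => hall y)
    rw [ew_const (c.hp.ch n)] at h1
    have h2 : K1 / n < 1 := (div_lt_one hn0).2 hnK
    linarith
  obtain ⟨X, hX⟩ : ∃ x, x = exp (l + K * log n) := ⟨_, rfl⟩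
  have hX1 : 1 ≤ X := by rw [hX]; exact Real.one_le_exp hex
  obtain ⟨M, hM⟩ : ∃ m, m = ⌈log n * X⌉₊ := ⟨_, rfl⟩
  have hMge : log n * X ≤ M := by rw [hM]; exact Nat.le_ceil _
  have hMle : (M : ℝ) ≤ log n * X + 1 := by rw [hM]; exact (Nat.ceil_lt_add_one (by positivity)).le
  have hMpos : 0 < M := by
    have : (0 : ℝ) < M := lt_of_lt_of_le (by positivity) hMge
    exact_mod_cast this
  refine ⟨M, hMpos, ?_, ?_⟩
  · have e : exp (l + (K + 2) * log n) = X * exp (2 * log n) := by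
      rw [hX, ← exp_add]; congr 1; ring
    rw [e]
    have := Real.add_one_le_exp (2 * log n)
    nlinarith
  obtain ⟨cb, hcb⟩ := random_cov (pmf_prod c.hQ n) (pmf_prod c.hp n) (fun y z => c.AA K l y z)
    (fun y => ¬ (1 ≤ Bd n y)) hcov' M
  have hcb2 : ew (fun _ : Fin n => c.p) (fun y => ind (¬ (1 ≤ Bd n y) ∧ ∀ m, ¬ c.AA K l y (cb m))) ≤ 1 / n := by
    refine hcb.trans ?_
    have e : (1 : ℝ) / n = exp (- log n) := by rw [exp_neg, exp_log hn0, one_div]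
    rw [e]
    apply Real.exp_le_exp.2
    have : exp (-(l + K * log n)) = X⁻¹ := by rw [hX, exp_neg]
    rw [this]
    have h1 := mul_le_mul_of_nonneg_left hMge (by positivity : 0 ≤ X⁻¹)
    have h2 : X⁻¹ * (log n * X) = log n := by field_simp
    linarith
  refine ⟨fun y => if hy : ∃ m, c.AA K l y (cb m) then hy.choose else ⟨0, hMpos⟩, cb, ?_⟩
  intro lo e he hlo1 hlo
  have key : ew (fun _ : Fin n => c.p) lo ≤ ew (fun _ : Fin n => c.p) (fun y =>
      (c.g y (cb (if hy : ∃ m, c.AA K l y (cb m) then hy.choose else ⟨0, hMpos⟩)) + e) +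
      (Bd n y + ind (¬ (1 ≤ Bd n y) ∧ ∀ m, ¬ c.AA K l y (cb m)))) := by
    apply ew_mono (c.hp.ch n); intro y hy
    have g0 : ∀ z, 0 ≤ c.g y z := fun z => ew_nonneg (fun i => c.hW (y i)) (fun _ => ind_nonneg _)
    by_cases hb : 1 ≤ Bd n y
    · linarith [hlo1 y, g0 (cb (if hy : ∃ m, c.AA K l y (cb m) then hy.choose else ⟨0, hMpos⟩)),
        ind_nonneg (¬ (1 ≤ Bd n y) ∧ ∀ m, ¬ c.AA K l y (cb m))]
    by_cases hm : ∃ m, c.AA K l y (cb m)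
    · have := hlo y _ hy (hgood y hb).2 hm.choose_spec
      rw [dif_pos hm]
      linarith [hBd0 n y, ind_nonneg (¬ (1 ≤ Bd n y) ∧ ∀ m, ¬ c.AA K l y (cb m))]
    · have hm' : ¬ (1 ≤ Bd n y) ∧ ∀ m, ¬ c.AA K l y (cb m) := ⟨hb, fun m hh => hm ⟨m, hh⟩⟩
      rw [ind_true hm']
      linarith [hlo1 y, g0 (cb (if hy : ∃ m, c.AA K l y (cb m) then hy.choose else ⟨0, hMpos⟩)), hBd0 n y]
  rw [ew_add, ew_add, ew_add, ew_const (c.hp.ch n)] at key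
  have e2 : (K1 + B + 1) / (n : ℝ) = K1 / n + 1 / n + B / n := by ring
  have : 0 ≤ B / (n : ℝ) := by positivity
  rw [e2]
  linarith

/-- achievability -/
theorem Opt.ach (h : c.Opt) (B : ℝ) (hB : 0 ≤ B) : ∃ C > 0, ∃ n0 : ℕ, ∀ n ≥ n0, ∀ l : ℝ,
    |l - n * c.R| ≤ B * √n → ∃ M : ℕ, 0 < M ∧ (M : ℝ) ≤ exp (l + C * log n) ∧
      ∃ (f : (Fin n → 𝒴) → Fin M) (φ : Fin M → (Fin n → Xh)),
      Phi ((l - n * c.R) / √(n * c.Vt)) - C * (log n / √n) ≤ ew (fun _ : Fin n => c.p) (fun y => c.g y (φ (f y))) := by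
  obtain ⟨K, hK, K0, hK0, n1, haux⟩ := h.ach_aux B hB
  rcases c.vs_nonneg.lt_or_eq with hvs | hvs
  · obtain ⟨C1, hC1, n2, hpt⟩ := ach_pt_pos hvs K0 K hK0 hK
    obtain ⟨C2, hC2, n3, hun⟩ := c.unrep h.hV hvs B hB
    refine ⟨K + 2 + C1 + C2 + K0, by positivity, 3 + n1 + n2 + n3, ?_⟩
    intro n hn l hl
    have h3n : 3 ≤ n := by omega
    have hL := log_ge_one h3n
    have htd := two_div_le h3n
    obtain ⟨M, hM0, hM, f, φ, hf⟩ := haux n (by omega) l hl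
    have q0 : 0 ≤ log n / √(n : ℝ) := by positivity
    refine ⟨M, hM0, hM.trans (Real.exp_le_exp.2 (by nlinarith)), f, φ, ?_⟩
    have h1 := hf (fun y => Phi ((l - c.jn y) / √(n * (c.lam ^ 2 * c.vs)))) (C1 * (log n / √n)) (by positivity)
      (fun y => Phi_le_one _) (fun y z _ hj hA => hpt n (by omega) y z l hj hA)
    have h2 := (abs_le.1 (hun n (by omega) l hl)).1
    have e1 : K0 / (n : ℝ) = K0 * (1 / n) := by ring
    have e2 : C2 * log n / √(n : ℝ) = C2 * (log n / √n) := by ring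
    have h3 := mul_le_mul_of_nonneg_left htd hK0.le
    rw [e1] at h1; rw [e2] at h2
    nlinarith
  · obtain ⟨C2, hC2, hjb⟩ := h.jn_berry hvs.symm
    refine ⟨K + 2 + C2 + K0, by positivity, 3 + n1, ?_⟩
    intro n hn l hl
    have h3n : 3 ≤ n := by omega
    have hL := log_ge_one h3n
    have htd := two_div_le h3n
    obtain ⟨M, hM0, hM, f, φ, hf⟩ := haux n (by omega) l hl
    have q0 : 0 ≤ log n / √(n : ℝ) := by positivity
    refine ⟨M, hM0, hM.trans (Real.exp_le_exp.2 (by nlinarith)), f, φ, ?_⟩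
    have h1 := hf (fun y => ind (c.jn y ≤ l)) 0 le_rfl
      (fun y => ind_le_one _) (fun y z hy hj hA => by
        rw [sub_zero]; exact ach_pt_zero hvs.symm hy hA)
    have h2 := (abs_le.1 (hjb n (by omega) l)).1
    have e1 : K0 / (n : ℝ) = K0 * (1 / n) := by ring
    have e2 : C2 / √(n : ℝ) ≤ C2 * (log n / √n) := by
      rw [mul_div_assoc']; apply div_le_div_of_nonneg_right _ (Real.sqrt_nonneg _); nlinarith
    have h3 := mul_le_mul_of_nonneg_left htd hK0.le
    rw [e1] at h1
    nlinarith

end Core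
end

open scoped BigOperators
noncomputable section
open Real Set Filter Topology
set_option linter.unusedSectionVars false

lemma ev_log (K : ℝ) : ∃ n0 : ℕ, ∀ n ≥ n0, K * log n ≤ √(n : ℝ) := by
  have h1 : Tendsto (fun n : ℕ => log n / (n : ℝ) ^ ((1 : ℝ) / 2)) atTop (𝓝 0) := by
    have := ((isLittleO_log_rpow_atTop (show (0 : ℝ) < 1 / 2 by norm_num)).tendsto_div_nhds_zero).comp
      tendsto_natCast_atTop_atTop
    simpa [Function.comp_def] using this
  have h2 := h1.eventually (gt_mem_nhds (show 0 < 1 / (|K| + 1) by positivity))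
  obtain ⟨n0, hn0⟩ := eventually_atTop.1 h2
  refine ⟨max n0 1, fun n hn => ?_⟩
  have hn1 : (1 : ℝ) ≤ n := by exact_mod_cast (le_max_right n0 1).trans hn
  have := hn0 n ((le_max_left _ _).trans hn)
  rw [← Real.sqrt_eq_rpow, div_lt_div_iff₀ (by positivity) (by positivity)] at this
  have hl : 0 ≤ log (n : ℝ) := Real.log_nonneg hn1
  nlinarith [le_abs_self K, abs_nonneg K]

namespace Core
variable {𝒳 𝒴 Xh : Type} [Fintype 𝒳] [Fintype 𝒴] [Fintype Xh] {c : Core 𝒳 𝒴 Xh}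

/-- minimal code size of the reduced problem -/
def Mst (c : Core 𝒳 𝒴 Xh) (n : ℕ) (ε : ℝ) : ℕ :=
  sInf {M : ℕ | 0 < M ∧ ∃ (f : (Fin n → 𝒴) → Fin M) (φ : Fin M → (Fin n → Xh)),
    1 - ε ≤ ew (fun _ : Fin n => c.p) (fun y => c.g y (φ (f y)))}

set_option maxHeartbeats 1000000 in
theorem Opt.final (h : c.Opt) (z ε : ℝ) (hz : Phi z = 1 - ε) : ∃ C > 0, ∃ n0 : ℕ, ∀ n ≥ n0,
    |log (c.Mst n ε) - (n * c.R + √(n * c.Vt) * z)| ≤ C * log n := by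
  classical
  have hV := h.hV
  have hs : 0 < √c.Vt := Real.sqrt_pos.2 hV
  have hB : 0 ≤ √c.Vt * |z| + 1 := by positivity
  obtain ⟨C1, hC1, n1, hconv⟩ := h.conv _ hB
  obtain ⟨C2, hC2, n2, hach⟩ := h.ach _ hB
  obtain ⟨c0, hc0, hloc⟩ := Phi_local z
  obtain ⟨K, hK⟩ : ∃ x, x = (C1 + C2 + 1) * √c.Vt / c0 := ⟨_, rfl⟩
  have hK0 : 0 < K := by rw [hK]; positivity
  obtain ⟨n3, he3⟩ := ev_log K
  obtain ⟨n4, he4⟩ := ev_log (K / √c.Vt)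
  refine ⟨K + C2, by positivity, 3 + n1 + n2 + n3 + n4, fun n hn => ?_⟩
  have h3 : 3 ≤ n := by omega
  have hL := log_ge_one h3
  have hn0 : (0 : ℝ) < n := by exact_mod_cast (by omega : 0 < n)
  have hsn : 0 < √(n : ℝ) := Real.sqrt_pos.2 hn0
  have hsq : √(n * c.Vt) = √n * √c.Vt := Real.sqrt_mul hn0.le _
  have hq3 := he3 n (by omega)
  have hq4 := he4 n (by omega)
  obtain ⟨t, ht⟩ : ∃ x, x = K * log n / √(n * c.Vt) := ⟨_, rfl⟩
  have ht0 : 0 ≤ t := by rw [ht]; positivity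
  have ht1 : t ≤ 1 := by
    rw [ht, hsq, div_le_one (by positivity)]
    rw [div_mul_eq_mul_div, div_le_iff₀ hs] at hq4
    exact hq4
  have hct : c0 * t = C1 * (log n / √n) + C2 * (log n / √n) + log n / √n := by
    rw [ht, hsq, hK]; field_simp
  have hpos : 0 < log n / √(n : ℝ) := by positivity
  have hp1 := mul_pos hC1 hpos
  have hp2 := mul_pos hC2 hpos
  obtain ⟨hl1, hl2⟩ := hloc t ht0 ht1
  have hzn : |√(n * c.Vt) * z| ≤ √c.Vt * |z| * √n := by
    rw [abs_mul, abs_of_nonneg (Real.sqrt_nonneg _), hsq]; apply le_of_eq; ring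
  -- achievability
  obtain ⟨M, hM0, hM, f, φ, hf⟩ := hach n (by omega) (n * c.R + √(n * c.Vt) * z + K * log n) (by
    rw [show n * c.R + √(n * c.Vt) * z + K * log n - n * c.R = √(n * c.Vt) * z + K * log n by ring]
    refine (abs_add_le _ _).trans ?_
    rw [abs_of_nonneg (by positivity : 0 ≤ K * log (n : ℝ))]
    rw [add_mul, one_mul]; linarith)
  have e1 : (n * c.R + √(n * c.Vt) * z + K * log n - n * c.R) / √(n * c.Vt) = z + t := by
    rw [ht]
    have : √(n * c.Vt) ≠ 0 := by rw [hsq]; positivity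
    field_simp; ring
  have hmem : M ∈ {M : ℕ | 0 < M ∧ ∃ (f : (Fin n → 𝒴) → Fin M) (φ : Fin M → (Fin n → Xh)),
    1 - ε ≤ ew (fun _ : Fin n => c.p) (fun y => c.g y (φ (f y)))} := by
    refine ⟨hM0, f, φ, ?_⟩
    rw [e1] at hf
    refine le_trans ?_ hf
    rw [← hz]
    linarith
  have hle : c.Mst n ε ≤ M := Nat.sInf_le hmem
  obtain ⟨hm0, f', φ', hf'⟩ : 0 < c.Mst n ε ∧ ∃ (f : (Fin n → 𝒴) → Fin (c.Mst n ε)) (φ : Fin (c.Mst n ε) → (Fin n → Xh)),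
    1 - ε ≤ ew (fun _ : Fin n => c.p) (fun y => c.g y (φ (f y))) := Nat.sInf_mem ⟨M, hmem⟩
  have hm0' : (0 : ℝ) < c.Mst n ε := by exact_mod_cast hm0
  have hup : log (c.Mst n ε) ≤ n * c.R + √(n * c.Vt) * z + K * log n + C2 * log n := by
    rw [Real.log_le_iff_le_exp hm0']
    exact le_trans (by exact_mod_cast hle) hM
  have hlo : n * c.R + √(n * c.Vt) * z - K * log n ≤ log (c.Mst n ε) := by
    by_contra hcon
    push Not at hcon
    have hcard : ((Finset.univ.image φ').card : ℝ) ≤ exp (n * c.R + √(n * c.Vt) * z - K * log n) := by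
      have h1 : (Finset.univ.image φ').card ≤ c.Mst n ε := by
        refine Finset.card_image_le.trans ?_
        simp
      have h2 : (c.Mst n ε : ℝ) ≤ exp (n * c.R + √(n * c.Vt) * z - K * log n) :=
        (Real.log_le_iff_le_exp hm0').1 hcon.le
      exact le_trans (by exact_mod_cast h1) h2
    have := hconv n (by omega) (n * c.R + √(n * c.Vt) * z - K * log n) (by
      rw [show n * c.R + √(n * c.Vt) * z - K * log n - n * c.R = √(n * c.Vt) * z - K * log n by ring]
      refine (abs_sub _ _).trans ?_
      rw [abs_of_nonneg (by positivity : 0 ≤ K * log (n : ℝ))]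
      rw [add_mul, one_mul]; linarith) _ hcard (fun y => φ' (f' y)) (fun y => Finset.mem_image_of_mem _ (Finset.mem_univ _))
    have e2 : (n * c.R + √(n * c.Vt) * z - K * log n - n * c.R) / √(n * c.Vt) = z - t := by
      rw [ht]
      have : √(n * c.Vt) ≠ 0 := by rw [hsq]; positivity
      field_simp; ring
    rw [e2] at this
    linarith
  have hp3 : 0 ≤ C2 * log n := by positivity
  rw [abs_le, add_mul]
  constructor <;> linarith

/-- the operational quantity equals the reduced one -/
lemma Mst_eq (P : 𝒳 → ℝ) (V : 𝒳 → 𝒴 → ℝ) (hPV : ∀ x y, P x * V x y = c.p y * c.W y x) (n : ℕ) (hn : 1 ≤ n)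
    (ε : ℝ) : MstarNoisy P V c.d n c.D ε = c.Mst n ε := by
  classical
  unfold MstarNoisy Mst
  have hn0 : (0 : ℝ) < n := by exact_mod_cast hn
  have key : ∀ ζ : (Fin n → 𝒴) → (Fin n → Xh),
      Pr (iidJoint P V n) {p | c.D < distn c.d p.1 (ζ p.2)} =
      1 - ew (fun _ : Fin n => c.p) (fun y => c.g y (ζ y)) := by
    intro ζ
    have e1 : ew (fun _ : Fin n => c.p) (fun y => 1 - c.g y (ζ y)) =
        1 - ew (fun _ : Fin n => c.p) (fun y => c.g y (ζ y)) := by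
      rw [ew_sub, ew_const (c.hp.ch n)]
    rw [← e1]
    have e2 : ∀ y, 1 - c.g y (ζ y) = ew (fun i => c.W (y i))
        (fun x => ind (c.D < distn c.d x (ζ y))) := by
      intro y
      unfold g
      have hw : IsChannel (fun i => c.W (y i)) := fun i => c.hW (y i)
      rw [← ew_const hw 1, ← ew_sub]
      congr 1; ext x
      rw [← ind_not]
      apply ind_congr
      unfold distn
      rw [lt_div_iff₀ hn0, not_le, mul_comm]
    simp_rw [e2]
    unfold Pr ew
    rw [Fintype.sum_prod_type, Finset.sum_comm]
    apply Finset.sum_congr rfl; intro y _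
    rw [Finset.mul_sum]
    apply Finset.sum_congr rfl; intro x _
    rw [Set.indicator_apply]
    have e3 : iidJoint P V n (x, y) = (∏ i, c.p (y i)) * ∏ i, c.W (y i) (x i) := by
      unfold iidJoint
      rw [← Finset.prod_mul_distrib]
      exact Finset.prod_congr rfl fun i _ => hPV _ _
    rw [e3]
    by_cases hh : c.D < distn c.d x (ζ y)
    · rw [if_pos (by exact hh)]; beta_reduce; rw [ind_true hh]; ring
    · rw [if_neg (by exact hh)]; beta_reduce; rw [ind_false hh]; ring
  congr 1
  ext M
  simp only [Set.mem_ofPred_eq]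
  refine and_congr_right fun _ => exists_congr fun f => exists_congr fun φ => ?_
  have := key (fun y => φ (f y))
  beta_reduce at this
  rw [this]
  constructor <;> intro h <;> linarith

end Core
end

open scoped BigOperators
noncomputable section
open Real Set Filter Topology
set_option linter.unusedSectionVars false

lemma tang {a b r : ℝ} (ha : 0 ≤ a) (hb : 0 ≤ b) (hab : b = 0 → a = 0) (hr : 0 < r) :
    a * log r + a - b * r ≤ a * log (a / b) := by
  rcases ha.lt_or_eq with ha | ha
  · have hb' : 0 < b := by
      rcases hb.lt_or_eq with h | h
      · exact h
      · exact absurd (hab h.symm) ha.ne'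
    have h1 := Real.log_le_sub_one_of_pos (show 0 < b * r / a by positivity)
    rw [Real.log_div (by positivity) ha.ne', Real.log_mul hb'.ne' hr.ne'] at h1
    rw [Real.log_div ha.ne' hb'.ne']
    have h2 := mul_le_mul_of_nonneg_left h1 ha.le
    have h3 : a * (b * r / a - 1) = b * r - a := by field_simp
    rw [h3] at h2
    nlinarith
  · rw [← ha]; have := mul_nonneg hb hr.le; simp; exact this

lemma logsum2 {u0 u1 o0 o1 s : ℝ} (hs0 : 0 < s) (hs1' : 0 < 1 - s) (a0 : 0 ≤ u0) (a1 : 0 ≤ u1) (b0 : 0 ≤ o0) (b1 : 0 ≤ o1)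
    (z0 : o0 = 0 → u0 = 0) (z1 : o1 = 0 → u1 = 0) :
    ((1 - s) * u0 + s * u1) * log (((1 - s) * u0 + s * u1) / ((1 - s) * o0 + s * o1)) ≤
      (1 - s) * (u0 * log (u0 / o0)) + s * (u1 * log (u1 / o1)) := by
  by_cases hz : (1 - s) * u0 + s * u1 = 0
  · have p0 := mul_nonneg hs1'.le a0
    have p1 := mul_nonneg hs0.le a1
    have e0 : (1 - s) * u0 = 0 := by linarith
    have e1 : s * u1 = 0 := by linarith
    rw [hz, ← mul_assoc, ← mul_assoc, e0, e1]; simp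
  · have hpos : 0 < (1 - s) * u0 + s * u1 := lt_of_le_of_ne (by positivity) (Ne.symm hz)
    have hop : 0 < (1 - s) * o0 + s * o1 := by
      refine lt_of_le_of_ne (by positivity) (fun hh => hz ?_)
      have p0 := mul_nonneg hs1'.le b0
      have p1 := mul_nonneg hs0.le b1
      have e0 : (1 - s) * o0 = 0 := by linarith
      have e1 : s * o1 = 0 := by linarith
      rw [z0 ((mul_eq_zero.1 e0).resolve_left hs1'.ne'), z1 ((mul_eq_zero.1 e1).resolve_left hs0.ne')]; simp
    have t0 := mul_le_mul_of_nonneg_left (tang a0 b0 z0 (div_pos hpos hop)) hs1'.le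
    have t1 := mul_le_mul_of_nonneg_left (tang a1 b1 z1 (div_pos hpos hop)) hs0.le
    have e : ((1 - s) * o0 + s * o1) * (((1 - s) * u0 + s * u1) / ((1 - s) * o0 + s * o1)) = (1 - s) * u0 + s * u1 := by
      field_simp
    nlinarith

section red
variable {𝒴 Xh : Type} [Fintype 𝒴] [Fintype Xh]

/-- expected distortion -/
def DD (e : 𝒴 → Xh → ℝ) (q : 𝒴 → ℝ) (U : 𝒴 → Xh → ℝ) : ℝ := ∑ y, q y * ∑ z, U y z * e y z

/-- reduced rate-distortion function -/
def Rr (e : 𝒴 → Xh → ℝ) (q : 𝒴 → ℝ) (D : ℝ) : ℝ :=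
  sInf {r | ∃ U : 𝒴 → Xh → ℝ, IsChannel U ∧ DD e q U ≤ D ∧ r = mutInfo q U}

variable {q : 𝒴 → ℝ} {U : 𝒴 → Xh → ℝ} {e : 𝒴 → Xh → ℝ}

lemma out_zero (hq : ∀ y, 0 ≤ q y) (hU : IsChannel U) {y : 𝒴} (hy : 0 < q y) {z : Xh}
    (h0 : ∑ y, q y * U y z = 0) : U y z = 0 := by
  have := (Finset.sum_eq_zero_iff_of_nonneg (fun y _ => mul_nonneg (hq y) ((hU y).1 z))).1 h0 y (Finset.mem_univ y)
  rcases mul_eq_zero.1 this with h | h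
  · exact absurd h hy.ne'
  · exact h

lemma out_nonneg (hq : ∀ y, 0 ≤ q y) (hU : IsChannel U) (z : Xh) : 0 ≤ ∑ y, q y * U y z :=
  Finset.sum_nonneg fun y _ => mul_nonneg (hq y) ((hU y).1 z)

lemma out_sum (hU : IsChannel U) : ∑ z, ∑ y, q y * U y z = ∑ y, q y := by
  rw [Finset.sum_comm]
  apply Finset.sum_congr rfl; intro y _
  rw [← Finset.mul_sum, (hU y).2, mul_one]

lemma KT_lower (hq : ∀ y, 0 ≤ q y) (hU : IsChannel U) {κ : 𝒴 → Xh → ℝ} (hκ0 : ∀ y z, 0 < κ y z)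
    (hκ : ∀ z, ∑ y, q y * κ y z ≤ 1) : ∑ y, ∑ z, q y * U y z * log (κ y z) ≤ mutInfo q U := by
  have h1 : ∀ y z, q y * U y z * log (κ y z) + (q y * U y z - q y * κ y z * ∑ y', q y' * U y' z) ≤
      q y * U y z * log (U y z / ∑ y', q y' * U y' z) := by
    intro y z
    rcases (hq y).lt_or_eq with hy | hy
    · have := tang ((hU y).1 z) (out_nonneg hq hU z) (out_zero hq hU hy) (hκ0 y z)
      have := mul_le_mul_of_nonneg_left this hy.le
      nlinarith
    · rw [← hy]; simp
  have h2 := Finset.sum_le_sum fun y (_ : y ∈ Finset.univ) => Finset.sum_le_sum fun z (_ : z ∈ Finset.univ) => h1 y z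
  simp only [Finset.sum_add_distrib, Finset.sum_sub_distrib] at h2
  have h3 : ∑ y, ∑ z, q y * U y z = ∑ y, q y := by
    rw [Finset.sum_comm, out_sum hU]
  have h4 : ∑ y, ∑ z, q y * κ y z * ∑ y', q y' * U y' z ≤ ∑ y, q y := by
    rw [Finset.sum_comm, ← out_sum hU (q := q)]
    apply Finset.sum_le_sum; intro z _
    rw [← Finset.sum_mul]
    have := mul_le_mul_of_nonneg_right (hκ z) (out_nonneg hq hU z)
    linarith
  unfold mutInfo
  linarith

lemma KT_out {κ : 𝒴 → Xh → ℝ} {A : Xh → ℝ}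
    (hUA : ∀ y z, q y ≠ 0 → U y z = A z * κ y z) (hA : ∀ z, A z ≠ 0 → ∑ y, q y * κ y z = 1) (z : Xh) :
    ∑ y, q y * U y z = A z := by
  have : ∑ y, q y * U y z = A z * ∑ y, q y * κ y z := by
    rw [Finset.mul_sum]; apply Finset.sum_congr rfl; intro y _
    by_cases hy : q y = 0
    · rw [hy]; ring
    · rw [hUA y z hy]; ring
  rw [this]
  by_cases hz : A z = 0
  · rw [hz]; ring
  · rw [hA z hz, mul_one]

lemma KT_eq {κ : 𝒴 → Xh → ℝ} {A : Xh → ℝ}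
    (hUA : ∀ y z, q y ≠ 0 → U y z = A z * κ y z) (hA : ∀ z, A z ≠ 0 → ∑ y, q y * κ y z = 1) :
    mutInfo q U = ∑ y, ∑ z, q y * U y z * log (κ y z) := by
  unfold mutInfo
  apply Finset.sum_congr rfl; intro y _
  apply Finset.sum_congr rfl; intro z _
  rw [KT_out hUA hA]
  by_cases hy : q y = 0
  · rw [hy]; ring
  rw [hUA y z hy]
  by_cases hz : A z = 0
  · rw [hz]; ring
  · rw [mul_div_cancel_left₀ _ hz]

lemma log_k (hU : IsChannel U) (β : 𝒴 → ℝ) (lam : ℝ) :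
    ∑ y, ∑ z, q y * U y z * log (exp (β y - lam * e y z)) = ∑ y, q y * β y - lam * DD e q U := by
  unfold DD
  rw [Finset.mul_sum, ← Finset.sum_sub_distrib]
  apply Finset.sum_congr rfl; intro y _
  simp only [Real.log_exp]
  have : ∀ z, q y * U y z * (β y - lam * e y z) = q y * β y * U y z - lam * (q y * (U y z * e y z)) := fun z => by ring
  simp only [this]
  rw [Finset.sum_sub_distrib, ← Finset.mul_sum, (hU y).2, ← Finset.mul_sum, ← Finset.mul_sum]; ring

lemma mi_bdd (hq : ∀ y, 0 ≤ q y) (hU : IsChannel U) : (∑ y, q y) * log (1 / (∑ y, q y + 1)) ≤ mutInfo q U := by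
  have h0 : 0 ≤ ∑ y, q y := Finset.sum_nonneg fun y _ => hq y
  have := KT_lower hq hU (κ := fun _ _ => 1 / (∑ y, q y + 1)) (fun _ _ => by positivity) (fun z => by
    rw [← Finset.sum_mul, mul_one_div, div_le_one (by positivity)]; linarith)
  refine le_trans (le_of_eq ?_) this
  rw [Finset.sum_mul]
  apply Finset.sum_congr rfl; intro y _
  rw [← Finset.sum_mul, ← Finset.mul_sum, (hU y).2, mul_one]

lemma mi_nonneg {p : 𝒴 → ℝ} (hp : IsPmf p) (hU : IsChannel U) : 0 ≤ mutInfo p U := by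
  have := KT_lower hp.1 hU (κ := fun _ _ => 1) (fun _ _ => by positivity) (fun z => by
    simp [hp.2])
  simpa using this

lemma Rr_le (hq : ∀ y, 0 ≤ q y) (hU : IsChannel U) {D : ℝ} (hD : DD e q U ≤ D) : Rr e q D ≤ mutInfo q U := by
  refine csInf_le ?_ ⟨U, hU, hD, rfl⟩
  refine ⟨(∑ y, q y) * log (1 / (∑ y, q y + 1)), ?_⟩
  rintro r ⟨U', hU', -, rfl⟩
  exact mi_bdd hq hU'

lemma Rr_eq (hq : ∀ y, 0 ≤ q y) (hU : IsChannel U) {β : 𝒴 → ℝ} {lam D : ℝ} (hlam : 0 ≤ lam) {A : Xh → ℝ}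
    (hle : ∀ z, ∑ y, q y * exp (β y - lam * e y z) ≤ 1)
    (hUA : ∀ y z, q y ≠ 0 → U y z = A z * exp (β y - lam * e y z))
    (hA : ∀ z, A z ≠ 0 → ∑ y, q y * exp (β y - lam * e y z) = 1)
    (hD : DD e q U = D) : mutInfo q U = Rr e q D := by
  apply le_antisymm _ (Rr_le hq hU hD.le)
  refine le_csInf ⟨_, U, hU, hD.le, rfl⟩ ?_
  rintro r ⟨U', hU', hD', rfl⟩
  have h1 := KT_lower hq hU' (κ := fun y z => exp (β y - lam * e y z)) (fun _ _ => Real.exp_pos _) hle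
  have h2 := KT_eq (κ := fun y z => exp (β y - lam * e y z)) hUA hA
  rw [log_k hU'] at h1
  rw [log_k hU] at h2
  rw [h2, hD]
  have := mul_le_mul_of_nonneg_left hD' hlam
  linarith

lemma mi_convex (hq : ∀ y, 0 ≤ q y) {U0 U1 : 𝒴 → Xh → ℝ} (h0 : IsChannel U0) (h1 : IsChannel U1) {s : ℝ} (hs0 : 0 < s)
    (hs1 : s < 1) : mutInfo q (fun y z => (1 - s) * U0 y z + s * U1 y z) ≤
      (1 - s) * mutInfo q U0 + s * mutInfo q U1 := by
  unfold mutInfo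
  simp only [Finset.mul_sum]
  rw [← Finset.sum_add_distrib]
  apply Finset.sum_le_sum; intro y _
  rw [← Finset.sum_add_distrib]
  apply Finset.sum_le_sum; intro z _
  rcases (hq y).lt_or_eq with hy | hy
  swap
  · rw [← hy]; simp
  have hs1' : 0 < 1 - s := by linarith
  have eo : ∑ y, q y * ((1 - s) * U0 y z + s * U1 y z) = (1 - s) * ∑ y, q y * U0 y z + s * ∑ y, q y * U1 y z := by
    rw [Finset.mul_sum, Finset.mul_sum, ← Finset.sum_add_distrib]
    apply Finset.sum_congr rfl; intro y _; ring
  rw [eo]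
  have a0 := (h0 y).1 z
  have a1 := (h1 y).1 z
  have z0 := out_zero hq h0 hy (z := z)
  have z1 := out_zero hq h1 hy (z := z)
  have b0 := out_nonneg hq h0 z
  have b1 := out_nonneg hq h1 z
  have key := logsum2 hs0 hs1' a0 a1 b0 b1 z0 z1
  have := mul_le_mul_of_nonneg_left key hy.le
  nlinarith

lemma mix_ch {U0 U1 : 𝒴 → Xh → ℝ} (h0 : IsChannel U0) (h1 : IsChannel U1) {s : ℝ} (hs0 : 0 ≤ s)
    (hs1 : s ≤ 1) : IsChannel (fun y z => (1 - s) * U0 y z + s * U1 y z) := by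
  intro y
  refine ⟨fun z => add_nonneg (mul_nonneg (by linarith) ((h0 y).1 z)) (mul_nonneg hs0 ((h1 y).1 z)), ?_⟩
  rw [Finset.sum_add_distrib, ← Finset.mul_sum, ← Finset.mul_sum, (h0 y).2, (h1 y).2]; ring

lemma mix_DD (U0 U1 : 𝒴 → Xh → ℝ) (s : ℝ) : DD e q (fun y z => (1 - s) * U0 y z + s * U1 y z) =
    (1 - s) * DD e q U0 + s * DD e q U1 := by
  unfold DD
  rw [Finset.mul_sum, Finset.mul_sum, ← Finset.sum_add_distrib]
  apply Finset.sum_congr rfl; intro y _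
  simp only [add_mul, Finset.sum_add_distrib, mul_assoc]
  rw [← Finset.mul_sum, ← Finset.mul_sum]; ring

lemma deriv_le_of {f : ℝ → ℝ} {f' c : ℝ} (hf : HasDerivAt f f' 0) (h : ∀ s, 0 < s → s < 1 → f s ≤ f 0 + s * c) :
    f' ≤ c := by
  have h1 := (hasDerivAt_iff_tendsto_slope.1 hf).mono_left
    (nhdsWithin_mono (0 : ℝ) (s := Ioi 0) (fun x hx => ne_of_gt hx))
  refine le_of_tendsto h1 ?_
  filter_upwards [Ioo_mem_nhdsGT (show (0 : ℝ) < 1 by norm_num)] with s hs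
  rw [slope_def_field, sub_zero, div_le_iff₀ hs.1]
  have := h s hs.1 hs.2
  linarith

lemma kkt {p : 𝒴 → ℝ} (hp : IsPmf p) {U0 : 𝒴 → Xh → ℝ} (h0 : IsChannel U0) {D lam : ℝ} (hD : DD e p U0 = D)
    (hopt : mutInfo p U0 = Rr e p D) (hlam : HasDerivAt (fun D' => Rr e p D') (-lam) D)
    (hU : IsChannel U) : mutInfo p U0 + lam * D ≤ mutInfo p U + lam * DD e p U := by
  have h1 : HasDerivAt (fun s : ℝ => Rr e p (D + s * (DD e p U - D))) (-lam * (DD e p U - D)) 0 := by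
    have h2 : HasDerivAt (fun s : ℝ => D + s * (DD e p U - D)) (DD e p U - D) 0 := by
      simpa using ((hasDerivAt_id (0 : ℝ)).mul_const (DD e p U - D)).const_add D
    have h3 : HasDerivAt (fun D' => Rr e p D') (-lam) (D + 0 * (DD e p U - D)) := by simpa using hlam
    exact HasDerivAt.comp (h₂ := fun D' => Rr e p D') (0 : ℝ) h3 h2
  have := deriv_le_of h1 (c := mutInfo p U - mutInfo p U0) (fun s hs0 hs1 => by
    have h4 := Rr_le (e := e) hp.1 (mix_ch h0 hU hs0.le hs1.le) (D := D + s * (DD e p U - D))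
      (by rw [mix_DD, hD]; apply le_of_eq; ring)
    have h5 := mi_convex hp.1 h0 hU hs0 hs1
    have h6 : Rr e p (D + 0 * (DD e p U - D)) = mutInfo p U0 := by rw [hopt]; congr 1; ring
    beta_reduce
    rw [h6]
    linarith)
  nlinarith

end red
end

open scoped BigOperators
noncomputable section
open Real Set Filter Topology
set_option linter.unusedSectionVars false

section red
variable {𝒴 Xh : Type} [Fintype 𝒴] [Fintype Xh]
variable {q p : 𝒴 → ℝ} {U U0 : 𝒴 → Xh → ℝ} {e : 𝒴 → Xh → ℝ} {Q : Xh → ℝ} {D lam : ℝ}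

lemma KT_upper (hp : IsPmf p) (hU : IsChannel U) {κ : 𝒴 → Xh → ℝ} (hκ0 : ∀ y z, 0 < κ y z) (hQ : IsPmf Q)
    (hUQ : ∀ y z, U y z = Q z * κ y z) : mutInfo p U ≤ ∑ y, ∑ z, p y * U y z * log (κ y z) := by
  have h1 : ∀ y z, p y * U y z * log (U y z / ∑ y', p y' * U y' z) =
      p y * U y z * log (κ y z) - p y * U y z * log ((∑ y', p y' * U y' z) / Q z) := by
    intro y z
    rcases (hp.1 y).lt_or_eq with hy | hy
    swap
    · rw [← hy]; simp
    by_cases hz : Q z = 0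
    · rw [hUQ, hz]; simp
    have hu : U y z ≠ 0 := by rw [hUQ]; exact mul_ne_zero hz (hκ0 y z).ne'
    have ho : ∑ y', p y' * U y' z ≠ 0 := fun h => hu (out_zero hp.1 hU hy h)
    rw [Real.log_div hu ho, Real.log_div ho hz]
    have : log (U y z) = log (Q z) + log (κ y z) := by rw [hUQ, Real.log_mul hz (hκ0 y z).ne']
    rw [this]; ring
  unfold mutInfo
  simp only [h1, Finset.sum_sub_distrib]
  have h2 : 0 ≤ ∑ y, ∑ z, p y * U y z * log ((∑ y', p y' * U y' z) / Q z) := by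
    rw [Finset.sum_comm]
    have h3 : ∀ z, ∑ y, p y * U y z - Q z ≤ ∑ y, p y * U y z * log ((∑ y', p y' * U y' z) / Q z) := by
      intro z
      rw [← Finset.sum_mul]
      have := tang (out_nonneg hp.1 hU z) (hQ.1 z) (fun h => by simp [hUQ, h]) one_pos
      simp at this
      linarith
    have h4 := Finset.sum_le_sum fun z (_ : z ∈ Finset.univ) => h3 z
    rw [Finset.sum_sub_distrib, out_sum hU, hp.2, hQ.2] at h4
    linarith
  linarith

/-- partition function -/
def SS (lam : ℝ) (e : 𝒴 → Xh → ℝ) (Q : Xh → ℝ) (y : 𝒴) : ℝ := ∑ z, Q z * exp (-(lam * e y z))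
/-- tilting kernel -/
def kk (lam : ℝ) (e : 𝒴 → Xh → ℝ) (Q : Xh → ℝ) (y : 𝒴) (z : Xh) : ℝ := exp (-log (SS lam e Q y) - lam * e y z)

lemma SS_pos (hQ : IsPmf Q) (y : 𝒴) : 0 < SS lam e Q y := by
  obtain ⟨z, _, hz⟩ : ∃ z ∈ Finset.univ, 0 < Q z := by
    apply Finset.exists_lt_of_sum_lt (f := fun _ => (0 : ℝ))
    rw [hQ.2]; simp
  refine lt_of_lt_of_le (mul_pos hz (Real.exp_pos _)) (Finset.single_le_sum
    (f := fun z => Q z * Real.exp (-(lam * e y z)))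
    (fun i _ => mul_nonneg (hQ.1 i) (Real.exp_pos _).le) (Finset.mem_univ z))

lemma kk_eq (hQ : IsPmf Q) (y : 𝒴) (z : Xh) : kk lam e Q y z = exp (-(lam * e y z)) / SS lam e Q y := by
  unfold kk
  rw [sub_eq_add_neg, Real.exp_add, Real.exp_neg, Real.exp_log (SS_pos hQ y)]
  field_simp

lemma kk_ch (hQ : IsPmf Q) : IsChannel (fun y z => Q z * kk lam e Q y z) := by
  intro y
  refine ⟨fun z => mul_nonneg (hQ.1 z) (Real.exp_pos _).le, ?_⟩
  simp_rw [kk_eq hQ, ← mul_div_assoc]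
  rw [← Finset.sum_div]
  exact div_self (SS_pos hQ y).ne'

lemma out_pmf (hp : IsPmf p) (hU : IsChannel U) : IsPmf (fun z => ∑ y, p y * U y z) :=
  ⟨fun z => out_nonneg hp.1 hU z, by rw [out_sum hU, hp.2]⟩

/-- `F(Q') ≥ L` for all `Q'` -/
lemma kktF (hp : IsPmf p) (h0 : IsChannel U0) (hD : DD e p U0 = D)
    (hopt : mutInfo p U0 = Rr e p D) (hlam : HasDerivAt (fun D' => Rr e p D') (-lam) D) (hQ : IsPmf Q) :
    mutInfo p U0 + lam * D ≤ - ∑ y, p y * log (SS lam e Q y) := by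
  have h1 := kkt hp h0 hD hopt hlam (kk_ch (lam := lam) (e := e) hQ)
  have h2 := KT_upper hp (kk_ch (lam := lam) (e := e) hQ) (fun y z => Real.exp_pos _) hQ (fun y z => rfl)
  have h5 := log_k (q := p) (e := e) (kk_ch (lam := lam) (e := e) hQ) (fun y => -log (SS lam e Q y)) lam
  rw [h5] at h2
  have : ∑ y, p y * -log (SS lam e Q y) = - ∑ y, p y * log (SS lam e Q y) := by simp
  rw [this] at h2
  linarith

lemma red_tilt (hp : IsPmf p) (h0 : IsChannel U0) (hD : DD e p U0 = D)
    (hopt : mutInfo p U0 = Rr e p D) (hlam : HasDerivAt (fun D' => Rr e p D') (-lam) D)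
    (hQd : Q = fun z => ∑ y, p y * U0 y z) : ∀ y z, p y ≠ 0 → U0 y z = Q z * kk lam e Q y z := by
  have hQ : IsPmf Q := hQd ▸ out_pmf hp h0
  have h1 := kktF hp h0 hD hopt hlam hQ
  have hk : ∑ y, ∑ z, p y * U0 y z * log (kk lam e Q y z) = - ∑ y, p y * log (SS lam e Q y) - lam * D := by
    unfold kk
    rw [log_k h0, hD]; simp
  have hQz : ∀ z, ∑ y, p y * U0 y z = Q z := fun z => by rw [hQd]
  have h3 : ∀ y z, p y * ((U0 y z - Q z * kk lam e Q y z) + (√(U0 y z) - √(Q z * kk lam e Q y z)) ^ 2) ≤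
      p y * U0 y z * log (U0 y z / ∑ y', p y' * U0 y' z) - p y * U0 y z * log (kk lam e Q y z) := by
    intro y z
    rcases (hp.1 y).lt_or_eq with hy | hy
    swap
    · rw [← hy]; simp
    rw [hQz]
    have : (U0 y z - Q z * kk lam e Q y z) + (√(U0 y z) - √(Q z * kk lam e Q y z)) ^ 2 ≤
        U0 y z * log (U0 y z / Q z) - U0 y z * log (kk lam e Q y z) := by
      have hkp : 0 < kk lam e Q y z := Real.exp_pos _
      rcases ((h0 y).1 z).lt_or_eq with hu | hu
      · have hz : 0 < Q z := by
          refine lt_of_le_of_ne (hQ.1 z) (fun h => hu.ne' ?_)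
          exact out_zero hp.1 h0 hy (by rw [hQz, ← h])
        have := alog hu (mul_pos hz hkp)
        rw [Real.log_div hu.ne' (by positivity), Real.log_mul hz.ne' hkp.ne'] at this
        rw [Real.log_div hu.ne' hz.ne']
        linarith
      · rw [← hu]
        have := mul_nonneg (hQ.1 z) hkp.le
        simp [Real.sq_sqrt this]
    have := mul_le_mul_of_nonneg_left this hy.le
    nlinarith
  have h4 := Finset.sum_le_sum fun y (_ : y ∈ Finset.univ) => Finset.sum_le_sum fun z (_ : z ∈ Finset.univ) => h3 y z
  simp only [mul_add, mul_sub, Finset.sum_add_distrib, Finset.sum_sub_distrib] at h4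
  have h5 : ∑ y, ∑ z, p y * U0 y z = 1 := by rw [Finset.sum_comm, out_sum h0, hp.2]
  have h6 : ∑ y, ∑ z, p y * (Q z * kk lam e Q y z) = 1 := by
    rw [Finset.sum_comm, out_sum (kk_ch hQ), hp.2]
  unfold mutInfo at h1
  rw [h5, h6, hk] at h4
  have h7 : ∑ y, ∑ z, p y * (√(U0 y z) - √(Q z * kk lam e Q y z)) ^ 2 ≤ 0 := by linarith
  intro y z hy
  have hnn : ∀ y z, 0 ≤ p y * (√(U0 y z) - √(Q z * kk lam e Q y z)) ^ 2 := fun y z => mul_nonneg (hp.1 y) (sq_nonneg _)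
  have h8 := le_antisymm h7 (Finset.sum_nonneg fun y _ => Finset.sum_nonneg fun z _ => hnn y z)
  have h9 := (Finset.sum_eq_zero_iff_of_nonneg (fun y _ => Finset.sum_nonneg fun z _ => hnn y z)).1 h8 y (Finset.mem_univ y)
  have h10 := (Finset.sum_eq_zero_iff_of_nonneg (fun z _ => hnn y z)).1 h9 z (Finset.mem_univ z)
  have h11 := (mul_eq_zero.1 h10).resolve_left hy
  have h12 : √(U0 y z) = √(Q z * kk lam e Q y z) := by
    have := pow_eq_zero_iff (two_ne_zero) |>.1 h11
    linarith
  exact (Real.sqrt_inj ((h0 y).1 z) (mul_nonneg (hQ.1 z) (Real.exp_pos _).le)).1 h12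

lemma red_one (hQd : Q = fun z => ∑ y, p y * U0 y z) (ht : ∀ y z, p y ≠ 0 → U0 y z = Q z * kk lam e Q y z) :
    ∀ z, Q z ≠ 0 → ∑ y, p y * kk lam e Q y z = 1 := by
  intro z hz
  have h1 : ∑ y, p y * U0 y z = Q z * ∑ y, p y * kk lam e Q y z := by
    rw [Finset.mul_sum]; apply Finset.sum_congr rfl; intro y _
    by_cases hy : p y = 0
    · rw [hy]; ring
    · rw [ht y z hy]; ring
  have h2 : ∑ y, p y * U0 y z = Q z := by rw [hQd]
  rw [h2] at h1
  exact mul_left_cancel₀ hz (by rw [← h1, mul_one])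

lemma red_val (h0 : IsChannel U0) (hD : DD e p U0 = D) (hQd : Q = fun z => ∑ y, p y * U0 y z)
    (ht : ∀ y z, p y ≠ 0 → U0 y z = Q z * kk lam e Q y z) :
    mutInfo p U0 = ∑ y, p y * -log (SS lam e Q y) - lam * D := by
  rw [KT_eq ht (red_one hQd ht)]
  unfold kk
  rw [log_k h0, hD]

lemma red_le [DecidableEq Xh] (hp : IsPmf p) (h0 : IsChannel U0) (hD : DD e p U0 = D)
    (hopt : mutInfo p U0 = Rr e p D) (hlam : HasDerivAt (fun D' => Rr e p D') (-lam) D)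
    (hQd : Q = fun z => ∑ y, p y * U0 y z) : ∀ z, ∑ y, p y * kk lam e Q y z ≤ 1 := by
  intro z0
  have hQ : IsPmf Q := hQd ▸ out_pmf hp h0
  have ht := red_tilt hp h0 hD hopt hlam hQd
  have hv := red_val h0 hD hQd ht
  have hd : HasDerivAt (fun s : ℝ => ∑ y, p y * log ((1 - s) * SS lam e Q y + s * exp (-(lam * e y z0))))
      (∑ y, p y * (kk lam e Q y z0 - 1)) 0 := by
    apply HasDerivAt.fun_sum
    intro y _
    have hS := SS_pos (lam := lam) (e := e) hQ y
    have h1 : HasDerivAt (fun s : ℝ => (1 - s) * SS lam e Q y + s * exp (-(lam * e y z0)))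
        (- SS lam e Q y + exp (-(lam * e y z0))) 0 := by
      have a := ((hasDerivAt_id (0 : ℝ)).const_sub 1).mul_const (SS lam e Q y)
      have b := (hasDerivAt_id (0 : ℝ)).mul_const (exp (-(lam * e y z0)))
      simpa using a.fun_add b
    have h2 := (h1.log (by simpa using hS.ne')).const_mul (p y)
    refine h2.congr_deriv ?_
    rw [kk_eq hQ]
    simp
    left
    field_simp; ring
  have := deriv_le_of hd (c := 0) (fun s hs0 hs1 => by
    have hQ' : IsPmf (fun z => (1 - s) * Q z + s * (if z = z0 then 1 else 0)) := by
      refine ⟨fun z => ?_, ?_⟩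
      · have := hQ.1 z
        have h1s : 0 ≤ 1 - s := by linarith
        beta_reduce; split_ifs <;> positivity
      · rw [Finset.sum_add_distrib, ← Finset.mul_sum, hQ.2, ← Finset.mul_sum]; simp
    have h1 := kktF hp h0 hD hopt hlam hQ'
    have hS : ∀ y, SS lam e (fun z => (1 - s) * Q z + s * (if z = z0 then 1 else 0)) y =
        (1 - s) * SS lam e Q y + s * exp (-(lam * e y z0)) := by
      intro y
      unfold SS
      simp only [add_mul, Finset.sum_add_distrib, mul_assoc]
      rw [← Finset.mul_sum, ← Finset.mul_sum]; simp
    simp only [hS] at h1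
    rw [hv] at h1
    simp at h1 ⊢
    linarith)
  have h2 : ∑ y, p y * (kk lam e Q y z0 - 1) = ∑ y, p y * kk lam e Q y z0 - 1 := by
    simp only [mul_sub, mul_one, Finset.sum_sub_distrib, hp.2]
  linarith

lemma red_delta (hQ : IsPmf Q) (hDm : ∀ z, D < ∑ y, p y * e y z) : D < DD e p (fun _ => Q) := by
  have h1 : DD e p (fun _ => Q) = ∑ z, Q z * ∑ y, p y * e y z := by
    unfold DD
    simp only [Finset.mul_sum]
    rw [Finset.sum_comm]
    apply Finset.sum_congr rfl; intro z _
    apply Finset.sum_congr rfl; intro y _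
    ring
  rw [h1]
  obtain ⟨z, _, hz⟩ : ∃ z ∈ Finset.univ, 0 < Q z := by
    apply Finset.exists_lt_of_sum_lt (f := fun _ => (0 : ℝ))
    rw [hQ.2]; simp
  have h2 : D = ∑ z, Q z * D := by rw [← Finset.sum_mul, hQ.2, one_mul]
  rw [h2]
  apply Finset.sum_lt_sum
  · intro z _; exact mul_le_mul_of_nonneg_left (hDm z).le (hQ.1 z)
  · exact ⟨z, Finset.mem_univ _, mul_lt_mul_of_pos_left (hDm z) hz⟩

lemma red_lam (hp : IsPmf p) (h0 : IsChannel U0) (hD : DD e p U0 = D)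
    (hopt : mutInfo p U0 = Rr e p D) (hlam : HasDerivAt (fun D' => Rr e p D') (-lam) D)
    (hDm : ∀ z, D < ∑ y, p y * e y z) : 0 < lam := by
  obtain ⟨Q, hQd⟩ : ∃ Q, Q = fun z => ∑ y, p y * U0 y z := ⟨_, rfl⟩
  have hQ : IsPmf Q := hQd ▸ out_pmf hp h0
  have hΔ := red_delta hQ hDm
  have hch : IsChannel (fun _ : 𝒴 => Q) := fun _ => hQ
  have h1 := kkt hp h0 hD hopt hlam hch
  have h2 := KT_upper hp hch (κ := fun _ _ => 1) (fun _ _ => one_pos) hQ (fun _ _ => by simp)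
  simp at h2
  have h3 := mi_nonneg hp h0
  have hl0 : 0 ≤ lam := by
    by_contra hneg
    push Not at hneg
    nlinarith
  refine lt_of_le_of_ne hl0 (fun hl => ?_)
  have ht := red_tilt hp h0 hD hopt hlam hQd
  have : DD e p U0 = DD e p (fun _ => Q) := by
    unfold DD
    apply Finset.sum_congr rfl; intro y _
    by_cases hy : p y = 0
    · rw [hy]; ring
    congr 1
    apply Finset.sum_congr rfl; intro z _
    rw [ht y z hy]
    have : kk lam e Q y z = 1 := by
      rw [kk_eq hQ]; unfold SS; rw [← hl]; simp [hQ.2]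
    rw [this, mul_one]
  linarith

end red
end

open scoped BigOperators
noncomputable section
open Real Set Filter Topology
set_option linter.unusedSectionVars false

section red
variable {𝒴 Xh : Type} [Fintype 𝒴] [Fintype Xh]
variable {q p : 𝒴 → ℝ} {U U0 : 𝒴 → Xh → ℝ} {e : 𝒴 → Xh → ℝ} {Q : Xh → ℝ} {D lam : ℝ}

/-- support stability -/
def Supp (e : 𝒴 → Xh → ℝ) (p : 𝒴 → ℝ) (Q : Xh → ℝ) (D : ℝ) : Prop :=
  ∀ᶠ q in 𝓝 p, (∀ y, p y = 0 → q y = 0) → (∀ y, 0 ≤ q y) → ∀ U : 𝒴 → Xh → ℝ, IsChannel U →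
    DD e q U ≤ D → mutInfo q U = Rr e q D → ∀ z, (0 < ∑ y, q y * U y z) ↔ 0 < Q z

lemma red_hm [DecidableEq Xh] (hp : IsPmf p) (hQ : IsPmf Q) (hlam : 0 < lam) (hD0 : 0 < D)
    (hD : DD e p (fun y z => Q z * kk lam e Q y z) = D)
    (hle : ∀ z, ∑ y, p y * kk lam e Q y z ≤ 1)
    (hone : ∀ z, Q z ≠ 0 → ∑ y, p y * kk lam e Q y z = 1)
    (hs : Supp e p Q D) : ∀ z, Q z = 0 → ∑ y, p y * kk lam e Q y z < 1 := by
  intro z0 hz0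
  by_contra hcon
  have hm0 : ∑ y, p y * kk lam e Q y z0 = 1 := le_antisymm (hle z0) (not_lt.1 hcon)
  obtain ⟨δ, hδ⟩ : ∃ x, x = ∑ y, p y * (kk lam e Q y z0 * e y z0) := ⟨_, rfl⟩
  have hkp : ∀ y z, 0 < kk lam e Q y z := fun y z => Real.exp_pos _
  have hcD : Continuous (fun s : ℝ => (1 - s) * D + s * δ) := by fun_prop
  have hc : ContinuousAt (fun s : ℝ => fun y => D / ((1 - s) * D + s * δ) * (p y * ((1 - s) + s * kk lam e Q y z0))) 0 := by
    refine continuousAt_pi.2 fun y => ContinuousAt.mul (ContinuousAt.div continuousAt_const hcD.continuousAt ?_) ?_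
    · simpa using hD0.ne'
    · exact Continuous.continuousAt (by fun_prop)
  have hc0 : (fun y => D / ((1 - (0 : ℝ)) * D + 0 * δ) * (p y * ((1 - 0) + 0 * kk lam e Q y z0))) = p := by
    ext y; simp [hD0.ne']
  have hev : ∀ᶠ s in 𝓝 (0 : ℝ), 0 < (1 - s) * D + s * δ :=
    hcD.continuousAt.eventually (lt_mem_nhds (by simpa using hD0))
  have hc1 : Tendsto (fun s : ℝ => fun y => D / ((1 - s) * D + s * δ) * (p y * ((1 - s) + s * kk lam e Q y z0))) (𝓝 0) (𝓝 p) := by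
    have := hc.tendsto
    rw [hc0] at this
    exact this
  have hev2 := hc1.eventually hs
  have hev3 : ∀ᶠ s in 𝓝[>] (0 : ℝ), s ∈ Ioo (0 : ℝ) 1 := Ioo_mem_nhdsGT (show (0 : ℝ) < 1 by norm_num)
  obtain ⟨s, ⟨hs0, hs1⟩, hDs, hfin⟩ := (hev3.and ((hev.and hev2).filter_mono nhdsWithin_le_nhds)).exists
  obtain ⟨t, ht⟩ : ∃ x, x = D / ((1 - s) * D + s * δ) := ⟨_, rfl⟩
  have htp : 0 < t := by rw [ht]; positivity
  have htD : t * ((1 - s) * D + s * δ) = D := by rw [ht]; exact div_mul_cancel₀ _ hDs.ne'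
  have h1s : 0 < 1 - s := by linarith
  obtain ⟨r, hr⟩ : ∃ r : 𝒴 → ℝ, ∀ y, r y = (1 - s) + s * kk lam e Q y z0 := ⟨_, fun _ => rfl⟩
  have hrp : ∀ y, 0 < r y := fun y => by rw [hr]; have := hkp y z0; positivity
  obtain ⟨Qs, hQs⟩ : ∃ Qs : Xh → ℝ, ∀ z, Qs z = (1 - s) * Q z + s * (if z = z0 then 1 else 0) := ⟨_, fun _ => rfl⟩
  have hQs0 : ∀ z, 0 ≤ Qs z := fun z => by
    rw [hQs]; have := hQ.1 z; split_ifs <;> positivity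
  have hsum : ∀ (f : Xh → ℝ), ∑ z, Qs z * f z = (1 - s) * ∑ z, Q z * f z + s * f z0 := by
    intro f
    simp only [hQs, add_mul, Finset.sum_add_distrib, mul_assoc]
    rw [← Finset.mul_sum, ← Finset.mul_sum]; simp
  rw [← ht] at hfin
  simp only [← hr] at hfin
  have hq0 : ∀ y, 0 ≤ t * (p y * r y) := fun y => by have := hp.1 y; have := hrp y; positivity
  have hch : IsChannel (fun y z => Qs z * kk lam e Q y z / r y) := by
    intro y
    refine ⟨fun z => div_nonneg (mul_nonneg (hQs0 z) (hkp y z).le) (hrp y).le, ?_⟩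
    rw [← Finset.sum_div, hsum, (kk_ch hQ y).2, mul_one, ← hr, div_self (hrp y).ne']
  have hexp : ∀ y z, exp ((-log (SS lam e Q y) - log (r y) - log t) - lam * e y z) = kk lam e Q y z / (r y * t) := by
    intro y z
    have : (-log (SS lam e Q y) - log (r y) - log t) - lam * e y z = (-log (SS lam e Q y) - lam * e y z) - (log (r y) + log t) := by ring
    rw [this, Real.exp_sub, Real.exp_add, Real.exp_log (hrp y), Real.exp_log htp]
    rfl
  have hmm : ∀ z, ∑ y, t * (p y * r y) * exp ((-log (SS lam e Q y) - log (r y) - log t) - lam * e y z) =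
      ∑ y, p y * kk lam e Q y z := by
    intro z
    apply Finset.sum_congr rfl; intro y _
    rw [hexp]
    have := hrp y
    field_simp
  have hUA : ∀ y z, t * (p y * r y) ≠ 0 → Qs z * kk lam e Q y z / r y =
      (t * Qs z) * exp ((-log (SS lam e Q y) - log (r y) - log t) - lam * e y z) := by
    intro y z _
    rw [hexp]
    have := hrp y
    field_simp
  have hA : ∀ z, t * Qs z ≠ 0 → ∑ y, t * (p y * r y) * exp ((-log (SS lam e Q y) - log (r y) - log t) - lam * e y z) = 1 := by
    intro z hz
    rw [hmm]
    by_cases h : Q z = 0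
    · by_cases h' : z = z0
      · rw [h', hm0]
      · exfalso; apply hz; rw [hQs, h, if_neg h']; ring
    · exact hone z h
  have hDD : DD e (fun y => t * (p y * r y)) (fun y z => Qs z * kk lam e Q y z / r y) = D := by
    rw [← htD, ← hD, hδ]
    unfold DD
    rw [Finset.mul_sum, Finset.mul_sum, ← Finset.sum_add_distrib, Finset.mul_sum]
    apply Finset.sum_congr rfl; intro y _
    have h1 : ∑ z, Qs z * kk lam e Q y z / r y * e y z = (∑ z, Qs z * (kk lam e Q y z * e y z)) / r y := by
      rw [Finset.sum_div]; apply Finset.sum_congr rfl; intro z _; ring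
    rw [h1, hsum]
    have h2 : ∑ z, Q z * kk lam e Q y z * e y z = ∑ z, Q z * (kk lam e Q y z * e y z) :=
      Finset.sum_congr rfl fun z _ => by ring
    rw [h2]
    have := hrp y
    field_simp
  have hopt := Rr_eq hq0 hch hlam.le (fun z => by rw [hmm]; exact hle z) hUA hA hDD
  have hout := KT_out (κ := fun y z => exp ((-log (SS lam e Q y) - log (r y) - log t) - lam * e y z)) hUA hA z0
  have := (hfin (fun y hy => by rw [hy]; ring) hq0 _ hch hDD.le hopt z0).1 (by
    rw [hout, hQs, hz0, if_pos rfl]; simp; positivity)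
  exact absurd hz0 this.ne'

lemma red_uniq (hp : IsPmf p) (hQ : IsPmf Q) (hlam : 0 < lam)
    (hD : DD e p (fun y z => Q z * kk lam e Q y z) = D)
    (hle : ∀ z, ∑ y, p y * kk lam e Q y z ≤ 1)
    (hone : ∀ z, Q z ≠ 0 → ∑ y, p y * kk lam e Q y z = 1)
    (hs : Supp e p Q D) (a : Xh → ℝ) (ha0 : ∀ z, Q z = 0 → a z = 0)
    (ha1 : ∀ y, ∑ z, a z * (p y * kk lam e Q y z) = 0)
    (ha2 : ∑ z, a z * (∑ y, p y * kk lam e Q y z * e y z) = 0) : a = 0 := by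
  classical
  by_contra hne
  have hsum : ∑ z, a z = 0 := by
    have h1 : ∑ y, ∑ z, a z * (p y * kk lam e Q y z) = 0 := Finset.sum_eq_zero fun y _ => ha1 y
    rw [Finset.sum_comm] at h1
    rw [← h1]
    apply Finset.sum_congr rfl; intro z _
    rw [← Finset.mul_sum]
    by_cases h : Q z = 0
    · rw [ha0 z h]; ring
    · rw [hone z h, mul_one]
  have hneg : ∃ z, a z < 0 := by
    by_contra hcon
    push Not at hcon
    apply hne
    ext z
    exact (Finset.sum_eq_zero_iff_of_nonneg (fun z _ => hcon z)).1 hsum z (Finset.mem_univ z)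
  have hN : (Finset.univ.filter (fun z => a z < 0)).Nonempty := by
    obtain ⟨z, hz⟩ := hneg
    exact ⟨z, by simpa using hz⟩
  obtain ⟨z1, hz1, hmin⟩ := Finset.exists_min_image _ (fun z => Q z / (- a z)) hN
  have hz1' : a z1 < 0 := by simpa using hz1
  have hQ1 : 0 < Q z1 := lt_of_le_of_ne (hQ.1 z1) (fun h => hz1'.ne (ha0 z1 h.symm))
  obtain ⟨s, hsd⟩ : ∃ s, s = Q z1 / (- a z1) := ⟨_, rfl⟩
  have hs0 : 0 < s := by rw [hsd]; exact div_pos hQ1 (by linarith)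
  have hA0 : ∀ z, 0 ≤ Q z + s * a z := by
    intro z
    by_cases hz : a z < 0
    · have := hmin z (by simpa using hz)
      rw [← hsd, le_div_iff₀ (by linarith)] at this
      linarith
    · push Not at hz
      have := hQ.1 z
      positivity
  have hAz1 : Q z1 + s * a z1 = 0 := by
    rw [hsd]; have : a z1 ≠ 0 := hz1'.ne; field_simp; ring
  have hay : ∀ y, p y ≠ 0 → ∑ z, a z * kk lam e Q y z = 0 := by
    intro y hy
    have := ha1 y
    have h2 : ∑ z, a z * (p y * kk lam e Q y z) = p y * ∑ z, a z * kk lam e Q y z := by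
      rw [Finset.mul_sum]; exact Finset.sum_congr rfl fun z _ => by ring
    rw [h2] at this
    exact (mul_eq_zero.1 this).resolve_left hy
  have hkp : ∀ y z, 0 < kk lam e Q y z := fun y z => Real.exp_pos _
  obtain ⟨U, hU⟩ : ∃ U : 𝒴 → Xh → ℝ, ∀ y z, U y z = if p y = 0 then Q z else (Q z + s * a z) * kk lam e Q y z :=
    ⟨fun y z => if p y = 0 then Q z else (Q z + s * a z) * kk lam e Q y z, fun _ _ => rfl⟩
  have hch : IsChannel U := by
    intro y
    by_cases hy : p y = 0
    · simp only [hU, if_pos hy]; exact hQ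
    · simp only [hU, if_neg hy]
      refine ⟨fun z => mul_nonneg (hA0 z) (hkp y z).le, ?_⟩
      simp only [add_mul, Finset.sum_add_distrib, mul_assoc]
      rw [← Finset.mul_sum, hay y hy, (kk_ch hQ y).2]; ring
  have hUA : ∀ y z, p y ≠ 0 → U y z = (Q z + s * a z) * exp (-log (SS lam e Q y) - lam * e y z) := by
    intro y z hy
    rw [hU, if_neg hy]; rfl
  have hA : ∀ z, Q z + s * a z ≠ 0 → ∑ y, p y * exp (-log (SS lam e Q y) - lam * e y z) = 1 := by
    intro z hz
    apply hone z
    intro h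
    apply hz
    rw [h, ha0 z h]; ring
  have hDD : DD e p U = D := by
    have h1 : DD e p U = DD e p (fun y z => Q z * kk lam e Q y z) + s * ∑ z, a z * (∑ y, p y * kk lam e Q y z * e y z) := by
      simp only [Finset.mul_sum (s := (Finset.univ : Finset 𝒴))]
      rw [Finset.sum_comm, Finset.mul_sum]
      unfold DD
      rw [← Finset.sum_add_distrib]
      apply Finset.sum_congr rfl; intro y _
      by_cases hy : p y = 0
      · simp [hy]
      rw [Finset.mul_sum, Finset.mul_sum, Finset.mul_sum, ← Finset.sum_add_distrib]
      apply Finset.sum_congr rfl; intro z _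
      rw [hU, if_neg hy]; ring
    rw [h1, ha2, hD]; ring
  have hopt := Rr_eq hp.1 hch hlam.le hle hUA hA hDD
  have hout := KT_out (κ := fun y z => exp (-log (SS lam e Q y) - lam * e y z)) hUA hA z1
  have := (hs.self_of_nhds (fun _ h => h) hp.1 U hch hDD.le hopt z1).2 hQ1
  rw [hout, hAz1] at this
  exact lt_irrefl _ this

end red
end

open scoped BigOperators
noncomputable section
open Real Set Filter Topology
set_option linter.unusedSectionVars false

section fin
variable {𝒳 𝒴 Xh : Type} [Fintype 𝒳] [Fintype 𝒴] [Fintype Xh]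
variable {P : 𝒳 → ℝ} {V : 𝒳 → 𝒴 → ℝ}

/-- backward channel, completed at the letters of probability zero -/
def bw (P : 𝒳 → ℝ) (V : 𝒳 → 𝒴 → ℝ) (y : 𝒴) (x : 𝒳) : ℝ :=
  open Classical in if PYof P V y = 0 then P x else condPXgY P V x y

lemma py_pmf (hP : IsPmf P) (hV : IsChannel V) : IsPmf (PYof P V) := by
  refine ⟨fun y => Finset.sum_nonneg fun x _ => mul_nonneg (hP.1 x) ((hV x).1 y), ?_⟩
  unfold PYof
  rw [Finset.sum_comm, ← hP.2]
  apply Finset.sum_congr rfl; intro x _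
  rw [← Finset.mul_sum, (hV x).2, mul_one]

lemma bw_mul (hP : IsPmf P) (hV : IsChannel V) (x : 𝒳) (y : 𝒴) : P x * V x y = PYof P V y * bw P V y x := by
  unfold bw
  split_ifs with h
  · rw [h, zero_mul]
    exact (Finset.sum_eq_zero_iff_of_nonneg (fun x _ => mul_nonneg (hP.1 x) ((hV x).1 y))).1 h x (Finset.mem_univ x)
  · unfold condPXgY; field_simp

lemma bw_ch (hP : IsPmf P) (hV : IsChannel V) : IsChannel (bw P V) := by
  intro y
  unfold bw
  split_ifs with h
  · exact hP
  · refine ⟨fun x => div_nonneg (mul_nonneg (hP.1 x) ((hV x).1 y)) ((py_pmf hP hV).1 y), ?_⟩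
    unfold condPXgY
    rw [← Finset.sum_div]
    exact div_self h

/-- averaged distortion -/
def ed (P : 𝒳 → ℝ) (V : 𝒳 → 𝒴 → ℝ) (d : 𝒳 → Xh → ℝ) (y : 𝒴) (z : Xh) : ℝ := mn (bw P V y) (fun x => d x z)

lemma DD_ed (d : 𝒳 → Xh → ℝ) {q : 𝒴 → ℝ} (hq : ∀ y, PYof P V y = 0 → q y = 0) (U : 𝒴 → Xh → ℝ) :
    ∑ y, ∑ x, ∑ z, q y * condPXgY P V x y * U y z * d x z = DD (ed P V d) q U := by
  unfold DD
  apply Finset.sum_congr rfl; intro y _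
  by_cases hy : q y = 0
  · simp [hy]
  have hpy : PYof P V y ≠ 0 := fun h => hy (hq y h)
  rw [Finset.sum_comm, Finset.mul_sum]
  apply Finset.sum_congr rfl; intro z _
  unfold ed mn bw
  rw [Finset.mul_sum, Finset.mul_sum]
  apply Finset.sum_congr rfl; intro x _
  rw [if_neg hpy]; ring

lemma RN_ed (d : 𝒳 → Xh → ℝ) {q : 𝒴 → ℝ} (hq : ∀ y, PYof P V y = 0 → q y = 0) (D : ℝ) :
    RN q (condPXgY P V) d D = Rr (ed P V d) q D := by
  unfold RN Rr
  simp only [DD_ed d hq]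

lemma DD_opt (hP : IsPmf P) (hV : IsChannel V) (d : 𝒳 → Xh → ℝ) (U : 𝒴 → Xh → ℝ) :
    ∑ x, ∑ y, ∑ z, P x * V x y * U y z * d x z = DD (ed P V d) (PYof P V) U := by
  unfold DD
  rw [Finset.sum_comm]
  apply Finset.sum_congr rfl; intro y _
  rw [Finset.sum_comm, Finset.mul_sum]
  apply Finset.sum_congr rfl; intro z _
  unfold ed mn
  rw [Finset.mul_sum, Finset.mul_sum]
  apply Finset.sum_congr rfl; intro x _
  rw [bw_mul hP hV]; ring

lemma ed_max (hP : IsPmf P) (hV : IsChannel V) (d : 𝒳 → Xh → ℝ) (z : Xh) :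
    ∑ y, PYof P V y * ed P V d y z = ∑ x, P x * d x z := by
  unfold ed mn
  simp only [Finset.mul_sum]
  rw [Finset.sum_comm]
  apply Finset.sum_congr rfl; intro x _
  have : ∀ y, PYof P V y * (bw P V y x * d x z) = P x * d x z * V x y := fun y => by
    rw [← mul_assoc, ← bw_mul hP hV]; ring
  simp only [this]
  rw [← Finset.mul_sum, (hV x).2, mul_one]

end fin

theorem noisy_main
    {𝒳 𝒴 Xh : Type} [Fintype 𝒳] [Fintype 𝒴] [Fintype Xh] [Nonempty Xh]
    (P : 𝒳 → ℝ) (hP0 : ∀ x, 0 ≤ P x) (hP1 : ∑ x, P x = 1)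
    (V : 𝒳 → 𝒴 → ℝ) (hV : IsChannel V)
    (d : 𝒳 → Xh → ℝ) (hd : ∀ x z, 0 ≤ d x z)
    (dmax : ℝ) (hdmax : ∀ x z, d x z ≤ dmax)
    (D : ℝ)
    (hDmin : (∑ y, ⨅ z, ∑ x, P x * V x y * d x z) < D)
    (hDmax : D < ⨅ z, ∑ x, P x * d x z)
    (Uopt : 𝒴 → Xh → ℝ) (hUch : IsChannel Uopt)
    (hUd : (∑ x, ∑ y, ∑ z, P x * V x y * Uopt y z * d x z) = D)
    (hUopt : mutInfo (PYof P V) Uopt = RN (PYof P V) (condPXgY P V) d D)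
    (lam : ℝ)
    (hlam : HasDerivAt (fun D' => RN (PYof P V) (condPXgY P V) d D') (-lam) D)
    (hsupp : ∀ᶠ q in nhds (PYof P V), ∀ U : 𝒴 → Xh → ℝ, IsChannel U →
      (∑ y, ∑ x, ∑ z, q y * condPXgY P V x y * U y z * d x z) ≤ D →
      mutInfo q U = RN q (condPXgY P V) d D →
      ∀ z, (0 < ∑ y, q y * U y z) ↔ 0 < outMarg (PYof P V) Uopt z)
    (hVd : 0 < varF3 P V Uopt (jNoisy Uopt (outMarg (PYof P V) Uopt) d lam D))
    (ε : ℝ) (z : ℝ) (hz : gaussQ z = ε) :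
    ∃ C > (0 : ℝ), ∃ n₀ : ℕ, ∀ n ≥ n₀,
      |Real.log (MstarNoisy P V d n D ε)
          - (n * RN (PYof P V) (condPXgY P V) d D
              + Real.sqrt
                  (n * varF3 P V Uopt (jNoisy Uopt (outMarg (PYof P V) Uopt) d lam D))
                * z)| ≤
        C * Real.log n := by
  classical
  have hP : IsPmf P := ⟨hP0, hP1⟩
  have hp := py_pmf hP hV
  have hD0 : 0 < D := by
    refine lt_of_le_of_lt (Finset.sum_nonneg fun y _ => ?_) hDmin
    exact Real.iInf_nonneg fun z => Finset.sum_nonneg fun x _ =>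
      mul_nonneg (mul_nonneg (hP0 x) ((hV x).1 y)) (hd x z)
  have hDm : ∀ z, D < ∑ y, PYof P V y * ed P V d y z := by
    intro z
    rw [ed_max hP hV]
    exact lt_of_lt_of_le hDmax (ciInf_le (Set.finite_range _).bddBelow z)
  have hDD : DD (ed P V d) (PYof P V) Uopt = D := by rw [← DD_opt hP hV, hUd]
  have hRN : ∀ D', RN (PYof P V) (condPXgY P V) d D' = Rr (ed P V d) (PYof P V) D' :=
    fun D' => RN_ed d (fun _ h => h) D'
  simp only [hRN] at hlam
  have hopt := hUopt
  rw [hRN] at hopt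
  obtain ⟨Q, hQd⟩ : ∃ Q : Xh → ℝ, Q = outMarg (PYof P V) Uopt := ⟨_, rfl⟩
  have hQd' : Q = fun z => ∑ y, PYof P V y * Uopt y z := hQd
  rw [← hQd] at hsupp hVd ⊢
  have hQ : IsPmf Q := hQd' ▸ out_pmf hp hUch
  have hs : Supp (ed P V d) (PYof P V) Q D := by
    unfold Supp
    filter_upwards [hsupp] with q hq hq0 _ U hU h1 h2
    exact hq U hU (by rw [DD_ed d hq0]; exact h1) (by rw [RN_ed d hq0]; exact h2)
  have hl := red_lam hp hUch hDD hopt hlam hDm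
  have ht := red_tilt hp hUch hDD hopt hlam hQd'
  have hle := red_le hp hUch hDD hopt hlam hQd'
  have hone := red_one hQd' ht
  have hval := red_val hUch hDD hQd' ht
  have hDQ : DD (ed P V d) (PYof P V) (fun y z => Q z * kk lam (ed P V d) Q y z) = D := by
    rw [← hDD]; unfold DD
    apply Finset.sum_congr rfl; intro y _
    by_cases hy : PYof P V y = 0
    · rw [hy]; ring
    · congr 1; apply Finset.sum_congr rfl; intro z _
      rw [ht y z hy]
  obtain ⟨c, hc⟩ : ∃ c : Core 𝒳 𝒴 Xh, c = {
    p := PYof P V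
    hp := hp
    W := bw P V
    hW := bw_ch hP hV
    d := d
    dm := |dmax| + 1
    dm0 := by positivity
    hdm := fun x z => by
      rw [abs_of_nonneg (hd x z)]; linarith [hdmax x z, le_abs_self dmax]
    Q := Q
    hQ := hQ
    lam := lam
    lam0 := hl
    D := D } := ⟨_, rfl⟩
  have cp : c.p = PYof P V := by rw [hc]
  have cW : c.W = bw P V := by rw [hc]
  have cd : c.d = d := by rw [hc]
  have cQ : c.Q = Q := by rw [hc]
  have cl : c.lam = lam := by rw [hc]
  have cD : c.D = D := by rw [hc]
  have cdb : c.db = ed P V d := by rw [hc]; rfl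
  have cker : c.ker = kk lam (ed P V d) Q := by rw [hc]; rfl
  have cbe : c.be = fun y => -log (SS lam (ed P V d) Q y) := by rw [hc]; rfl
  have cU : c.U = fun y z => Q z * kk lam (ed P V d) Q y z := by
    ext y z; unfold Core.U; rw [cQ, cker]
  have cww : ∀ y z, c.ww z y = PYof P V y * kk lam (ed P V d) Q y z := by
    intro y z; unfold Core.ww; rw [cp, cker]
  have hR : c.R = RN (PYof P V) (condPXgY P V) d D := by
    rw [← hUopt, hval]; unfold Core.R mn; rw [cp, cbe, cl, cD]
  -- the variance
  have hj : ∀ x y z, P x * V x y * Uopt y z = c.pyzx ((y, z), x) ∧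
      (P x * V x y * Uopt y z ≠ 0 → jNoisy Uopt Q d lam D x y z = c.j3 ((y, z), x)) := by
    intro x y z
    constructor
    · unfold Core.pyzx Core.pyz
      simp only [cp, cW, cU]
      rw [bw_mul hP hV]
      by_cases hy : PYof P V y = 0
      · rw [hy]; ring
      · rw [ht y z hy]; ring
    · intro hne
      have hy : PYof P V y ≠ 0 := by
        intro h; apply hne; rw [bw_mul hP hV, h]; ring
      have hu : Uopt y z ≠ 0 := by intro h; apply hne; rw [h]; ring
      have hqz : Q z ≠ 0 := by
        intro h; apply hu; rw [ht y z hy, h, zero_mul]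
      unfold jNoisy Core.j3
      simp only [cbe, cl, cD, cd, cdb]
      rw [ht y z hy, mul_div_cancel_left₀ _ hqz]
      unfold kk
      rw [Real.log_exp]; ring
  have hsum : ∀ F : (𝒴 × Xh) × 𝒳 → ℝ, ∑ x, ∑ y, ∑ z, F ((y, z), x) = ∑ t, F t := by
    intro F
    rw [Fintype.sum_prod_type, Fintype.sum_prod_type, Finset.sum_comm]
    apply Finset.sum_congr rfl; intro y _
    rw [Finset.sum_comm]
  have hmean : meanF3 P V Uopt (jNoisy Uopt Q d lam D) = mn c.pyzx c.j3 := by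
    unfold meanF3 mn
    rw [← hsum]
    apply Finset.sum_congr rfl; intro x _
    apply Finset.sum_congr rfl; intro y _
    apply Finset.sum_congr rfl; intro z _
    obtain ⟨h1, h2⟩ := hj x y z
    by_cases h : P x * V x y * Uopt y z = 0
    · rw [h1] at h ⊢; rw [h]; ring
    · rw [h2 h, h1]
  have hvar : varF3 P V Uopt (jNoisy Uopt Q d lam D) = c.Vt := by
    rw [← c.j3_var]
    unfold varF3 vr
    rw [← hsum, hmean]
    apply Finset.sum_congr rfl; intro x _
    apply Finset.sum_congr rfl; intro y _
    apply Finset.sum_congr rfl; intro z _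
    obtain ⟨h1, h2⟩ := hj x y z
    by_cases h : P x * V x y * Uopt y z = 0
    · rw [h1] at h ⊢; rw [h]; ring
    · rw [h2 h, h1]
  rw [hvar] at hVd ⊢
  have hOpt : c.Opt := by
    refine ⟨?_, ?_, ?_, ?_, ?_, hVd⟩
    · intro z hz
      simp only [cww]
      rw [cQ] at hz
      exact red_hm hp hQ hl hD0 hDQ hle hone hs z hz
    · intro z
      rw [cp, cU, cQ]
      have : ∀ y, PYof P V y * (Q z * kk lam (ed P V d) Q y z) = Q z * (PYof P V y * kk lam (ed P V d) Q y z) :=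
        fun y => by ring
      simp only [this]
      rw [← Finset.mul_sum]
      by_cases h : Q z = 0
      · rw [h]; ring
      · rw [hone z h, mul_one]
    · rw [cp, cU, cdb, cD]; exact hDQ
    · intro a h1 h2 h3
      simp only [cww, cQ, cdb] at h1 h2 h3
      exact red_uniq hp hQ hl hDQ hle hone hs a h1 h2 h3
    · rw [cp, cQ, cdb, cD]; exact red_delta hQ hDm
  obtain ⟨C, hC, n0, hfin⟩ := hOpt.final z ε (by unfold Phi; rw [hz])
  refine ⟨C, hC, max n0 1, fun n hn => ?_⟩
  have h1 := hfin n (le_of_max_le_left hn)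
  have h2 := Core.Mst_eq (c := c) P V (fun x y => by rw [cp, cW]; exact bw_mul hP hV x y) n (le_of_max_le_right hn) ε
  rw [cd, cD] at h2
  rw [h2, ← hR]
  exact h1

end

/-- **Second-order asymptotics for noisy lossy source coding.**  For a DMS `P` observed
through a DMC `V`, under the stated regularity assumptions, for every `ε ∈ (0,1)`,
`log M*(n,D,ε) = n R(P_{XY},D) + √(n Ṽ(P_{XY},D)) Q⁻¹(ε) + O(log n)`. -/
theorem noisy_second_order
    {𝒳 𝒴 Xh : Type} [Fintype 𝒳] [Fintype 𝒴] [Fintype Xh] [Nonempty Xh]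
    (P : 𝒳 → ℝ) (hP0 : ∀ x, 0 ≤ P x) (hP1 : ∑ x, P x = 1)
    (V : 𝒳 → 𝒴 → ℝ) (hV : IsChannel V)
    (d : 𝒳 → Xh → ℝ) (hd : ∀ x z, 0 ≤ d x z)
    (dmax : ℝ) (hdmax : ∀ x z, d x z ≤ dmax)
    (D : ℝ)
    (hDmin : (∑ y, ⨅ z, ∑ x, P x * V x y * d x z) < D)
    (hDmax : D < ⨅ z, ∑ x, P x * d x z)
    (hreg : ContDiffAt ℝ 2 (fun q : 𝒴 → ℝ => RN q (condPXgY P V) d D) (PYof P V))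
    (Uopt : 𝒴 → Xh → ℝ) (hUch : IsChannel Uopt)
    (hUd : (∑ x, ∑ y, ∑ z, P x * V x y * Uopt y z * d x z) = D)
    (hUopt : mutInfo (PYof P V) Uopt = RN (PYof P V) (condPXgY P V) d D)
    (lam : ℝ)
    (hlam : HasDerivAt (fun D' => RN (PYof P V) (condPXgY P V) d D') (-lam) D)
    (hsupp : ∀ᶠ q in nhds (PYof P V), ∀ U : 𝒴 → Xh → ℝ, IsChannel U →
      (∑ y, ∑ x, ∑ z, q y * condPXgY P V x y * U y z * d x z) ≤ D →
      mutInfo q U = RN q (condPXgY P V) d D →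
      ∀ z, (0 < ∑ y, q y * U y z) ↔ 0 < outMarg (PYof P V) Uopt z)
    (hVd : 0 < varF3 P V Uopt (jNoisy Uopt (outMarg (PYof P V) Uopt) d lam D))
    (ε : ℝ) (hε : ε ∈ Set.Ioo (0 : ℝ) 1) (z : ℝ) (hz : gaussQ z = ε) :
    ∃ C > (0 : ℝ), ∃ n₀ : ℕ, ∀ n ≥ n₀,
      |Real.log (MstarNoisy P V d n D ε)
          - (n * RN (PYof P V) (condPXgY P V) d D
              + Real.sqrt
                  (n * varF3 P V Uopt (jNoisy Uopt (outMarg (PYof P V) Uopt) d lam D))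
                * z)| ≤
        C * Real.log n := by
  exact noisy_main P hP0 hP1 V hV d hd dmax hdmax D hDmin hDmax Uopt hUch hUd hUopt lam hlam
    hsupp hVd ε z hz

end
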